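/- (Davenport–Heilbronn) As X → ∞, the sum of |Cl_K[3]| over all quadratic subfields K of ℂ with D_K ≤ X is asymptotic to (2/(3ζ(2)) + 1/ζ(2)) · X = (10/π²) · X; that is, (1/X) · Σ_{[K:ℚ]=2, D_K ≤ X} |Cl_K[3]| tends to 10/π². -/

import Mathlib

section frozen

open NumberField
open scoped Classical

/-- The order of the `ℓ`-torsion subgroup of the class group of a number field `K`. -/
noncomputable def clTor (K : Type*) [Field K] (ℓ : ℕ) : ℕ :=
  Nat.card {c : ClassGroup (𝓞 K) // c ^ ℓ = 1}

/-- The absolute value of the discriminant of a finite extension of `ℚ` realized as a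
subfield of `ℂ` (junk value `0` if the extension is infinite). -/
noncomputable def absDiscC (K : IntermediateField ℚ ℂ) : ℕ :=
  if h : FiniteDimensional ℚ K then
    haveI := h
    haveI : NumberField K := ⟨⟩
    (NumberField.discr K).natAbs
  else 0

end frozen

namespace DH

/-- Discriminant (suitably normalised) of the form `ax³+3bx²y+3cxy²+dy³`. -/
def fdisc {R : Type*} [CommRing R] (f : Fin 4 → R) : R :=
  f 0 ^ 2 * f 3 ^ 2 - 6 * f 0 * f 1 * f 2 * f 3 - 3 * f 1 ^ 2 * f 2 ^ 2
    + 4 * f 0 * f 2 ^ 3 + 4 * f 1 ^ 3 * f 3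

def hA {R : Type*} [CommRing R] (f : Fin 4 → R) : R := f 1 ^ 2 - f 0 * f 2
def hB {R : Type*} [CommRing R] (f : Fin 4 → R) : R := f 0 * f 3 - f 1 * f 2
def hC {R : Type*} [CommRing R] (f : Fin 4 → R) : R := f 2 ^ 2 - f 1 * f 3
def cG0 {R : Type*} [CommRing R] (f : Fin 4 → R) : R :=
  2 * f 1 ^ 3 - 3 * f 0 * f 1 * f 2 + f 0 ^ 2 * f 3
def cG1 {R : Type*} [CommRing R] (f : Fin 4 → R) : R :=
  f 1 ^ 2 * f 2 - 2 * f 0 * f 2 ^ 2 + f 0 * f 1 * f 3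

/-- Substitution `(x,y) ↦ (px+qy, rx+sy)`. -/
def act {R : Type*} [CommRing R] (p q r s : R) (f : Fin 4 → R) : Fin 4 → R :=
  ![f 0 * p ^ 3 + 3 * f 1 * p ^ 2 * r + 3 * f 2 * p * r ^ 2 + f 3 * r ^ 3,
    f 0 * p ^ 2 * q + f 1 * (p ^ 2 * s + 2 * p * q * r) + f 2 * (2 * p * r * s + q * r ^ 2)
      + f 3 * r ^ 2 * s,
    f 0 * p * q ^ 2 + f 1 * (2 * p * q * s + q ^ 2 * r) + f 2 * (p * s ^ 2 + 2 * q * r * s)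
      + f 3 * r * s ^ 2,
    f 0 * q ^ 3 + 3 * f 1 * q ^ 2 * s + 3 * f 2 * q * s ^ 2 + f 3 * s ^ 3]

def feval {R : Type*} [CommRing R] (f : Fin 4 → R) (x y : R) : R :=
  f 0 * x ^ 3 + 3 * f 1 * x ^ 2 * y + 3 * f 2 * x * y ^ 2 + f 3 * y ^ 3

section
variable {R : Type*} [CommRing R] (f : Fin 4 → R) (p q r s : R)

@[simp] lemma act_0 : act p q r s f 0 =
  f 0 * p ^ 3 + 3 * f 1 * p ^ 2 * r + 3 * f 2 * p * r ^ 2 + f 3 * r ^ 3 := rfl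
@[simp] lemma act_1 : act p q r s f 1 = f 0 * p ^ 2 * q + f 1 * (p ^ 2 * s + 2 * p * q * r) +
    f 2 * (2 * p * r * s + q * r ^ 2) + f 3 * r ^ 2 * s := rfl
@[simp] lemma act_2 : act p q r s f 2 = f 0 * p * q ^ 2 + f 1 * (2 * p * q * s + q ^ 2 * r)
    + f 2 * (p * s ^ 2 + 2 * q * r * s) + f 3 * r * s ^ 2 := rfl
@[simp] lemma act_3 : act p q r s f 3 =
  f 0 * q ^ 3 + 3 * f 1 * q ^ 2 * s + 3 * f 2 * q * s ^ 2 + f 3 * s ^ 3 := rfl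

lemma ext4 {α : Type*} {f g : Fin 4 → α} (h0 : f 0 = g 0) (h1 : f 1 = g 1) (h2 : f 2 = g 2)
    (h3 : f 3 = g 3) : f = g := by
  funext i; fin_cases i <;> assumption

lemma fdisc_eq : fdisc f = hB f ^ 2 - 4 * hA f * hC f := by
  simp only [fdisc, hA, hB, hC]; ring

lemma syzygy : cG0 f ^ 2 = f 0 ^ 2 * fdisc f + 4 * hA f ^ 3 := by
  simp only [fdisc, hA, cG0]; ring

lemma fdisc_act : fdisc (act p q r s f) = (p * s - q * r) ^ 6 * fdisc f := by
  simp only [fdisc, act_0, act_1, act_2, act_3]; ring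

lemma act_act (p' q' r' s' : R) : act p' q' r' s' (act p q r s f) =
    act (p * p' + q * r') (p * q' + q * s') (r * p' + s * r') (r * q' + s * s') f := by
  apply ext4 <;> simp only [act_0, act_1, act_2, act_3] <;> ring

lemma act_one : act 1 0 0 1 f = f := by
  apply ext4 <;> simp

lemma act_neg_one : act (-1) 0 0 (-1) f = -f := by
  apply ext4 <;> simp [pow_succ]

lemma feval_act (x y : R) : feval (act p q r s f) x y = feval f (p * x + q * y) (r * x + s * y) := by
  simp only [feval, act_0, act_1, act_2, act_3]; ring

lemma act_map {S : Type*} [CommRing S] (φ : R →+* S) :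
    (fun i => φ (act p q r s f i)) = act (φ p) (φ q) (φ r) (φ s) (fun i => φ (f i)) := by
  have h2 : φ 2 = 2 := map_ofNat φ 2
  have h3 : φ 3 = 3 := map_ofNat φ 3
  apply ext4 <;> simp [h2, h3]

lemma fdisc_map {S : Type*} [CommRing S] (φ : R →+* S) :
    fdisc (fun i => φ (f i)) = φ (fdisc f) := by
  have h6 : φ 6 = 6 := map_ofNat φ 6
  have h3 : φ 3 = 3 := map_ofNat φ 3
  have h4 : φ 4 = 4 := map_ofNat φ 4
  simp [fdisc, h3, h4, h6]
end

open Matrix in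
/-- action of `SL(2,ℤ)` -/
def gact (g : SpecialLinearGroup (Fin 2) ℤ) (f : Fin 4 → ℤ) : Fin 4 → ℤ :=
  act (g 0 0) (g 0 1) (g 1 0) (g 1 1) f

open Matrix in
lemma sl_det (g : SpecialLinearGroup (Fin 2) ℤ) : g 0 0 * g 1 1 - g 0 1 * g 1 0 = 1 := by
  have := g.det_coe
  rwa [Matrix.det_fin_two] at this

open Matrix in
lemma gact_mul (g h : SpecialLinearGroup (Fin 2) ℤ) (f : Fin 4 → ℤ) :
    gact (g * h) f = gact h (gact g f) := by
  have : ∀ i j, (g * h) i j = g i 0 * h 0 j + g i 1 * h 1 j := fun i j => by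
    change (g.1 * h.1) i j = _
    rw [Matrix.mul_apply, Fin.sum_univ_two]
  simp only [gact, act_act, this]

lemma gact_one (f : Fin 4 → ℤ) : gact 1 f = f := by
  simpa [gact] using act_one f

lemma gact_neg (g) (f : Fin 4 → ℤ) : gact (-g) f = - gact g f := by
  apply ext4 <;> simp [gact] <;> ring

lemma fdisc_gact (g) (f : Fin 4 → ℤ) : fdisc (gact g f) = fdisc f := by
  rw [gact, fdisc_act, sl_det]; simp

/-- Orbit equivalence. -/
def formSetoid : Setoid (Fin 4 → ℤ) where
  r f f' := ∃ g, gact g f = f'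
  iseqv := by
    refine ⟨fun f => ⟨1, gact_one f⟩, ?_, ?_⟩
    · rintro f _ ⟨g, rfl⟩
      exact ⟨g⁻¹, by rw [← gact_mul, mul_inv_cancel, gact_one]⟩
    · rintro f _ _ ⟨g, rfl⟩ ⟨h, rfl⟩
      exact ⟨g * h, gact_mul g h f⟩

def Orb : Type := Quotient formSetoid
def toOrb (f : Fin 4 → ℤ) : Orb := Quotient.mk formSetoid f

lemma toOrb_eq {f f' : Fin 4 → ℤ} : toOrb f = toOrb f' ↔ ∃ g, gact g f = f' :=
  Quotient.eq (r := formSetoid)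

lemma toOrb_gact (g) (f : Fin 4 → ℤ) : toOrb (gact g f) = toOrb f :=
  (toOrb_eq.2 ⟨g, rfl⟩).symm

lemma toOrb_surj : Function.Surjective toOrb := Quotient.mk_surjective

lemma fdisc_of_toOrb {f f' : Fin 4 → ℤ} (h : toOrb f = toOrb f') : fdisc f = fdisc f' := by
  obtain ⟨g, rfl⟩ := toOrb_eq.1 h
  exact (fdisc_gact g f).symm

/-- Fundamental discriminants at `p` -/
def FundAt (p : ℕ) (D : ℤ) : Prop :=
  if p = 2 then D % 4 = 1 ∨ D % 16 = 8 ∨ D % 16 = 12 else ¬ ((p : ℤ) ^ 2 ∣ D)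

/-- `D` is a fundamental discriminant (possibly `1`). -/
def Fund (D : ℤ) : Prop := ∀ p : ℕ, p.Prime → FundAt p D

end DH

namespace DH
set_option linter.unusedSectionVars false

def cG2 {R : Type*} [CommRing R] (f : Fin 4 → R) : R :=
  -(f 2 ^ 2 * f 1 - 2 * f 3 * f 1 ^ 2 + f 3 * f 2 * f 0)
def cG3 {R : Type*} [CommRing R] (f : Fin 4 → R) : R :=
  -(2 * f 2 ^ 3 - 3 * f 1 * f 2 * f 3 + f 3 ^ 2 * f 0)

/-- Quadratic order data. -/
structure QD (O : Type*) [CommRing O] where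
  D : ℤ
  τ : O
  b : Module.Basis (Fin 2) ℤ O
  b0 : b 0 = 1
  b1 : b 1 = τ
  hτ : 4 * (τ * τ) = 4 * D * τ - (D * D - D)
  fund : Fund D

namespace QD
variable {O : Type*} [CommRing O] (Q : QD O)

def s : O := 2 * Q.τ - Q.D

lemma s_sq : Q.s * Q.s = Q.D := by
  have := Q.hτ
  simp only [s]; linear_combination this

lemma repr_eq (x : O) : x = (Q.b.repr x 0 : O) + (Q.b.repr x 1 : O) * Q.τ := by
  conv_lhs => rw [← Q.b.sum_repr x]
  simp [Fin.sum_univ_two, Q.b0, Q.b1]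

lemma coord (m n : ℤ) : Q.b.repr ((m : O) + n * Q.τ) 0 = m ∧ Q.b.repr ((m : O) + n * Q.τ) 1 = n := by
  have : (m : O) + n * Q.τ = m • Q.b 0 + n • Q.b 1 := by simp [Q.b0, Q.b1]
  rw [this, map_add, map_smul, map_smul, Module.Basis.repr_self, Module.Basis.repr_self]
  constructor <;> simp

noncomputable def re (x : O) : ℤ := 2 * Q.b.repr x 0 + Q.b.repr x 1 * Q.D
noncomputable def im (x : O) : ℤ := Q.b.repr x 1

lemma two_mul_eq (x : O) : 2 * x = Q.re x + Q.im x * Q.s := by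
  conv_lhs => rw [Q.repr_eq x]
  simp only [re, im, s]; push_cast; ring

lemma indep_tau {m n : ℤ} (h : (m : O) + n * Q.τ = 0) : m = 0 ∧ n = 0 := by
  have := Q.coord m n
  rw [h] at this
  simpa [eq_comm] using this

lemma indep {m n : ℤ} (h : (m : O) + n * Q.s = 0) : m = 0 ∧ n = 0 := by
  have : ((m - n * Q.D : ℤ) : O) + (2 * n : ℤ) * Q.τ = 0 := by
    rw [← h]; simp only [s]; push_cast; ring
  obtain ⟨h1, h2⟩ := Q.indep_tau this
  have : n = 0 := by omega
  subst this; simp at h1; exact ⟨h1, rfl⟩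

lemma indep' {m n m' n' : ℤ} (h : (m : O) + n * Q.s = m' + n' * Q.s) : m = m' ∧ n = n' := by
  have : ((m - m' : ℤ) : O) + (n - n' : ℤ) * Q.s = 0 := by push_cast; linear_combination h
  have := Q.indep this
  omega

lemma exists_of_even {m n : ℤ} (h : 2 ∣ m - n * Q.D) : ∃ x : O, 2 * x = m + n * Q.s := by
  obtain ⟨k, hk⟩ := h
  refine ⟨k + n * Q.τ, ?_⟩
  have : (m : O) = 2 * k + n * Q.D := by
    have : m = 2 * k + n * Q.D := by omega
    rw [this]; push_cast; ring
  rw [this, s]; ring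

include Q in
lemma nontriv : Nontrivial O := ⟨⟨0, 1, fun h => by
  have := Q.indep_tau (m := 1) (n := 0) (by simp [← h])
  simp at this⟩⟩

include Q in
lemma cast_inj {m n : ℤ} (h : (m : O) = n) : m = n := by
  have := Q.indep' (m := m) (n := 0) (m' := n) (n' := 0) (by simpa using h)
  exact this.1

include Q in
lemma cast_eq_zero {m : ℤ} (h : (m : O) = 0) : m = 0 := Q.cast_inj (by simpa using h)

include Q in
lemma two_ne : (2 : O) ≠ 0 := fun h => by
  have := Q.cast_eq_zero (m := 2) (by simpa using h)
  omega

variable [IsDomain O]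

include Q in
lemma two_cancel {x y : O} (h : 2 * x = 2 * y) : x = y := mul_left_cancel₀ Q.two_ne h

include Q in
lemma four_cancel {x y : O} (h : 4 * x = 4 * y) : x = y :=
  Q.two_cancel (Q.two_cancel (by linear_combination h))

lemma re_im_of {x : O} {m n : ℤ} (h : 2 * x = m + n * Q.s) : Q.re x = m ∧ Q.im x = n := by
  rw [Q.two_mul_eq] at h; exact Q.indep' h

lemma not_sq (k : ℤ) : Q.D ≠ k * k := fun h => by
  have h1 : (Q.s - k) * (Q.s + k) = 0 := by
    have := Q.s_sq; rw [h] at this; push_cast at this; linear_combination this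
  rcases mul_eq_zero.1 h1 with h1 | h1
  · have := Q.indep (m := -k) (n := 1) (by push_cast; linear_combination h1)
    omega
  · have := Q.indep (m := k) (n := 1) (by push_cast; linear_combination h1)
    omega

lemma D_ne : Q.D ≠ 0 := by simpa using Q.not_sq 0

lemma parity {m n k : ℤ} (h : m ^ 2 = n ^ 2 * Q.D + 4 * k) : 2 ∣ m - n * Q.D := by
  have h1 : m ^ 2 % 2 = (n ^ 2 * Q.D) % 2 := by omega
  rcases Int.even_or_odd m with hm | hm <;> rcases Int.even_or_odd n with hn | hn <;>
  rcases Int.even_or_odd Q.D with hD | hD <;>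
  · obtain ⟨a, ha⟩ := hm
    obtain ⟨b, hb⟩ := hn
    obtain ⟨c, hc⟩ := hD
    rw [ha, hb, hc] at h1 ⊢
    ring_nf at h1 ⊢
    omega

/-- The elements `e_i` attached to a form. -/
structure IsE (f : Fin 4 → ℤ) (e : Fin 4 → O) : Prop where
  h0 : 2 * e 0 = (cG0 f : ℤ) + (f 0 : ℤ) * Q.s
  h1 : 2 * e 1 = (cG1 f : ℤ) + (f 1 : ℤ) * Q.s
  h2 : 2 * e 2 = (cG2 f : ℤ) + (f 2 : ℤ) * Q.s
  h3 : 2 * e 3 = (cG3 f : ℤ) + (f 3 : ℤ) * Q.s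

lemma exists_e {f : Fin 4 → ℤ} (hf : fdisc f = Q.D) : ∃ e, Q.IsE f e := by
  obtain ⟨e0, h0⟩ := Q.exists_of_even (m := cG0 f) (n := f 0) (Q.parity (k := hA f ^ 3)
    (by rw [← hf, syzygy]))
  obtain ⟨e1, h1⟩ := Q.exists_of_even (m := cG1 f) (n := f 1) (Q.parity (k := hA f ^ 2 * hC f)
    (by rw [← hf]; simp only [fdisc, hA, hC, cG1]; ring))
  obtain ⟨e2, h2⟩ := Q.exists_of_even (m := cG2 f) (n := f 2) (Q.parity (k := hA f * hC f ^ 2)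
    (by rw [← hf]; simp only [fdisc, hA, hC, cG2]; ring))
  obtain ⟨e3, h3⟩ := Q.exists_of_even (m := cG3 f) (n := f 3) (Q.parity (k := hC f ^ 3)
    (by rw [← hf]; simp only [fdisc, hC, cG3]; ring))
  exact ⟨![e0, e1, e2, e3], h0, h1, h2, h3⟩

section forms
variable {Q} {f : Fin 4 → ℤ} {e : Fin 4 → O} (hf : fdisc f = Q.D) (he : Q.IsE f e)
include hf

lemma s_sq_f : Q.s * Q.s = (fdisc f : ℤ) := by rw [hf]; exact Q.s_sq

include he

lemma e02 : e 0 * e 2 = e 1 * e 1 := by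
  apply Q.four_cancel
  have : 4 * (e 0 * e 2) = (2 * e 0) * (2 * e 2) := by ring
  rw [this]
  have : 4 * (e 1 * e 1) = (2 * e 1) * (2 * e 1) := by ring
  rw [this, he.h0, he.h1, he.h2]
  have hs := s_sq_f hf
  simp only [cG0, cG1, cG2, fdisc] at *
  push_cast at *
  linear_combination (f 0 * f 2 - f 1 ^ 2 : O) * hs

lemma e03 : e 0 * e 3 = e 1 * e 2 := by
  apply Q.four_cancel
  have : 4 * (e 0 * e 3) = (2 * e 0) * (2 * e 3) := by ring
  rw [this]
  have : 4 * (e 1 * e 2) = (2 * e 1) * (2 * e 2) := by ring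
  rw [this, he.h0, he.h1, he.h2, he.h3]
  have hs := s_sq_f hf
  simp only [cG0, cG1, cG2, cG3, fdisc] at *
  push_cast at *
  linear_combination (f 0 * f 3 - f 1 * f 2 : O) * hs

lemma omega_e0 {w : O} (hw : 2 * w = -(hB f : ℤ) + Q.s) : w * e 0 = (hA f : ℤ) * e 1 := by
  apply Q.four_cancel
  have : 4 * (w * e 0) = (2 * w) * (2 * e 0) := by ring
  rw [this]
  have : 4 * ((hA f : ℤ) * e 1) = 2 * (hA f : ℤ) * (2 * e 1) := by ring
  rw [this, he.h0, he.h1, hw]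
  have hs := s_sq_f hf
  simp only [cG0, cG1, fdisc, hA, hB] at *
  push_cast at *
  linear_combination (f 0 : O) * hs

lemma omega_e1 {w : O} (hw : 2 * w = -(hB f : ℤ) + Q.s) :
    w * e 1 = -(hB f : ℤ) * e 1 - (hC f : ℤ) * e 0 := by
  apply Q.four_cancel
  have : 4 * (w * e 1) = (2 * w) * (2 * e 1) := by ring
  rw [this]
  have : 4 * (-(hB f : ℤ) * e 1 - (hC f : ℤ) * e 0) =
    -2 * (hB f : ℤ) * (2 * e 1) - 2 * (hC f : ℤ) * (2 * e 0) := by ring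
  rw [this, he.h0, he.h1, hw]
  have hs := s_sq_f hf
  simp only [cG0, cG1, fdisc, hA, hB, hC] at *
  push_cast at *
  linear_combination (f 1 : O) * hs

lemma e0_norm : e 0 * ((cG0 f : ℤ) - e 0) = (hA f : ℤ) ^ 3 := by
  apply Q.four_cancel
  have : 4 * (e 0 * ((cG0 f : ℤ) - e 0)) = (2 * e 0) * (2 * (cG0 f : ℤ) - 2 * e 0) := by ring
  rw [this, he.h0]
  have hs := s_sq_f hf
  simp only [cG0, fdisc, hA] at *
  push_cast at *
  linear_combination -(f 0 : O) ^ 2 * hs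

lemma e3_norm : e 3 * ((cG3 f : ℤ) - e 3) = (hC f : ℤ) ^ 3 := by
  apply Q.four_cancel
  have : 4 * (e 3 * ((cG3 f : ℤ) - e 3)) = (2 * e 3) * (2 * (cG3 f : ℤ) - 2 * e 3) := by ring
  rw [this, he.h3]
  have hs := s_sq_f hf
  simp only [cG3, fdisc, hC] at *
  push_cast at *
  linear_combination -(f 3 : O) ^ 2 * hs

lemma DB_eq : (Q.D : O) * (hB f : ℤ) = -e 0 * ((cG3 f : ℤ) - e 3) - ((cG0 f : ℤ) - e 0) * e 3 +
    e 1 * ((cG2 f : ℤ) - e 2) + ((cG1 f : ℤ) - e 1) * e 2 := by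
  apply Q.four_cancel
  have : 4 * (-e 0 * ((cG3 f : ℤ) - e 3) - ((cG0 f : ℤ) - e 0) * e 3 +
    e 1 * ((cG2 f : ℤ) - e 2) + ((cG1 f : ℤ) - e 1) * e 2) =
    -(2 * e 0) * (2 * (cG3 f : ℤ) - 2 * e 3) - (2 * (cG0 f : ℤ) - 2 * e 0) * (2 * e 3) +
    (2 * e 1) * (2 * (cG2 f : ℤ) - 2 * e 2) + (2 * (cG1 f : ℤ) - 2 * e 1) * (2 * e 2) := by ring
  rw [this, he.h0, he.h1, he.h2, he.h3]
  have hs := s_sq_f hf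
  rw [← hf]
  simp only [cG0, cG1, cG2, cG3, fdisc, hB] at *
  push_cast at *
  linear_combination (-2 * (f 0 * f 3 - f 1 * f 2) : O) * hs

omit he in
lemma hA_ne : hA f ≠ 0 := fun h => by
  have := fdisc_eq f
  rw [h, hf] at this
  exact Q.not_sq (hB f) (by rw [this]; ring)

lemma e0_ne : e 0 ≠ 0 := fun h => by
  have := e0_norm hf he
  rw [h, zero_mul] at this
  exact hA_ne hf (Q.cast_eq_zero (eq_zero_of_pow_eq_zero this.symm))

omit [IsDomain O] he in
lemma hB_even : 2 ∣ - hB f - Q.D := by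
  have := fdisc_eq f
  rw [hf] at this
  rcases Int.even_or_odd' (hB f) with ⟨k, hk | hk⟩
  · rw [this, hk]; ring_nf; omega
  · rw [this, hk]; ring_nf; omega

lemma mem_span_e {x : O} (hx : x ∈ Ideal.span {e 0, e 1}) : ∃ m n : ℤ, x = m * e 0 + n * e 1 := by
  obtain ⟨w, hw⟩ := Q.exists_of_even (m := - hB f) (n := 1) (by simpa using hB_even hf)
  have hw : 2 * w = -(hB f : ℤ) + Q.s := by rw [hw]; push_cast; ring
  have hO : ∀ y : O, ∃ m n : ℤ, y = m + n * w := by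
    intro y
    obtain ⟨k, hk⟩ := hB_even hf
    refine ⟨Q.b.repr y 0 + (-k) * Q.b.repr y 1, Q.b.repr y 1, ?_⟩
    apply Q.two_cancel
    have hk' : (-(hB f : ℤ) : O) - Q.D = 2 * k := by exact_mod_cast congrArg (Int.cast : ℤ → O) hk
    have h2 : 2 * (((Q.b.repr y 0 + (-k) * Q.b.repr y 1 : ℤ) : O) + (Q.b.repr y 1 : ℤ) * w)
      = 2 * Q.b.repr y 0 - (2 * k) * Q.b.repr y 1 + (Q.b.repr y 1 : ℤ) * (2 * w) := by
        push_cast; ring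
    rw [h2, hw, ← hk', Q.two_mul_eq]
    simp only [re, im]; push_cast; ring
  obtain ⟨y, z, rfl⟩ := Ideal.mem_span_pair.1 hx
  obtain ⟨m, n, rfl⟩ := hO y
  obtain ⟨m', n', rfl⟩ := hO z
  have h0 := omega_e0 hf he hw
  have h1 := omega_e1 hf he hw
  refine ⟨m - n' * hC f, m' + n * hA f - n' * hB f, ?_⟩
  push_cast
  linear_combination (n : O) * h0 + n' * h1

lemma span_e_top : Ideal.span {e 0, e 1, e 2, e 3} = ⊤ := by
  by_contra hne
  obtain ⟨P, hP, hle⟩ := Ideal.exists_le_maximal _ hne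
  have hPp := hP.isPrime
  have m0 : e 0 ∈ P := hle (Ideal.subset_span (by simp))
  have m1 : e 1 ∈ P := hle (Ideal.subset_span (by simp))
  have m2 : e 2 ∈ P := hle (Ideal.subset_span (by simp))
  have m3 : e 3 ∈ P := hle (Ideal.subset_span (by simp))
  have mA : ((hA f : ℤ) : O) ∈ P := hPp.mem_of_pow_mem 3 (by
    rw [← e0_norm hf he]; exact P.mul_mem_right _ m0)
  have mC : ((hC f : ℤ) : O) ∈ P := hPp.mem_of_pow_mem 3 (by
    rw [← e3_norm hf he]; exact P.mul_mem_right _ m3)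
  have mDB : (Q.D : O) * (hB f : ℤ) ∈ P := by
    rw [DB_eq hf he]
    refine P.add_mem (P.add_mem (P.sub_mem ?_ ?_) ?_) ?_
    · exact P.mul_mem_right _ (P.neg_mem m0)
    · exact P.mul_mem_left _ m3
    · exact P.mul_mem_right _ m1
    · exact P.mul_mem_left _ m2
  have hD : (Q.D : O) = (hB f : ℤ) ^ 2 - 4 * (hA f : ℤ) * (hC f : ℤ) := by
    rw [← hf, fdisc_eq]; push_cast; ring
  have mB : ((hB f : ℤ) : O) ∈ P := hPp.mem_of_pow_mem 3 (by
    have : ((hB f : ℤ) : O) ^ 3 = Q.D * (hB f : ℤ) + (4 * (hB f : ℤ) * (hC f : ℤ)) * (hA f : ℤ) := by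
      rw [hD]; ring
    rw [this]
    exact P.add_mem mDB (P.mul_mem_left _ mA))
  -- contract to ℤ
  have hc : (P.comap (Int.castRingHom O)).IsPrime := Ideal.IsPrime.comap _
  obtain ⟨g, hg⟩ := (IsPrincipalIdealRing.principal (P.comap (Int.castRingHom O))).principal
  have hmem : ∀ n : ℤ, (n : O) ∈ P → g ∣ n := fun n hn => by
    have : n ∈ P.comap (Int.castRingHom O) := by simpa using hn
    rw [hg] at this
    exact Ideal.mem_span_singleton.1 this
  have gA := hmem _ mA
  have gB := hmem _ mB
  have gC := hmem _ mC
  have g0 : g ≠ 0 := by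
    rintro rfl
    exact hA_ne hf (zero_dvd_iff.1 gA)
  have gp : Prime g := by
    rw [hg] at hc
    exact (Ideal.span_singleton_prime g0).1 hc
  have hp : g.natAbs.Prime := Int.prime_iff_natAbs_prime.1 gp
  have hF := Q.fund _ hp
  obtain ⟨A', hA'⟩ := Int.natAbs_dvd.2 gA
  obtain ⟨B', hB'⟩ := Int.natAbs_dvd.2 gB
  obtain ⟨C', hC'⟩ := Int.natAbs_dvd.2 gC
  have hDD : Q.D = (g.natAbs : ℤ) ^ 2 * (B' ^ 2 - 4 * A' * C') := by
    rw [← hf, fdisc_eq, hA', hB', hC']; ring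
  unfold FundAt at hF
  split_ifs at hF with h2
  · rw [h2] at hDD
    rcases Int.even_or_odd' B' with ⟨k, hk | hk⟩
    · have : Q.D = 16 * (k ^ 2 - A' * C') := by rw [hDD, hk]; push_cast; ring
      omega
    · have : Q.D = 16 * (k ^ 2 + k - A' * C') + 4 := by rw [hDD, hk]; push_cast; ring
      omega
  · exact hF ⟨_, hDD⟩

open Pointwise in
lemma span_cube : Ideal.span {e 0, e 1} ^ 3 = Ideal.span {e 0 ^ 2} := by
  have h02 := e02 hf he
  have h03 := e03 hf he
  have h1 : Ideal.span {e 0, e 1} ^ 3 = Ideal.span {e 0 ^ 2} * Ideal.span {e 0, e 1, e 2, e 3} := by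
    apply le_antisymm
    · rw [pow_succ, pow_two, Ideal.span_pair_mul_span_pair, Ideal.span_mul_span', Ideal.span_mul_span',
        Ideal.span_le]
      rintro _ ⟨x, hx, y, hy, rfl⟩
      have key : ∀ i : Fin 4, e 0 ^ 2 * e i ∈ Ideal.span (({e 0 ^ 2} : Set O) * ({e 0, e 1, e 2, e 3} : Set O)) := by
        intro i
        apply Ideal.subset_span
        refine Set.mul_mem_mul rfl ?_
        fin_cases i <;> simp
      have k0 := key 0
      have k1 := key 1
      have k2 := key 2
      have k3 := key 3
      simp only [Set.mem_insert_iff, Set.mem_singleton_iff] at hx hy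
      have l2 : e 0 * e 1 * e 1 = e 0 ^ 2 * e 2 := by linear_combination -e 0 * h02
      have l3 : e 1 * e 1 * e 1 = e 0 ^ 2 * e 3 := by linear_combination -e 1 * h02 - e 0 * h03
      rcases hx with rfl | rfl | rfl | rfl <;> rcases hy with rfl | rfl <;> simp only [SetLike.mem_coe]
      · convert k0 using 1; ring
      · convert k1 using 1; ring
      · convert k1 using 1; ring
      · convert k2 using 1
      · convert k1 using 1; ring
      · convert k2 using 1; rw [← l2]; ring
      · convert k2 using 1; rw [← l2]; ring
      · convert k3 using 1
    · rw [Ideal.span_mul_span', Ideal.span_le]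
      rintro _ ⟨x, hx, y, hy, rfl⟩
      have m0 : e 0 ∈ Ideal.span {e 0, e 1} := Ideal.subset_span (by simp)
      have m1 : e 1 ∈ Ideal.span {e 0, e 1} := Ideal.subset_span (by simp)
      have hx : x = e 0 ^ 2 := hx
      subst hx
      simp only [Set.mem_insert_iff, Set.mem_singleton_iff] at hy
      have key : ∀ u v w : O, u ∈ Ideal.span {e 0, e 1} → v ∈ Ideal.span {e 0, e 1} →
        w ∈ Ideal.span {e 0, e 1} → u * v * w ∈ Ideal.span {e 0, e 1} ^ 3 := fun u v w hu hv hw => by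
          rw [pow_succ, pow_two]; exact Ideal.mul_mem_mul (Ideal.mul_mem_mul hu hv) hw
      rcases hy with rfl | rfl | rfl | rfl <;> simp only [SetLike.mem_coe]
      · convert key _ _ _ m0 m0 m0 using 1; ring
      · convert key _ _ _ m0 m0 m1 using 1; ring
      · convert key _ _ _ m0 m1 m1 using 1; linear_combination e 0 * h02
      · convert key _ _ _ m1 m1 m1 using 1; linear_combination e 1 * h02 + e 0 * h03
  rw [h1, span_e_top hf he, Ideal.mul_top]

end forms
end QD
end DH

namespace DH
set_option linter.unusedSectionVars false

def cG {R : Type*} [CommRing R] (f : Fin 4 → R) : Fin 4 → R := ![cG0 f, cG1 f, cG2 f, cG3 f]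

lemma cG_act {R : Type*} [CommRing R] (p q r s : R) (f : Fin 4 → R) :
    cG (act p q r s f) = fun i => (p * s - q * r) ^ 3 * act p q r s (cG f) i := by
  apply ext4
  · simp [cG, cG0, cG1, cG2, cG3]; ring
  · simp [cG, cG0, cG1, cG2, cG3]; ring
  · simp [cG, cG0, cG1, cG2, cG3]; ring
  · simp [cG, cG0, cG1, cG2, cG3]; ring

namespace QD
variable {O : Type*} [CommRing O] [IsDedekindDomain O] {Q : QD O}
variable {f f' : Fin 4 → ℤ} {e e' : Fin 4 → O}

lemma IsE.eq (he : Q.IsE f e) (i : Fin 4) : 2 * e i = (cG f i : ℤ) + (f i : ℤ) * Q.s := by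
  fin_cases i
  · exact he.h0
  · exact he.h1
  · exact he.h2
  · exact he.h3

lemma isE_act (he : Q.IsE f e) (p q r s : ℤ) (i : Fin 4) :
    2 * act (p : O) q r s e i = (act p q r s (cG f) i : ℤ) + (act p q r s f i : ℤ) * Q.s := by
  have e0 := he.eq 0
  have e1 := he.eq 1
  have e2 := he.eq 2
  have e3 := he.eq 3
  fin_cases i
  · simp; linear_combination (p:O)^3 * e0 + 3 * p^2*r * e1 + 3 * p * r^2 * e2 + r^3 * e3
  · simp; linear_combination (p:O)^2*q * e0 + (p^2*s+2*p*q*r) * e1 + (2*p*r*s+q*r^2) * e2 + r^2*s * e3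
  · simp; linear_combination (p:O)*q^2 * e0 + (2*p*q*s+q^2*r) * e1 + (p*s^2+2*q*r*s) * e2 + r*s^2 * e3
  · simp; linear_combination (q:O)^3 * e0 + 3 * q^2*s * e1 + 3 * q * s^2 * e2 + s^3 * e3

/-- same orbit implies classes equal up to a cube -/
theorem orbit_cube (hf : fdisc f = Q.D) (he : Q.IsE f e) (he' : Q.IsE f' e')
    (h : toOrb f = toOrb f') : ∃ x y : O, x ≠ 0 ∧ y ≠ 0 ∧ e' 0 * y ^ 3 = e 0 * x ^ 3 := by
  obtain ⟨g, rfl⟩ := toOrb_eq.1 h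
  have h0 := isE_act he (g 0 0) (g 0 1) (g 1 0) (g 1 1) 0
  have h0' := he'.eq 0
  have hc := cG_act (g 0 0) (g 0 1) (g 1 0) (g 1 1) f
  rw [sl_det] at hc
  simp only [gact] at h0'
  rw [hc] at h0'
  simp only [one_pow, one_mul] at h0'
  have h1 : e' 0 = act ((g 0 0 : ℤ) : O) (g 0 1 : ℤ) (g 1 0 : ℤ) (g 1 1 : ℤ) e 0 :=
    Q.two_cancel (by rw [h0, h0'])
  have h02 := e02 hf he
  have h03 := e03 hf he
  have key : e' 0 * e 0 ^ 2 = ((g 0 0 : ℤ) * e 0 + (g 1 0 : ℤ) * e 1) ^ 3 := by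
    rw [h1, act_0]
    linear_combination (3 * (g 0 0 : ℤ) * (g 1 0 : ℤ) ^ 2 * e 0) * h02 +
      ((g 1 0 : ℤ) ^ 3 * e 0) * h03 + ((g 1 0 : ℤ) ^ 3 * e 1) * h02
  have hne : e 0 ≠ 0 := e0_ne hf he
  have hne' : e' 0 ≠ 0 := e0_ne (Q := Q) (f := gact g f) (by rw [fdisc_gact, hf]) he'
  refine ⟨_, e 0, ?_, hne, by rw [← key]; ring⟩
  intro hz
  rw [hz] at key
  simp [hne, hne'] at key

theorem cube_orbit (hf : fdisc f = Q.D) (hf' : fdisc f' = Q.D) (he : Q.IsE f e) (he' : Q.IsE f' e')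
    {x y : O} (hx : x ≠ 0) (hy : y ≠ 0) (h : e' 0 * y ^ 3 = e 0 * x ^ 3) : toOrb f = toOrb f' := by
  have hI : Ideal.span {y ^ 2} * Ideal.span {e' 0, e' 1} = Ideal.span {x ^ 2} * Ideal.span {e 0, e 1} := by
    apply pow_left_injective (M := Ideal O) (n := 3) (by norm_num)
    simp only [mul_pow, span_cube hf he, span_cube hf' he', Ideal.span_singleton_pow,
      Ideal.span_singleton_mul_span_singleton]
    congr 2
    linear_combination (e' 0 * y ^ 3 + e 0 * x ^ 3) * h
  have hmem : ∀ z ∈ Ideal.span {e' 0, e' 1}, ∃ m n : ℤ, y ^ 2 * z = x ^ 2 * (m * e 0 + n * e 1) := by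
    intro z hz
    have : y ^ 2 * z ∈ Ideal.span {x ^ 2} * Ideal.span {e 0, e 1} := by
      rw [← hI]
      exact Ideal.mul_mem_mul (Ideal.mem_span_singleton_self _) hz
    obtain ⟨w, hw, hw'⟩ := Ideal.mem_span_singleton_mul.1 this
    obtain ⟨m, n, rfl⟩ := mem_span_e hf he hw
    exact ⟨m, n, hw'.symm⟩
  obtain ⟨p, r, hu⟩ := hmem (e' 0) (Ideal.subset_span (by simp))
  obtain ⟨q, s, hv⟩ := hmem (e' 1) (Ideal.subset_span (by simp))
  have h02 := e02 hf he
  have h03 := e03 hf he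
  have h02' := e02 hf' he'
  have h03' := e03 hf' he'
  have hne : e 0 ≠ 0 := e0_ne hf he
  have hsq : e' 0 ^ 2 * y ^ 6 = e 0 ^ 2 * x ^ 6 := by
    linear_combination (e' 0 * y ^ 3 + e 0 * x ^ 3) * h
  set u : O := p * e 0 + r * e 1 with hud
  set v : O := q * e 0 + s * e 1 with hvd
  have hcancel : ∀ {a b : O}, x ^ 6 * e 0 ^ 2 * a = x ^ 6 * e 0 ^ 2 * b → a = b := fun h =>
    mul_left_cancel₀ (mul_ne_zero (pow_ne_zero _ hx) (pow_ne_zero _ hne)) h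
  have E0 : e' 0 = act (p : O) q r s e 0 := by
    apply hcancel
    have : x ^ 6 * e 0 ^ 2 * e' 0 = x ^ 6 * u ^ 3 := by
      calc _ = (y ^ 2 * e' 0) ^ 3 := by linear_combination -e' 0 * hsq
        _ = _ := by rw [hu]; ring
    rw [this, act_0, hud]
    linear_combination (-x ^ 6) * ((3 * p * r ^ 2 * e 0) * h02 + (r ^ 3 * e 0) * h03 + (r ^ 3 * e 1) * h02)
  have E1 : e' 1 = act (p : O) q r s e 1 := by
    apply hcancel
    have : x ^ 6 * e 0 ^ 2 * e' 1 = x ^ 6 * (u ^ 2 * v) := by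
      calc _ = (y ^ 2 * e' 0) ^ 2 * (y ^ 2 * e' 1) := by linear_combination -e' 1 * hsq
        _ = _ := by rw [hu, hv]; ring
    rw [this, act_1, hud, hvd]
    linear_combination (-x ^ 6) * (((2*p*r*s+q*r^2) * e 0) * h02 + (r ^ 2 * s * e 0) * h03 + (r ^ 2 * s * e 1) * h02)
  have E2 : e' 2 = act (p : O) q r s e 2 := by
    apply hcancel
    have : x ^ 6 * e 0 ^ 2 * e' 2 = x ^ 6 * (u * v ^ 2) := by
      calc _ = (y ^ 2 * e' 0) * (y ^ 2 * e' 1) ^ 2 := by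
            linear_combination -e' 2 * hsq + y ^ 6 * e' 0 * h02'
        _ = _ := by rw [hu, hv]; ring
    rw [this, act_2, hud, hvd]
    linear_combination (-x ^ 6) * (((p*s^2+2*q*r*s) * e 0) * h02 + (r * s ^ 2 * e 0) * h03 + (r * s ^ 2 * e 1) * h02)
  have E3 : e' 3 = act (p : O) q r s e 3 := by
    apply hcancel
    have : x ^ 6 * e 0 ^ 2 * e' 3 = x ^ 6 * (v ^ 3) := by
      calc _ = (y ^ 2 * e' 1) ^ 3 := by
            linear_combination -e' 3 * hsq + y ^ 6 * e' 0 * h03' + y ^ 6 * e' 1 * h02'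
        _ = _ := by rw [hv]; ring
    rw [this, act_3, hvd]
    linear_combination (-x ^ 6) * ((3 * q * s ^ 2 * e 0) * h02 + (s ^ 3 * e 0) * h03 + (s ^ 3 * e 1) * h02)
  have hall : ∀ i, cG f' i = act p q r s (cG f) i ∧ f' i = act p q r s f i := by
    intro i
    have : e' i = act (p : O) q r s e i := by
      fin_cases i
      · exact E0
      · exact E1
      · exact E2
      · exact E3
    have h1 := he'.eq i
    rw [this, isE_act he] at h1
    have := Q.indep' h1
    exact ⟨this.1.symm, this.2.symm⟩
  have hfe : f' = act p q r s f := funext fun i => (hall i).2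
  have hge : cG f' = act p q r s (cG f) := funext fun i => (hall i).1
  have hdet6 : (p * s - q * r) ^ 6 = 1 := by
    have := fdisc_act f p q r s
    rw [← hfe, hf, hf'] at this
    have h2 : ((p * s - q * r) ^ 6 - 1) * Q.D = 0 := by linear_combination -this
    rcases mul_eq_zero.1 h2 with h | h
    · linarith
    · exact absurd h Q.D_ne
  have hdet : p * s - q * r = 1 ∨ p * s - q * r = -1 := by
    have h1 : ((p * s - q * r) ^ 3 - 1) * ((p * s - q * r) ^ 3 + 1) = 0 := by
      linear_combination hdet6
    have h3 : IsUnit ((p * s - q * r)) := IsUnit.of_pow_eq_one hdet6 (by norm_num)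
    exact Int.isUnit_iff.1 h3
  rcases hdet with hd | hd
  · rw [toOrb_eq]
    refine ⟨⟨!![p, q; r, s], by rw [Matrix.det_fin_two_of]; exact hd⟩, ?_⟩
    rw [hfe]; rfl
  · exfalso
    have h1 := cG_act p q r s f
    rw [← hfe, ← hge, hd] at h1
    have g0 := congrFun h1 0
    have g1 := congrFun h1 1
    simp only [cG] at g0 g1
    norm_num at g0 g1
    have g0 : cG0 f' = 0 := by linarith
    have g1 : cG1 f' = 0 := by linarith
    have h2 : 2 * hA f' * cG1 f' = - hB f' * cG0 f' + f' 0 * fdisc f' := by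
      simp only [hA, hB, cG0, cG1, fdisc]; ring
    rw [g0, g1, hf'] at h2
    have h3 : f' 0 = 0 := by
      have : f' 0 * Q.D = 0 := by linarith
      exact (mul_eq_zero.1 this).resolve_right Q.D_ne
    have h4 := syzygy f'
    rw [g0, h3] at h4
    have : hA f' ^ 3 = 0 := by linarith
    exact hA_ne hf' (eq_zero_of_pow_eq_zero this)

end QD
end DH

namespace DH
set_option linter.unusedSectionVars false
namespace QD
variable {O : Type*} [CommRing O] [IsDedekindDomain O] (Q : QD O)

noncomputable def conj (x : O) : O := Q.re x - x

lemma two_conj (x : O) : 2 * Q.conj x = Q.re x - Q.im x * Q.s := by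
  simp only [conj]; linear_combination - Q.two_mul_eq x

lemma sub_conj (x : O) : x - Q.conj x = Q.im x * Q.s := by
  simp only [conj]; linear_combination Q.two_mul_eq x

lemma add_conj (x : O) : x + Q.conj x = Q.re x := by
  simp only [conj]; ring

lemma conj_mul (x y : O) : Q.conj (x * y) = Q.conj x * Q.conj y := by
  have h1 : ((2 * Q.re (x * y) : ℤ) : O) + (2 * Q.im (x * y) : ℤ) * Q.s =
      ((Q.re x * Q.re y + Q.im x * Q.im y * Q.D : ℤ) : O) +
        (Q.re x * Q.im y + Q.im x * Q.re y : ℤ) * Q.s := by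
    push_cast
    linear_combination -2 * Q.two_mul_eq (x * y) + 2 * y * Q.two_mul_eq x + 
     (Q.re x + Q.im x * Q.s) * Q.two_mul_eq y + Q.im x * Q.im y * Q.s_sq
  obtain ⟨h2, h3⟩ := Q.indep' h1
  have h2' := congrArg (Int.cast : ℤ → O) h2
  have h3' := congrArg (Int.cast : ℤ → O) h3
  push_cast at h2' h3'
  apply Q.four_cancel
  have : 4 * (Q.conj x * Q.conj y) = (2 * Q.conj x) * (2 * Q.conj y) := by ring
  rw [this]
  have : 4 * Q.conj (x * y) = 2 * (2 * Q.conj (x * y)) := by ring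
  rw [this, two_conj, two_conj, two_conj]
  linear_combination h2' - Q.s * h3' - Q.im x * Q.im y * Q.s_sq

lemma conj_pow_mul (x y : O) : 
   Q.conj (x ^ 3) = Q.conj x ^ 3 ∧ Q.conj (x ^ 2 * y) = Q.conj x ^ 2 * Q.conj y ∧
   Q.conj (x * y ^ 2) = Q.conj x * Q.conj y ^ 2 := by
  simp only [pow_succ, pow_zero, one_mul, conj_mul]
  exact ⟨trivial, trivial, trivial⟩

lemma norm_eq (x : O) : (Algebra.norm ℤ x : O) = x * Q.conj x := by
  rw [Algebra.norm_eq_matrix_det Q.b, Matrix.det_fin_two]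
  simp only [Algebra.leftMulMatrix_eq_repr_mul, Q.b0, Q.b1]
  set m := Q.b.repr x 0 with hm
  set n := Q.b.repr x 1 with hn
  have hx : x = m + n * Q.τ := Q.repr_eq x
  have hre : Q.re x = 2 * m + n * Q.D := rfl
  obtain ⟨k, hk⟩ : ∃ k : ℤ, Q.D * Q.D - Q.D = 4 * k := by
    have h2 := Q.fund 2 Nat.prime_two
    simp only [FundAt, if_true] at h2
    have h3 : Q.D % 4 = 1 ∨ Q.D % 4 = 0 := by omega
    rcases h3 with h3 | h3
    · obtain ⟨j, hj⟩ : ∃ j, Q.D = 4 * j + 1 := ⟨Q.D / 4, by omega⟩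
      exact ⟨4 * j ^ 2 + j, by rw [hj]; ring⟩
    · obtain ⟨j, hj⟩ : ∃ j, Q.D = 4 * j := ⟨Q.D / 4, by omega⟩
      exact ⟨4 * j ^ 2 - j, by rw [hj]; ring⟩
  have hk' := congrArg (Int.cast : ℤ → O) hk
  push_cast at hk'
  have htt : Q.τ * Q.τ = Q.D * Q.τ - k := by
    apply Q.four_cancel
    linear_combination Q.hτ - hk'
  have hxt : x * Q.τ = ((-(n * k) : ℤ) : O) + ((m + n * Q.D : ℤ) : O) * Q.τ := by
    rw [hx]; push_cast; linear_combination (n : O) * htt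
  have h1 := Q.coord m n
  have h2 := Q.coord (-(n * k)) (m + n * Q.D)
  rw [mul_one, hxt, h2.1, h2.2, ← hm, ← hn]
  rw [conj, hre, hx]
  push_cast
  linear_combination (n : O) ^ 2 * htt

lemma det_eq (a b : O) : (Q.b.det ![a, b] : O) * Q.s = -(a * Q.conj b - Q.conj a * b) := by
  rw [Module.Basis.det_apply, Matrix.det_fin_two]
  simp only [Module.Basis.toMatrix_apply, Matrix.cons_val_zero, Matrix.cons_val_one]
  apply Q.four_cancel
  have : 4 * (-(a * Q.conj b - Q.conj a * b)) = -((2 * a) * (2 * Q.conj b) - (2 * Q.conj a) * (2 * b)) := by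
    ring
  rw [this, two_conj, two_conj, two_mul_eq, two_mul_eq]
  simp only [re, im]
  push_cast
  ring

theorem exists_form {I : Ideal O} (hI : I ≠ ⊥) {δ : O} (hδ : I ^ 3 = Ideal.span {δ}) :
    ∃ f e, fdisc f = Q.D ∧ Q.IsE f e ∧ ∃ α : O, α ≠ 0 ∧ e 0 * δ = α ^ 3 := by
  have hfree : Module.Free ℤ O := Module.Free.of_basis Q.b
  have hfin : Module.Finite ℤ O := Module.Finite.of_basis Q.b
  -- oriented basis
  have hbasis : ∃ α ∈ I, ∃ β ∈ I, α ≠ 0 ∧ (Q.b.det ![α, β]) ^ 3 = Algebra.norm ℤ δ := by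
    set bI := I.selfBasis Q.b hI with hbI
    have h1 := Ideal.natAbs_det_basis_change Q.b I bI
    have h2 : Ideal.absNorm I ^ 3 = (Algebra.norm ℤ δ).natAbs := by
      rw [← Ideal.absNorm_span_singleton, ← hδ, map_pow]
    have h3 : ((↑) ∘ bI : Fin 2 → O) = ![(bI 0 : O), (bI 1 : O)] := by
      funext i; fin_cases i <;> rfl
    rw [h3] at h1
    rw [← h1, ← Int.natAbs_pow] at h2
    have hn : ∀ i, (bI i : O) ≠ 0 := fun i h => bI.ne_zero i (Subtype.ext h)
    rcases Int.natAbs_eq_natAbs_iff.1 h2 with h | h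
    · exact ⟨_, (bI 0).2, _, (bI 1).2, hn 0, h⟩
    · refine ⟨_, (bI 1).2, _, (bI 0).2, hn 1, ?_⟩
      have : Q.b.det ![(bI 1 : O), (bI 0 : O)] = - Q.b.det ![(bI 0 : O), (bI 1 : O)] := by
        rw [Module.Basis.det_apply, Module.Basis.det_apply, Matrix.det_fin_two, Matrix.det_fin_two]
        simp only [Module.Basis.toMatrix_apply, Matrix.cons_val_zero, Matrix.cons_val_one]
        ring
      rw [this]
      linear_combination -h
  obtain ⟨α, hα, β, hβ, hα0, ht⟩ := hbasis
  have hmem : ∀ x ∈ I, ∀ y ∈ I, ∀ z ∈ I, ∃ e, x * y * z = δ * e := fun x hx y hy z hz => by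
    have : x * y * z ∈ Ideal.span {δ} := by
      rw [← hδ, pow_succ, pow_two]
      exact Ideal.mul_mem_mul (Ideal.mul_mem_mul hx hy) hz
    exact Ideal.mem_span_singleton.1 this
  obtain ⟨e0, h0⟩ := hmem α hα α hα α hα
  obtain ⟨e1, h1⟩ := hmem α hα α hα β hβ
  obtain ⟨e2, h2⟩ := hmem α hα β hβ β hβ
  obtain ⟨e3, h3⟩ := hmem β hβ β hβ β hβ
  have c0 := congrArg Q.conj h0
  have c1 := congrArg Q.conj h1
  have c2 := congrArg Q.conj h2
  have c3 := congrArg Q.conj h3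
  simp only [conj_mul] at c0 c1 c2 c3
  have hdet := Q.det_eq α β
  have hnorm := Q.norm_eq δ
  set ν := Algebra.norm ℤ δ with hν
  set t := Q.b.det ![α, β] with htdef
  have hδ0 : δ ≠ 0 := by
    rintro rfl
    rw [zero_mul] at h0
    simp [hα0] at h0
  have hν0 : ν ≠ 0 := by
    rw [hν]
    exact (Algebra.norm_ne_zero_iff).2 hδ0
  have ht' : (t : O) ^ 3 = ν := by exact_mod_cast congrArg (Int.cast : ℤ → O) ht
  set a1 := α
  set a2 := Q.conj α with ha2
  set b1 := β
  set b2 := Q.conj β with hb2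
  set d1 := δ
  set d2 := Q.conj δ with hd2
  have P0 : (ν : O) * Q.s * Q.im e0 = d2 * a1 ^ 3 - d1 * a2 ^ 3 := by
    linear_combination (Q.s * Q.im e0) * hnorm - d1 * d2 * Q.sub_conj e0 - d2 * h0 + d1 * c0
  have P1 : (ν : O) * Q.s * Q.im e1 = d2 * a1 ^ 2 * b1 - d1 * a2 ^ 2 * b2 := by
    linear_combination (Q.s * Q.im e1) * hnorm - d1 * d2 * Q.sub_conj e1 - d2 * h1 + d1 * c1
  have P2 : (ν : O) * Q.s * Q.im e2 = d2 * a1 * b1 ^ 2 - d1 * a2 * b2 ^ 2 := by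
    linear_combination (Q.s * Q.im e2) * hnorm - d1 * d2 * Q.sub_conj e2 - d2 * h2 + d1 * c2
  have P3 : (ν : O) * Q.s * Q.im e3 = d2 * b1 ^ 3 - d1 * b2 ^ 3 := by
    linear_combination (Q.s * Q.im e3) * hnorm - d1 * d2 * Q.sub_conj e3 - d2 * h3 + d1 * c3
  have R0 : (ν : O) * Q.re e0 = d2 * a1 ^ 3 + d1 * a2 ^ 3 := by
    linear_combination (Q.re e0) * hnorm - d1 * d2 * Q.add_conj e0 - d2 * h0 - d1 * c0
  have R1 : (ν : O) * Q.re e1 = d2 * a1 ^ 2 * b1 + d1 * a2 ^ 2 * b2 := by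
    linear_combination (Q.re e1) * hnorm - d1 * d2 * Q.add_conj e1 - d2 * h1 - d1 * c1
  have R2 : (ν : O) * Q.re e2 = d2 * a1 * b1 ^ 2 + d1 * a2 * b2 ^ 2 := by
    linear_combination (Q.re e2) * hnorm - d1 * d2 * Q.add_conj e2 - d2 * h2 - d1 * c2
  have R3 : (ν : O) * Q.re e3 = d2 * b1 ^ 3 + d1 * b2 ^ 3 := by
    linear_combination (Q.re e3) * hnorm - d1 * d2 * Q.add_conj e3 - d2 * h3 - d1 * c3
  let F : Fin 4 → ℤ := ![Q.im e0, Q.im e1, Q.im e2, Q.im e3]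
  let FO : Fin 4 → O := fun i => (F i : O)
  let P : Fin 4 → O := ![d2 * a1 ^ 3 - d1 * a2 ^ 3, d2 * a1 ^ 2 * b1 - d1 * a2 ^ 2 * b2,
    d2 * a1 * b1 ^ 2 - d1 * a2 * b2 ^ 2, d2 * b1 ^ 3 - d1 * b2 ^ 3]
  have hP : P = fun i => (ν : O) * Q.s * FO i := by
    apply ext4
    · exact P0.symm
    · exact P1.symm
    · exact P2.symm
    · exact P3.symm
  have hs0 : Q.s ≠ 0 := fun h => by
    have := Q.s_sq
    rw [h, mul_zero] at this
    exact Q.D_ne (Q.cast_eq_zero this.symm)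
  have hν0' : (ν : O) ≠ 0 := fun h => hν0 (Q.cast_eq_zero h)
  have hdisc : fdisc F = Q.D := by
    have k1 : fdisc P = (d1 * d2) ^ 2 * (a1 * b2 - a2 * b1) ^ 6 := by
      simp only [fdisc, P, Matrix.cons_val]; ring
    have k2 : fdisc P = (ν * Q.s) ^ 4 * fdisc FO := by
      rw [hP]; simp only [fdisc]; ring
    have k3 : a1 * b2 - a2 * b1 = - (t * Q.s) := by rw [hdet]; ring
    have k4 : (t : O) ^ 6 = ν ^ 2 := by rw [← ht']; ring
    have k5 : fdisc FO = (fdisc F : ℤ) := fdisc_map F (Int.castRingHom O)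
    rw [k1, k3, ← hnorm, k5] at k2
    apply Q.cast_inj
    apply mul_left_cancel₀ (mul_ne_zero (pow_ne_zero 4 hν0') (pow_ne_zero 4 hs0))
    linear_combination -k2 + ν ^ 2 * Q.s ^ 6 * k4 + ν ^ 4 * Q.s ^ 4 * Q.s_sq
  have hcov : ∀ (i : Fin 4) (g : ℤ) (w : O), (ν : O) * g = w →
      cG P i = - (d1 * d2) * (a1 * b2 - a2 * b1) ^ 3 * w → cG F i = g := by
    intro i g w hw hc
    have k2 : cG P i = (ν * Q.s) ^ 3 * cG FO i := by
      rw [hP]; fin_cases i <;> simp [cG, cG0, cG1, cG2, cG3] <;> ring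
    have k3 : a1 * b2 - a2 * b1 = - (t * Q.s) := by rw [hdet]; ring
    have k5 : cG FO i = (cG F i : ℤ) := by
      fin_cases i <;> simp [cG, cG0, cG1, cG2, cG3, FO]
    rw [hc, k3, ← hnorm, k5, ← hw] at k2
    apply Q.cast_inj
    apply mul_left_cancel₀ (mul_ne_zero (pow_ne_zero 3 hν0') (pow_ne_zero 3 hs0))
    linear_combination -k2 + ν ^ 2 * Q.s ^ 3 * g * ht'
  refine ⟨F, ![e0, e1, e2, e3], hdisc, ?_, α, hα0, ?_⟩
  · constructor
    · have : cG0 F = Q.re e0 := hcov 0 _ _ R0 (by simp [cG, cG0, P]; ring)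
      rw [this]; exact Q.two_mul_eq e0
    · have : cG1 F = Q.re e1 := hcov 1 _ _ R1 (by simp [cG, cG1, P]; ring)
      rw [this]; exact Q.two_mul_eq e1
    · have : cG2 F = Q.re e2 := hcov 2 _ _ R2 (by simp [cG, cG2, P]; ring)
      rw [this]; exact Q.two_mul_eq e2
    · have : cG3 F = Q.re e3 := hcov 3 _ _ R3 (by simp [cG, cG3, P]; ring)
      rw [this]; exact Q.two_mul_eq e3
  · change e0 * δ = α ^ 3
    linear_combination -h0

end QD
end DH

namespace DH
set_option linter.unusedSectionVars false

/-- Orbits of discriminant `D`. -/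
def orbD (D : ℤ) : Set Orb := toOrb '' {f | fdisc f = D}

abbrev UCubes (O : Type*) [CommRing O] : Type _ := Oˣ ⧸ (powMonoidHom 3 : Oˣ →* Oˣ).range

namespace QD
open nonZeroDivisors
variable {O : Type*} [CommRing O] [IsDedekindDomain O] (Q : QD O)

lemma exists_cl (c : {c : ClassGroup O // c ^ 3 = 1}) :
    ∃ (I : (Ideal O)⁰) (δ : O), ClassGroup.mk0 I = c.1 ∧ (I : Ideal O) ^ 3 = Ideal.span {δ} := by
  obtain ⟨I, hI⟩ := ClassGroup.mk0_surjective c.1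
  have h := c.2
  rw [← hI, ← map_pow, ClassGroup.mk0_eq_one_iff (I ^ 3).2] at h
  obtain ⟨δ, hδ⟩ := h.principal
  exact ⟨I, δ, hI, hδ⟩

include Q in
theorem card_orbD : Nat.card (orbD Q.D) = Nat.card {c : ClassGroup O // c ^ 3 = 1} * Nat.card (UCubes O) := by
  choose I δ hI hδ using exists_cl (O := O)
  have hI0 : ∀ c, (I c : Ideal O) ≠ ⊥ := fun c => nonZeroDivisors.coe_ne_zero (I c)
  have hδu : ∀ (c) (u : Oˣ), (I c : Ideal O) ^ 3 = Ideal.span {(u : O) * δ c} := fun c u => by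
    rw [hδ, Ideal.span_singleton_mul_left_unit u.isUnit]
  have hδ0 : ∀ c, δ c ≠ 0 := fun c h => by
    have := hδ c
    rw [h] at this
    simp only [Ideal.span_singleton_zero] at this
    exact hI0 c (eq_zero_of_pow_eq_zero this)
  choose F e hF he α hα hα3 using fun (c) (q : UCubes O) => Q.exists_form (hI0 c) (hδu c q.out)
  have hassoc : ∀ {a b : O}, Ideal.span {a} = Ideal.span {b} → ∃ w : Oˣ, a * w = b := fun h =>
    Ideal.span_singleton_eq_span_singleton.1 h
  have hcube : ∀ {a b : Ideal O}, a ^ 3 = b ^ 3 → a = b := fun h =>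
    pow_left_injective (M := Ideal O) (n := 3) (by norm_num) h
  let Φ : {c : ClassGroup O // c ^ 3 = 1} × UCubes O → orbD Q.D := fun x =>
    ⟨toOrb (F x.1 x.2), _, hF x.1 x.2, rfl⟩
  have hbij : Function.Bijective Φ := by
    constructor
    · rintro ⟨c, q⟩ ⟨c', q'⟩ h
      have h : toOrb (F c q) = toOrb (F c' q') := congrArg Subtype.val h
      obtain ⟨x, y, hx, hy, hxy⟩ := orbit_cube (hF c q) (he c q) (he c' q') h
      have h1 := hα3 c q
      have h2 := hα3 c' q'
      have h0 := e0_ne (hF c q) (he c q)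
      have h0' := e0_ne (hF c' q') (he c' q')
      have h3 : (α c' q' * y) ^ 3 * ((q.out : Oˣ) * δ c) = (α c q * x) ^ 3 * ((q'.out : Oˣ) * δ c') := by
        rw [mul_pow, mul_pow, ← h1, ← h2]
        linear_combination ((q'.out : Oˣ) : O) * δ c' * (q.out : Oˣ) * δ c * hxy
      have hcc : c = c' := by
        apply Subtype.ext
        rw [← hI c, ← hI c', ClassGroup.mk0_eq_mk0_iff]
        refine ⟨_, _, mul_ne_zero (hα c' q') hy, mul_ne_zero (hα c q) hx, ?_⟩
        apply hcube
        rw [mul_pow, mul_pow, hδu c q.out, hδu c' q'.out, Ideal.span_singleton_pow,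
          Ideal.span_singleton_pow, Ideal.span_singleton_mul_span_singleton,
          Ideal.span_singleton_mul_span_singleton, h3]
      subst hcc
      have h4 : (α c q' * y) ^ 3 * (q.out : Oˣ) = (α c q * x) ^ 3 * (q'.out : Oˣ) :=
        mul_right_cancel₀ (hδ0 c) (by linear_combination h3)
      have h5 : Ideal.span {α c q' * y} = Ideal.span {α c q * x} := by
        apply hcube
        rw [Ideal.span_singleton_pow, Ideal.span_singleton_pow,
          ← Ideal.span_singleton_mul_right_unit (q.out).isUnit, h4,
          Ideal.span_singleton_mul_right_unit (q'.out).isUnit]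
      obtain ⟨w, hw⟩ := hassoc h5
      rw [← hw] at h4
      have h6 : ((q.out : Oˣ) : O) = ((w ^ 3 * q'.out : Oˣ) : O) := by
        apply mul_left_cancel₀ (pow_ne_zero 3 (mul_ne_zero (hα c q') hy))
        rw [h4]; push_cast; ring
      have h7 := Units.ext h6
      have : q = q' := by
        rw [← q.out_eq', ← q'.out_eq']
        change (QuotientGroup.mk q.out : UCubes O) = QuotientGroup.mk q'.out
        rw [QuotientGroup.eq]
        refine ⟨w⁻¹, ?_⟩
        rw [h7]
        simp [powMonoidHom]
      rw [this]
    · rintro ⟨_, f, hf, rfl⟩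
      have hf : fdisc f = Q.D := hf
      obtain ⟨ε, hε⟩ := Q.exists_e hf
      have h0 := e0_ne hf hε
      have hc3 := span_cube hf hε
      have hJ : Ideal.span {ε 0, ε 1} ∈ (Ideal O)⁰ := by
        rw [mem_nonZeroDivisors_iff_ne_zero]
        intro h
        apply h0
        have : ε 0 ∈ Ideal.span {ε 0, ε 1} := Ideal.subset_span (by simp)
        rw [h] at this
        simpa using this
      let J : (Ideal O)⁰ := ⟨_, hJ⟩
      have hJ3 : ClassGroup.mk0 J ^ 3 = 1 := by
        rw [← map_pow, ClassGroup.mk0_eq_one_iff (J ^ 3).2]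
        exact ⟨_, hc3⟩
      let c : {c : ClassGroup O // c ^ 3 = 1} := ⟨_, hJ3⟩
      obtain ⟨x, y, hx, hy, hxy⟩ := ClassGroup.mk0_eq_mk0_iff.1 (hI c).symm
      have h1 := congrArg (· ^ 3) hxy
      simp only [mul_pow] at h1
      rw [show (J : Ideal O) ^ 3 = _ from hc3, hδ c] at h1
      simp only [Ideal.span_singleton_pow, Ideal.span_singleton_mul_span_singleton] at h1
      obtain ⟨u, hu⟩ := hassoc h1.symm
      let q : UCubes O := QuotientGroup.mk u
      have hq : ∃ w : Oˣ, q.out = u * w ^ 3 := by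
        have : (QuotientGroup.mk u : UCubes O) = QuotientGroup.mk q.out := (q.out_eq').symm
        rw [QuotientGroup.eq] at this
        obtain ⟨w, hw⟩ := this
        refine ⟨w, ?_⟩
        have hw : w ^ 3 = u⁻¹ * q.out := hw
        rw [hw]; group
      obtain ⟨w, hw⟩ := hq
      refine ⟨(c, q), Subtype.ext ?_⟩
      change toOrb (F c q) = toOrb f
      symm
      have h2 := hα3 c q
      rw [hw] at h2
      refine cube_orbit hf (hF c q) hε (he c q) (x := α c q * y) (y := w * x * ε 0)
        (mul_ne_zero (hα c q) hy) (mul_ne_zero (mul_ne_zero w.ne_zero hx) h0) ?_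
      push_cast at h2
      linear_combination ε 0 * y ^ 3 * h2 - e c q 0 * w ^ 3 * ε 0 * hu
  rw [← Nat.card_prod]
  exact (Nat.card_eq_of_bijective Φ hbij).symm

end QD
end DH

namespace DH
set_option linter.unusedSectionVars false

lemma Fund.not_sq {D : ℤ} (h : Fund D) (h1 : D ≠ 1) (k : ℤ) : D ≠ k ^ 2 := by
  rintro rfl
  have hk : k.natAbs ≠ 1 := fun hk => h1 (by rw [← Int.natAbs_sq, hk]; norm_num)
  obtain ⟨p, hp, hpk⟩ := Nat.exists_prime_and_dvd hk
  have hpk : (p : ℤ) ∣ k := Int.natCast_dvd.2 hpk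
  obtain ⟨j, rfl⟩ := hpk
  have := h p hp
  unfold FundAt at this
  split_ifs at this with h2
  · subst h2
    rcases Int.even_or_odd' j with ⟨i, hi | hi⟩
    · have : ((2 : ℕ) * j : ℤ) ^ 2 = 16 * i ^ 2 := by rw [hi]; push_cast; ring
      omega
    · have : ((2 : ℕ) * j : ℤ) ^ 2 = 16 * (i ^ 2 + i) + 4 := by rw [hi]; push_cast; ring
      omega
  · exact this ⟨j ^ 2, by ring⟩

lemma Fund.mod4 {D : ℤ} (h : Fund D) : D % 4 = 0 ∨ D % 4 = 1 := by
  have := h 2 Nat.prime_two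
  simp only [FundAt, if_true] at this
  omega

/-- key arithmetic: `n` rational, `n² D` integral and congruence ⇒ integral -/
lemma Fund.int_of {D : ℤ} (h : Fund D) {m N : ℤ} {n : ℚ} (hn : (m : ℚ) ^ 2 - n ^ 2 * D = 4 * N) :
    ∃ k : ℤ, n = k := by
  have hden : (n.den : ℚ) ≠ 0 := by exact_mod_cast n.den_nz
  have h1 : (n.num : ℚ) = n * n.den := (Rat.mul_den_eq_num n).symm
  have h2 : (m ^ 2 - 4 * N) * (n.den : ℤ) ^ 2 = n.num ^ 2 * D := by
    have : ((m : ℚ) ^ 2 - 4 * N) * (n.den : ℚ) ^ 2 = (n.num : ℚ) ^ 2 * D := by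
      rw [h1]; linear_combination (n.den : ℚ) ^ 2 * hn
    exact_mod_cast this
  have hcop : IsCoprime n.num (n.den : ℤ) := Int.isCoprime_iff_nat_coprime.2 (by simpa using n.reduced)
  have h3 : (n.den : ℤ) ^ 2 ∣ D := by
    have : (n.den : ℤ) ^ 2 ∣ n.num ^ 2 * D := ⟨m ^ 2 - 4 * N, by linear_combination -h2⟩
    exact (hcop.symm.pow (m := 2) (n := 2)).dvd_of_dvd_mul_left this
  by_cases hd : n.den = 1
  · exact ⟨n.num, by rw [h1, hd]; simp⟩
  exfalso
  obtain ⟨p, hp, hpd⟩ := Nat.exists_prime_and_dvd hd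
  have hF := h p hp
  have hp2 : (p : ℤ) ^ 2 ∣ D := (pow_dvd_pow_of_dvd (Int.natCast_dvd_natCast.2 hpd) 2).trans h3
  unfold FundAt at hF
  split_ifs at hF with h2'
  · subst h2'
    obtain ⟨v, hv⟩ := hpd
    obtain ⟨D', hD'⟩ := hp2
    have hodd : n.num % 2 = 1 := by
      by_contra hne
      have : (2 : ℤ) ∣ n.num := by omega
      have h22 : (2 : ℤ) ∣ n.den := ⟨v, by exact_mod_cast hv⟩
      have := hcop.isUnit_of_dvd' this h22
      norm_num [Int.isUnit_iff] at this
    rw [hv, hD'] at h2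
    push_cast at h2 hD'
    obtain ⟨u, hu⟩ : ∃ u, n.num = 2 * u + 1 := ⟨n.num / 2, by omega⟩
    have e1 : (m ^ 2 - 4 * N) * (v : ℤ) ^ 2 = (4 * (u ^ 2 + u) + 1) * D' := by
      rw [hu] at h2; linarith
    -- v odd, else 16 ∣ D
    have hvo : (v : ℤ) % 2 = 1 := by
      by_contra hne
      obtain ⟨w, hw⟩ : ∃ w, (v : ℤ) = 2 * w := ⟨v / 2, by omega⟩
      have : (16 : ℤ) ∣ D := by
        refine Dvd.dvd.trans ⟨w ^ 2, ?_⟩ h3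
        rw [hv]; push_cast; rw [hw]; ring
      omega
    obtain ⟨w, hw⟩ : ∃ w, (v : ℤ) = 2 * w + 1 := ⟨v / 2, by omega⟩
    rw [hw] at e1
    have e2 : (m * (2 * w + 1)) ^ 2 - D' = 4 * (N * (2 * w + 1) ^ 2 + (u ^ 2 + u) * D') := by
      linear_combination e1
    rcases Int.even_or_odd' (m * (2 * w + 1)) with ⟨i, hi | hi⟩
    · have : (m * (2 * w + 1)) ^ 2 = 4 * i ^ 2 := by rw [hi]; ring
      omega
    · have : (m * (2 * w + 1)) ^ 2 = 4 * (i ^ 2 + i) + 1 := by rw [hi]; ring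
      omega
  · exact hF hp2

open NumberField Module

section field
variable {K : Type*} [Field K] [NumberField K] {s : K} {D : ℤ}

lemma li_pair (hs : s ^ 2 = D) (h : Fund D) (h1 : D ≠ 1) {a b : ℚ} (hab : (a : K) + b * s = 0) :
    a = 0 ∧ b = 0 := by
  have hb : b = 0 := by
    by_contra hb
    have h2 : (a / b) ^ 2 = (D : ℚ) := by
      have : ((a / b : ℚ) : K) ^ 2 = D := by
        have hbK : (b : K) ≠ 0 := by exact_mod_cast hb
        rw [← hs]; push_cast
        field_simp
        linear_combination (a - b * s) * hab
      exact_mod_cast this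
    have h3 : (m : ℤ) → ¬ D = m ^ 2 := fun m => h.not_sq h1 m
    have hsq : IsSquare ((D : ℤ) : ℚ) := ⟨a / b, by rw [← h2]; ring⟩
    rw [Rat.isSquare_intCast_iff] at hsq
    obtain ⟨k, hk⟩ := hsq
    exact h.not_sq h1 k (by rw [hk]; ring)
  subst hb
  simp at hab
  exact ⟨hab, rfl⟩

lemma li_one_s (hs : s ^ 2 = D) (h : Fund D) (h1 : D ≠ 1) : LinearIndependent ℚ ![(1 : K), s] := by
  rw [LinearIndependent.pair_iff]
  intro a b hab
  simp only [Rat.smul_def, mul_one] at hab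
  exact li_pair hs h h1 hab

noncomputable def basisK (hs : s ^ 2 = D) (h : Fund D) (h1 : D ≠ 1) (hK : finrank ℚ K = 2) :
    Basis (Fin 2) ℚ K :=
  basisOfLinearIndependentOfCardEqFinrank (li_one_s hs h h1) (by simp [hK])

lemma exists_ab (hs : s ^ 2 = D) (h : Fund D) (h1 : D ≠ 1) (hK : finrank ℚ K = 2) (x : K) :
    ∃ a b : ℚ, x = a + b * s ∧ Algebra.trace ℚ K x = 2 * a ∧ Algebra.norm ℚ x = a ^ 2 - b ^ 2 * D := by
  set B := basisK hs h h1 hK with hB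
  have hB0 : B 0 = 1 := by simp [hB, basisK]
  have hB1 : B 1 = s := by simp [hB, basisK]
  have hc : ∀ a b : ℚ, B.repr ((a : K) + b * s) 0 = a ∧ B.repr ((a : K) + b * s) 1 = b := by
    intro a b
    have : (a : K) + b * s = a • B 0 + b • B 1 := by rw [hB0, hB1]; simp [Rat.smul_def]
    rw [this, map_add, map_smul, map_smul, Module.Basis.repr_self, Module.Basis.repr_self]
    constructor <;> simp
  have hx : x = B.repr x 0 + B.repr x 1 * s := by
    conv_lhs => rw [← B.sum_repr x]
    rw [Fin.sum_univ_two, hB0, hB1]; simp [Rat.smul_def]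
  have hxs : x * s = ((B.repr x 1 * D : ℚ) : K) + (B.repr x 0 : ℚ) * s := by
    conv_lhs => rw [hx]
    push_cast; linear_combination (B.repr x 1 : K) * hs
  refine ⟨_, _, hx, ?_, ?_⟩
  · rw [Algebra.trace_eq_matrix_trace B, Matrix.trace_fin_two]
    simp only [Algebra.leftMulMatrix_eq_repr_mul, hB0, hB1]
    rw [mul_one, hxs, (hc _ _).2]; ring
  · rw [Algebra.norm_eq_matrix_det B, Matrix.det_fin_two]
    simp only [Algebra.leftMulMatrix_eq_repr_mul, hB0, hB1]
    rw [mul_one, hxs, (hc _ _).2, (hc _ _).1]; ring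

lemma exists_int_of_isIntegral {q : ℚ} (h : IsIntegral ℤ q) : ∃ n : ℤ, q = n := by
  obtain ⟨n, hn⟩ := IsIntegrallyClosed.isIntegral_iff.1 h
  exact ⟨n, by simpa using hn.symm⟩

lemma tau_integral (hs : s ^ 2 = D) (h : Fund D) : IsIntegral ℤ ((D + s) / 2 : K) := by
  obtain ⟨k, hk⟩ : ∃ k : ℤ, D * D - D = 4 * k := by
    rcases h.mod4 with h3 | h3
    · obtain ⟨j, hj⟩ : ∃ j, D = 4 * j := ⟨D / 4, by omega⟩
      exact ⟨4 * j ^ 2 - j, by rw [hj]; ring⟩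
    · obtain ⟨j, hj⟩ : ∃ j, D = 4 * j + 1 := ⟨D / 4, by omega⟩
      exact ⟨4 * j ^ 2 + j, by rw [hj]; ring⟩
  have hk' : (D : K) * D - D = 4 * k := by exact_mod_cast congrArg (Int.cast : ℤ → K) hk
  refine ⟨Polynomial.X ^ 2 + (Polynomial.C (-D) * Polynomial.X + Polynomial.C k), ?_, ?_⟩
  · apply Polynomial.monic_X_pow_add
    exact (Polynomial.degree_linear_le).trans_lt (by norm_num)
  · simp only [Polynomial.eval₂_add, Polynomial.eval₂_pow, Polynomial.eval₂_X, Polynomial.eval₂_mul,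
      Polynomial.eval₂_C]
    simp only [algebraMap_int_eq, eq_intCast, Int.cast_neg]
    linear_combination (1 / 4 : K) * hs - (1 / 4 : K) * hk'

lemma exists_QD (hs : s ^ 2 = D) (h : Fund D) (h1 : D ≠ 1) (hK : finrank ℚ K = 2) :
    ∃ Q : QD (𝓞 K), Q.D = D := by
  obtain ⟨τ, hτ⟩ : ∃ τ : 𝓞 K, algebraMap (𝓞 K) K τ = (D + s) / 2 :=
    ⟨⟨(D + s) / 2, tau_integral hs h⟩, rfl⟩
  have hli : LinearIndependent ℤ ![(1 : 𝓞 K), τ] := by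
    rw [LinearIndependent.pair_iff]
    intro a b hab
    have hab' := congrArg (algebraMap (𝓞 K) K) hab
    simp only [zsmul_eq_mul, mul_one, map_add, map_mul, map_intCast, map_zero] at hab'
    rw [hτ] at hab'
    have h0 : ((a + b * D / 2 : ℚ) : K) + ((b / 2 : ℚ) : K) * s = 0 := by
      push_cast; linear_combination hab'
    have := li_pair hs h h1 h0
    have hb : (b : ℚ) = 0 := by simpa using this.2
    have ha : (a : ℚ) = 0 := by
      have h5 := this.1
      rw [hb] at h5; simpa using h5
    exact ⟨by exact_mod_cast ha, by exact_mod_cast hb⟩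
  have hsp : ⊤ ≤ Submodule.span ℤ (Set.range ![(1 : 𝓞 K), τ]) := by
    rintro x -
    obtain ⟨a, b, hx, ht, hn⟩ := exists_ab hs h h1 hK (algebraMap (𝓞 K) K x)
    obtain ⟨m, hm⟩ := exists_int_of_isIntegral (Algebra.isIntegral_trace (L := ℚ) (F := K) (RingOfIntegers.isIntegral_coe x))
    obtain ⟨N, hN⟩ := exists_int_of_isIntegral (Algebra.isIntegral_norm ℚ (RingOfIntegers.isIntegral_coe x))
    rw [ht] at hm
    rw [hn] at hN
    have e1 : (m : ℚ) ^ 2 - (2 * b) ^ 2 * D = 4 * N := by rw [← hm, ← hN]; ring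
    obtain ⟨n, hn'⟩ := h.int_of e1
    have e2 : m ^ 2 = n ^ 2 * D + 4 * N := by
      rw [hn'] at e1
      have : (m : ℚ) ^ 2 = n ^ 2 * D + 4 * N := by linarith
      exact_mod_cast this
    have e3 : 2 ∣ m - n * D := by
      have h1 : m ^ 2 % 2 = (n ^ 2 * D) % 2 := by omega
      rcases Int.even_or_odd m with hm | hm <;> rcases Int.even_or_odd n with hn | hn <;>
      rcases Int.even_or_odd D with hD | hD <;>
      · obtain ⟨a, ha⟩ := hm
        obtain ⟨b, hb⟩ := hn
        obtain ⟨c, hc⟩ := hD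
        rw [ha, hb, hc] at h1 ⊢
        ring_nf at h1 ⊢
        omega
    obtain ⟨k, hk⟩ := e3
    have hxe : x = k • (1 : 𝓞 K) + n • τ := by
      refine RingOfIntegers.ext (show algebraMap (𝓞 K) K _ = algebraMap (𝓞 K) K _ from ?_)
      simp only [zsmul_eq_mul, mul_one, map_add, map_mul, map_intCast]
      rw [hτ, hx]
      have ha : (a : K) = m / 2 := by
        have : a = m / 2 := by rw [← hm]; ring
        rw [this]; push_cast; ring
      have hb : (b : K) = n / 2 := by
        have : b = n / 2 := by rw [← hn']; ring
        rw [this]; push_cast; ring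
      have hk' : (m : K) - n * D = 2 * k := by exact_mod_cast congrArg (Int.cast : ℤ → K) hk
      rw [ha, hb]
      linear_combination (1 / 2 : K) * hk'
    rw [hxe]
    refine Submodule.add_mem _ (Submodule.smul_mem _ _ (Submodule.subset_span ⟨0, rfl⟩))
      (Submodule.smul_mem _ _ (Submodule.subset_span ⟨1, rfl⟩))
  refine ⟨⟨D, τ, Basis.mk hli hsp, by simp, by simp, ?_, h⟩, rfl⟩
  apply RingOfIntegers.ext
  simp only [map_sub, map_mul, map_intCast, map_ofNat]
  rw [hτ]
  linear_combination hs

end field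

lemma QD.trace_eq {O : Type*} [CommRing O] [IsDedekindDomain O] (Q : QD O) (x : O) :
    Algebra.trace ℤ O x = Q.re x := by
  rw [Algebra.trace_eq_matrix_trace Q.b, Matrix.trace_fin_two]
  simp only [Algebra.leftMulMatrix_eq_repr_mul, Q.b0, Q.b1]
  have h := Q.two_mul_eq (x * Q.τ)
  have h2 := Q.two_mul_eq x
  have h4 := Q.hτ
  have h5 := Q.s_sq
  have h6 : Q.s = 2 * Q.τ - Q.D := rfl
  have h3 : ((2 * Q.re (x * Q.τ) : ℤ) : O) + (2 * Q.im (x * Q.τ) : ℤ) * Q.s =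
      ((Q.re x * Q.D + Q.im x * Q.D : ℤ) : O) + (Q.re x + Q.im x * Q.D : ℤ) * Q.s := by
    push_cast
    linear_combination -2 * h + 2 * Q.τ * h2 - (Q.re x + Q.im x * Q.s) * h6 + Q.im x * h5
  have := (Q.indep' h3).2
  have e1 : Q.im (x * Q.τ) = Q.b.repr (x * Q.τ) 1 := rfl
  have e2 : Q.re x = 2 * Q.b.repr x 0 + Q.b.repr x 1 * Q.D := rfl
  have e3 : Q.im x = Q.b.repr x 1 := rfl
  rw [mul_one, ← e1]
  rw [e3] at this
  linarith

lemma QD.discr_eq {K : Type*} [Field K] [NumberField K] (Q : QD (𝓞 K)) : NumberField.discr K = Q.D := by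
  rw [← NumberField.discr_eq_discr K Q.b, Algebra.discr_def, Matrix.det_fin_two]
  simp only [Algebra.traceMatrix_apply, Algebra.traceForm_apply, Q.b0, Q.b1, Q.trace_eq, mul_one, one_mul]
  have h1 : Q.re 1 = 2 := (Q.re_im_of (m := 2) (n := 0) (by simp)).1
  have h2 : Q.re Q.τ = Q.D := (Q.re_im_of (m := Q.D) (n := 1) (by simp [QD.s])).1
  have h4 := Q.two_mul_eq (Q.τ * Q.τ)
  have h3 : ((2 * Q.re (Q.τ * Q.τ) : ℤ) : 𝓞 K) + (2 * Q.im (Q.τ * Q.τ) : ℤ) * Q.s =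
     ((Q.D * Q.D + Q.D : ℤ) : 𝓞 K) + (2 * Q.D : ℤ) * Q.s := by
    have := Q.hτ
    have h6 : Q.s = 2 * Q.τ - Q.D := rfl
    push_cast
    linear_combination -2 * h4 + this - 2 * Q.D * h6
  have := (Q.indep' h3).1
  rw [h1, h2]
  linarith

end DH

namespace DH
set_option linter.unusedSectionVars false
open NumberField Module

lemma QD.norm4 {O : Type*} [CommRing O] [IsDedekindDomain O] (Q : QD O) (x : O) :
    4 * Algebra.norm ℤ x = Q.re x ^ 2 - Q.im x ^ 2 * Q.D := by
  apply Q.cast_inj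
  push_cast
  rw [Q.norm_eq]
  have : 4 * (x * Q.conj x) = (2 * x) * (2 * Q.conj x) := by ring
  rw [this, Q.two_mul_eq, Q.two_conj]
  linear_combination (-(Q.im x : O) ^ 2) * Q.s_sq

theorem QD.card_UCubes_imag {O : Type*} [CommRing O] [IsDedekindDomain O] (Q : QD O) (hD : Q.D < -4) :
    Nat.card (UCubes O) = 1 := by
  rw [Nat.card_eq_one_iff_unique]
  refine ⟨⟨?_⟩, inferInstance⟩
  have hall : ∀ u : Oˣ, ∃ w : Oˣ, w ^ 3 = u := by
    intro u
    have hN : Algebra.norm ℤ (u : O) = 1 ∨ Algebra.norm ℤ (u : O) = -1 :=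
      Int.isUnit_iff.1 (u.isUnit.map (Algebra.norm ℤ))
    have h4 := Q.norm4 (u : O)
    have him : Q.im (u : O) = 0 := by
      by_contra hne
      have h0 : 0 < Q.im (u : O) ^ 2 := by positivity
      have h5 : 0 ≤ (Q.im (u : O) ^ 2 - 1) * (-4 - Q.D) := mul_nonneg (by omega) (by omega)
      rcases hN with h | h <;> rw [h] at h4 <;> nlinarith [sq_nonneg (Q.re (u : O))]
    rw [him] at h4
    have hre : Q.re (u : O) = 2 ∨ Q.re (u : O) = -2 := by
      have : Q.re (u : O) ^ 2 = 2 ^ 2 := by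
        rcases hN with h | h
        · rw [h] at h4; linarith
        · rw [h] at h4; nlinarith [sq_nonneg (Q.re (u : O))]
      exact sq_eq_sq_iff_eq_or_eq_neg.1 this
    have h2 := Q.two_mul_eq (u : O)
    rw [him] at h2
    rcases hre with h | h
    · refine ⟨1, Units.ext (Q.two_cancel ?_)⟩
      rw [h2, h]; simp
    · refine ⟨-1, Units.ext (Q.two_cancel ?_)⟩
      rw [h2, h]; push_cast; ring
  intro a b
  induction a using QuotientGroup.induction_on with | H a => ?_
  induction b using QuotientGroup.induction_on with | H b => ?_
  rw [QuotientGroup.eq]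
  obtain ⟨w, hw⟩ := hall (a⁻¹ * b)
  exact ⟨w, hw⟩

section real
variable {K : Type*} [Field K] [NumberField K]

lemma rank_one {s : K} {D : ℤ} (hs : s ^ 2 = D) (hF : Fund D) (h1 : D ≠ 1) (hK : finrank ℚ K = 2)
    (hD : 0 < D) : Units.rank K = 1 := by
  have hreal : ∀ w : InfinitePlace K, w.IsReal := by
    intro w
    rw [InfinitePlace.isReal_iff, ComplexEmbedding.isReal_iff]
    ext x
    obtain ⟨a, b, rfl, -, -⟩ := exists_ab hs hF h1 hK x
    have hsr : (starRingEnd ℂ) (w.embedding s) = w.embedding s := by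
      have h2 : (w.embedding s) ^ 2 = ((Real.sqrt D : ℝ) : ℂ) ^ 2 := by
        rw [← map_pow, hs, map_intCast, ← Complex.ofReal_pow, Real.sq_sqrt (by exact_mod_cast hD.le)]
        simp
      rcases sq_eq_sq_iff_eq_or_eq_neg.1 h2 with h | h <;> rw [h] <;> simp
    simp [ComplexEmbedding.conjugate_coe_eq, hsr]
  have hc : InfinitePlace.nrComplexPlaces K = 0 := by
    haveI : IsTotallyReal K := ⟨hreal⟩
    exact IsTotallyReal.nrComplexPlaces_eq_zero K
  have h2 := InfinitePlace.card_add_two_mul_card_eq_rank K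
  have h3 := InfinitePlace.card_eq_nrRealPlaces_add_nrComplexPlaces K
  rw [Units.rank, h3]
  omega

theorem card_UCubes_real {s : K} {D : ℤ} (hs : s ^ 2 = D) (hF : Fund D) (h1 : D ≠ 1)
    (hK : finrank ℚ K = 2) (hD : 0 < D) : Nat.card (UCubes (𝓞 K)) = 3 := by
  obtain ⟨Q, hQ⟩ := exists_QD hs hF h1 hK
  have hr := rank_one hs hF h1 hK hD
  let i0 : Fin (Units.rank K) := ⟨0, by omega⟩
  have huniq : ∀ i : Fin (Units.rank K), i = i0 := fun i => Fin.ext (by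
    have := i.2
    simp only [i0]; omega)
  set ε := Units.fundSystem K i0 with hε
  have hprod : ∀ e : Fin (Units.rank K) → ℤ, ∏ i, (Units.fundSystem K i) ^ (e i) = ε ^ (e i0) := by
    intro e
    rw [Finset.prod_eq_single i0 (fun b _ hb => absurd (huniq b) hb) (fun h => absurd (Finset.mem_univ _) h)]
  have hex : ∀ u : (𝓞 K)ˣ, ∃ n : ℤ, u * ε ^ (-n) ∈ Units.torsion K := by
    intro u
    obtain ⟨⟨ζ, e⟩, he, -⟩ := Units.exist_unique_eq_mul_prod K u
    refine ⟨e i0, ?_⟩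
    simp only [hprod] at he
    rw [he, mul_assoc, ← zpow_add]
    simp
  have hun : ∀ n : ℤ, ε ^ n ∈ Units.torsion K → n = 0 := by
    intro n hn
    obtain ⟨p, hp, hu⟩ := Units.exist_unique_eq_mul_prod K (ε ^ n)
    have h1 := hu (⟨ε ^ n, hn⟩, fun _ => 0) (by simp)
    have h2 := hu (1, fun _ => n) (by simp only [hprod]; simp)
    have h3 := congrArg (fun q => q.2 i0) (h1.trans h2.symm)
    exact h3.symm
  choose L0 hL0 using hex
  have hL0u : ∀ u n, u * ε ^ (-n) ∈ Units.torsion K → L0 u = n := by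
    intro u n h
    have h1 := mul_mem h (inv_mem (hL0 u))
    have h2 : u * ε ^ (-n) * (u * ε ^ (-L0 u))⁻¹ = ε ^ (L0 u - n) := by
      rw [zpow_sub, zpow_neg, zpow_neg]
      rw [mul_inv, inv_inv]
      calc u * (ε ^ n)⁻¹ * (u⁻¹ * ε ^ L0 u) = (u * u⁻¹) * (ε ^ L0 u * (ε ^ n)⁻¹) := by ac_rfl
        _ = _ := by simp
    rw [h2] at h1
    have := hun _ h1
    omega
  let L : Additive (𝓞 K)ˣ →+ ℤ := AddMonoidHom.mk' (fun u => L0 u.toMul) (by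
    intro a b
    apply hL0u
    have := mul_mem (hL0 a.toMul) (hL0 b.toMul)
    have h2 : a.toMul * ε ^ (-L0 a.toMul) * (b.toMul * ε ^ (-L0 b.toMul)) =
      (a + b).toMul * ε ^ (-(L0 a.toMul + L0 b.toMul)) := by
      rw [neg_add, zpow_add, toMul_add]; ac_rfl
    rwa [h2] at this)
  let φ : Additive (𝓞 K)ˣ →+ ZMod 3 := (Int.castAddHom (ZMod 3)).comp L
  let ψ : (𝓞 K)ˣ →* Multiplicative (ZMod 3) := AddMonoidHom.toMultiplicativeRight φ
  have hLsurj : Function.Surjective L := by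
    intro n
    refine ⟨Additive.ofMul (ε ^ n), hL0u _ _ ?_⟩
    simp
  have hLker : ∀ u : (𝓞 K)ˣ, L (Additive.ofMul u) = 0 → u ∈ Units.torsion K := by
    intro u hu
    have hu : L0 u = 0 := hu
    have := hL0 u
    rw [hu] at this
    simpa using this
  have htor : ∀ u ∈ Units.torsion K, ∃ w : (𝓞 K)ˣ, w ^ 3 = u := by
    intro u hu
    have hinj : Function.Injective (fun x : Units.torsion K => x ^ 3) := by
      have : Function.Injective (powMonoidHom 3 : Units.torsion K →* Units.torsion K) := by
        rw [injective_iff_map_eq_one]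
        intro x hx
        have hx : x ^ 3 = 1 := hx
        have hx' : (((x : (𝓞 K)ˣ) : 𝓞 K)) ^ 3 = 1 := by
          have := congrArg (fun y : Units.torsion K => (((y : (𝓞 K)ˣ) : 𝓞 K))) hx
          simpa using this
        set z := (((x : (𝓞 K)ˣ) : 𝓞 K)) with hz
        have h3 : (z - 1) * (z ^ 2 + z + 1) = 0 := by linear_combination hx'
        rcases mul_eq_zero.1 h3 with h | h
        · apply Subtype.ext; apply Units.ext
          change z = 1
          linear_combination h
        · exfalso
          have h4 : (2 * (2 * z) + 2) ^ 2 = ((-12 : ℤ) : 𝓞 K) + (0 : ℤ) * Q.s := by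
            push_cast; linear_combination 16 * h
          rw [Q.two_mul_eq z] at h4
          have h5 : (((2 * Q.re z + 2) ^ 2 + 4 * Q.im z ^ 2 * Q.D : ℤ) : 𝓞 K) +
            (4 * Q.im z * (2 * Q.re z + 2) : ℤ) * Q.s = ((-12 : ℤ) : 𝓞 K) + (0 : ℤ) * Q.s := by
              rw [← h4]; push_cast
              linear_combination (-4 * (Q.im z : 𝓞 K) ^ 2) * Q.s_sq
          have h6 := (Q.indep' h5).1
          rw [hQ] at h6
          nlinarith [sq_nonneg (2 * Q.re z + 2), mul_nonneg (sq_nonneg (Q.im z)) hD.le]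
      exact this
    have hsurj := Finite.surjective_of_injective hinj
    obtain ⟨w, hw⟩ := hsurj ⟨u, hu⟩
    exact ⟨w, by simpa using congrArg Subtype.val hw⟩
  have hψsurj : Function.Surjective ψ := by
    intro z
    obtain ⟨n, hn⟩ := ZMod.intCast_surjective (Multiplicative.toAdd z)
    obtain ⟨u, hu⟩ := hLsurj n
    refine ⟨Additive.toMul u, ?_⟩
    change Multiplicative.ofAdd ((Int.castAddHom (ZMod 3)) (L u)) = z
    rw [hu]; simp [hn]
  have hker : ψ.ker = (powMonoidHom 3 : (𝓞 K)ˣ →* (𝓞 K)ˣ).range := by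
    ext u
    rw [MonoidHom.mem_ker]
    have : ψ u = 1 ↔ ((L (Additive.ofMul u) : ℤ) : ZMod 3) = 0 := Iff.rfl
    rw [this]
    have h30 : ((L (Additive.ofMul u) : ℤ) : ZMod 3) = 0 ↔ (3 : ℤ) ∣ L (Additive.ofMul u) := by
      rw [ZMod.intCast_zmod_eq_zero_iff_dvd]; rfl
    rw [h30]
    constructor
    · rintro ⟨k, hk⟩
      obtain ⟨v, hv⟩ := hLsurj k
      have h7 : L (Additive.ofMul (u * (Additive.toMul v ^ 3)⁻¹)) = 0 := by
        have : Additive.ofMul (u * (Additive.toMul v ^ 3)⁻¹) = Additive.ofMul u - (3 : ℤ) • v := by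
          rw [sub_eq_add_neg]; rfl
        rw [this, map_sub, map_zsmul, hv, hk]
        simp
      obtain ⟨w, hw⟩ := htor _ (hLker _ h7)
      refine ⟨w * Additive.toMul v, ?_⟩
      change (w * Additive.toMul v) ^ 3 = u
      rw [mul_pow, hw]; group
    · rintro ⟨w, hw⟩
      have hw : w ^ 3 = u := hw
      rw [← hw, ofMul_pow, map_nsmul]
      exact ⟨L (Additive.ofMul w), by simp⟩
  have e : UCubes (𝓞 K) ≃* Multiplicative (ZMod 3) :=
    (QuotientGroup.quotientMulEquivOfEq hker.symm).trans
      (QuotientGroup.quotientKerEquivOfSurjective ψ hψsurj)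
  rw [Nat.card_congr e.toEquiv]
  simp
end real
end DH

namespace DH
open MeasureTheory Filter Topology Set

section lattice
variable {n : ℕ}

/-- rounding map -/
noncomputable def rnd (m : ℕ) (r : Fin n → ℤ) (l : ℝ) (y : Fin n → ℝ) : Fin n → ℝ :=
  fun i => ((r i : ℝ) + m * ⌊l * y i / m⌋) / l

lemma rnd_sub {m : ℕ} (hm : 0 < m) (r : Fin n → ℤ) {l : ℝ} (hl : 0 < l) (y : Fin n → ℝ) (i : Fin n) :
    |rnd m r l y i - y i| ≤ (|(r i : ℝ)| + m) / l := by
  have hm' : (0 : ℝ) < m := by exact_mod_cast hm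
  have h1 := Int.floor_le (l * y i / m)
  have h2 := Int.lt_floor_add_one (l * y i / m)
  set t : ℝ := (⌊l * y i / m⌋ : ℝ)
  have h3 : t * m ≤ l * y i := (le_div_iff₀ hm').1 h1
  have h4 : l * y i < (t + 1) * m := (div_lt_iff₀ hm').1 h2
  have : rnd m r l y i - y i = ((r i : ℝ) + (m * t - l * y i)) / l := by
    simp only [rnd]; field_simp; ring
  rw [this, abs_div, abs_of_pos hl]
  gcongr
  refine (abs_add_le _ _).trans ?_
  gcongr
  rw [abs_le]; constructor <;> linarith

lemma tendsto_rnd {m : ℕ} (hm : 0 < m) (r : Fin n → ℤ) (y : Fin n → ℝ) :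
    Tendsto (fun l => rnd m r l y) atTop (𝓝 y) := by
  rw [tendsto_pi_nhds]
  intro i
  rw [tendsto_iff_norm_sub_tendsto_zero]
  refine squeeze_zero' (Eventually.of_forall fun _ => norm_nonneg _) ?_
    (tendsto_const_nhds.div_atTop tendsto_id : Tendsto (fun l : ℝ => (|(r i : ℝ)| + m) / l) atTop (𝓝 0))
  filter_upwards [eventually_gt_atTop 0] with l hl
  exact rnd_sub hm r hl y i

/-- the set of lattice points counted -/
def lat (m : ℕ) (r : Fin n → ℤ) (l : ℝ) (s : Set (Fin n → ℝ)) : Set (Fin n → ℤ) :=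
  {x | (fun i => ((r i : ℝ) + m * x i) / l) ∈ s}

lemma vol_preimage {m : ℕ} (hm : 0 < m) (r : Fin n → ℤ) {l : ℝ} (hl : 0 < l) (s : Set (Fin n → ℝ)) :
    MeasurableSet (rnd m r l ⁻¹' s) ∧
    volume (rnd m r l ⁻¹' s) = ENat.toENNReal (lat m r l s).encard * ENNReal.ofReal ((m / l) ^ n) := by
  have hm' : (0 : ℝ) < m := by exact_mod_cast hm
  let cell : (Fin n → ℤ) → Set (Fin n → ℝ) := fun x =>
    Set.pi univ fun i => Ico ((m / l) * x i) ((m / l) * (x i + 1))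
  have hcell : ∀ x y, y ∈ cell x ↔ (fun i => ⌊l * y i / m⌋) = x := by
    intro x y
    simp only [cell, Set.mem_pi, mem_univ, forall_true_left, mem_Ico, funext_iff]
    refine forall_congr' fun i => ?_
    rw [Int.floor_eq_iff, le_div_iff₀ hm', div_lt_iff₀ hm']
    have e1 : m / l * (x i : ℝ) = (x i * m) / l := by ring
    have e2 : m / l * ((x i : ℝ) + 1) = ((x i + 1) * m) / l := by ring
    rw [e1, e2, div_le_iff₀ hl, lt_div_iff₀ hl, mul_comm (y i) l]
  have hmeas : ∀ x, MeasurableSet (cell x) := fun x =>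
    MeasurableSet.univ_pi fun i => measurableSet_Ico
  have hvol : ∀ x, volume (cell x) = ENNReal.ofReal ((m / l) ^ n) := by
    intro x
    rw [Real.volume_pi_Ico]
    have : ∀ i, (m / l) * ((x i : ℝ) + 1) - (m / l) * x i = m / l := fun i => by ring
    simp only [this]
    rw [Finset.prod_const, Finset.card_univ, Fintype.card_fin, ← ENNReal.ofReal_pow (by positivity)]
  have hU : rnd m r l ⁻¹' s = ⋃ x ∈ lat m r l s, cell x := by
    ext y
    simp only [mem_preimage, mem_iUnion, exists_prop, hcell]
    constructor
    · intro h; exact ⟨_, h, rfl⟩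
    · rintro ⟨x, hx, rfl⟩; exact hx
  rw [hU]
  have hcount : (lat m r l s).Countable := Set.to_countable _
  refine ⟨MeasurableSet.biUnion hcount fun x _ => hmeas x, ?_⟩
  rw [measure_biUnion hcount ?_ fun x _ => hmeas x]
  · simp only [hvol]
    rw [ENNReal.tsum_const]
    rfl
  · intro x _ x' _ hne
    rw [Function.onFun, Set.disjoint_left]
    intro y hy hy'
    exact hne (((hcell _ _).1 hy).symm.trans ((hcell _ _).1 hy'))

theorem lattice_count {m : ℕ} (hm : 0 < m) (r : Fin n → ℤ) {s : Set (Fin n → ℝ)}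
    (hb : Bornology.IsBounded s) (hf : volume (frontier s) = 0) :
    Tendsto (fun l : ℝ => ((lat m r l s).ncard : ℝ) / l ^ n) atTop
      (𝓝 ((volume s).toReal / (m : ℝ) ^ n)) := by
  have hm' : (0 : ℝ) < m := by exact_mod_cast hm
  obtain ⟨R, hR⟩ := hb.subset_closedBall 0
  obtain ⟨ρ, hρ, hρr⟩ : ∃ ρ : ℝ, 0 < ρ ∧ ∀ i, |(r i : ℝ)| + m ≤ ρ := by
    refine ⟨(∑ i, |(r i : ℝ)|) + m, by positivity, fun i => ?_⟩
    gcongr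
    exact Finset.single_le_sum (f := fun i => |(r i : ℝ)|) (fun _ _ => abs_nonneg _) (Finset.mem_univ i)
  have hsm : NullMeasurableSet s volume := by
    have h1 : s =ᵐ[volume] closure s := by
      refine ae_eq_set.2 ⟨by rw [diff_eq_empty.2 subset_closure]; simp, ?_⟩
      refine measure_mono_null ?_ hf
      exact fun x hx => ⟨hx.1, fun hi => hx.2 (interior_subset hi)⟩
    exact (isClosed_closure.measurableSet.nullMeasurableSet).congr h1.symm
  have hconv : Tendsto (fun l : ℝ => ∫ y, (rnd m r l ⁻¹' s).indicator (fun _ => (1 : ℝ)) y) atTop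
      (𝓝 (∫ y, s.indicator (fun _ => (1 : ℝ)) y)) := by
    apply tendsto_integral_filter_of_dominated_convergence
      ((Metric.closedBall (0 : Fin n → ℝ) (R + ρ)).indicator (fun _ => (1 : ℝ)))
    · filter_upwards [eventually_gt_atTop 0] with l hl
      exact (aestronglyMeasurable_const.indicator (vol_preimage hm r hl s).1)
    · filter_upwards [eventually_ge_atTop 1] with l hl
      refine Eventually.of_forall fun y => ?_
      have hl0 : (0 : ℝ) < l := by linarith
      by_cases hy : rnd m r l y ∈ s
      · have : y ∈ Metric.closedBall (0 : Fin n → ℝ) (R + ρ) := by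
          have h1 := hR hy
          rw [mem_closedBall_zero_iff] at h1 ⊢
          have h2 : ‖rnd m r l y - y‖ ≤ ρ := by
            rw [pi_norm_le_iff_of_nonneg hρ.le]
            intro i
            refine (rnd_sub hm r hl0 y i).trans ?_
            refine (div_le_self (by positivity) hl).trans (hρr i)
          calc ‖y‖ = ‖rnd m r l y - (rnd m r l y - y)‖ := by congr 1; abel
            _ ≤ ‖rnd m r l y‖ + ‖rnd m r l y - y‖ := norm_sub_le _ _
            _ ≤ R + ρ := add_le_add h1 h2
        rw [indicator_of_mem this, indicator_of_mem (show y ∈ rnd m r l ⁻¹' s from hy)]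
        simp
      · rw [indicator_of_notMem (show y ∉ rnd m r l ⁻¹' s from hy)]
        simp only [norm_zero]
        exact indicator_nonneg (fun _ _ => zero_le_one) _
    · rw [integrable_indicator_iff Metric.isClosed_closedBall.measurableSet]
      exact integrableOn_const (isCompact_closedBall _ _).measure_lt_top.ne
    · have : ∀ᵐ y : Fin n → ℝ, y ∉ frontier s := measure_eq_zero_iff_ae_notMem.1 hf
      filter_upwards [this] with y hy
      have ht := tendsto_rnd hm r y
      apply tendsto_nhds_of_eventually_eq
      by_cases hys : y ∈ s
      · have hi : y ∈ interior s := by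
          by_contra h; exact hy ⟨subset_closure hys, h⟩
        filter_upwards [ht (mem_interior_iff_mem_nhds.1 hi)] with l hl
        rw [indicator_of_mem hys, indicator_of_mem (show y ∈ rnd m r l ⁻¹' s from hl)]
      · have hi : y ∉ closure s := fun h => hy ⟨h, fun h' => hys (interior_subset h')⟩
        have : (closure s)ᶜ ∈ 𝓝 y := isClosed_closure.isOpen_compl.mem_nhds hi
        filter_upwards [ht this] with l hl
        rw [indicator_of_notMem hys, indicator_of_notMem (show y ∉ rnd m r l ⁻¹' s from fun h => hl (subset_closure h))]
  rw [integral_indicator₀ hsm] at hconv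
  have h2 := (hconv.div_const ((m : ℝ) ^ n))
  have e : ∫ _ in s, (1 : ℝ) = (volume s).toReal := by simp [Measure.real]
  rw [e] at h2
  refine h2.congr' ?_
  filter_upwards [eventually_gt_atTop 0] with l hl
  have hv := vol_preimage hm r hl s
  rw [integral_indicator hv.1]
  simp only [integral_const, MeasurableSet.univ, measureReal_restrict_apply, univ_inter, smul_eq_mul, mul_one]
  rw [Measure.real, hv.2, ENNReal.toReal_mul, ENNReal.toReal_ofReal (by positivity), div_pow, ncard]
  have : (ENat.toENNReal (lat m r l s).encard).toReal = ((lat m r l s).encard.toNat : ℝ) := by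
    cases h : (lat m r l s).encard <;> simp
  rw [this]
  field_simp

lemma lat_finite {s : Set (Fin n → ℝ)} (hb : Bornology.IsBounded s) {l : ℝ} (hl : 0 < l) :
    {x : Fin n → ℤ | (fun i => (x i : ℝ) / l) ∈ s}.Finite := by
  obtain ⟨R, hR⟩ := hb.subset_closedBall 0
  refine (Set.Finite.pi' (t := fun _ : Fin n => Set.Icc (-⌈R * l⌉) ⌈R * l⌉)
    (fun _ => Set.finite_Icc _ _)).subset ?_
  intro x hx i
  have h1 := hR hx
  rw [mem_closedBall_zero_iff] at h1
  have h2 := (norm_le_pi_norm _ i).trans h1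
  rw [Real.norm_eq_abs, abs_div, abs_of_pos hl, div_le_iff₀ hl] at h2
  have h3 := h2.trans (Int.le_ceil (R * l))
  rw [abs_le] at h3
  constructor
  · exact_mod_cast h3.1
  · exact_mod_cast h3.2

theorem density {ι : Type*} [Fintype ι] (q : ι → ℕ) (hq : ∀ i, 0 < q i)
    (hc : Pairwise (Function.onFun Nat.Coprime q)) (G : ∀ i, Set (Fin n → ZMod (q i)))
    {s : Set (Fin n → ℝ)} (hb : Bornology.IsBounded s) (hf : volume (frontier s) = 0) :
    Tendsto (fun l : ℝ => (({x : Fin n → ℤ | (fun i => (x i : ℝ) / l) ∈ s ∧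
        ∀ i, (fun j => (x j : ZMod (q i))) ∈ G i}.ncard : ℕ) : ℝ) / l ^ n) atTop
      (𝓝 ((volume s).toReal * ∏ i, ((G i).ncard : ℝ) / (q i : ℝ) ^ n)) := by
  classical
  set m := ∏ i, q i with hmdef
  have hm : 0 < m := Finset.prod_pos fun i _ => hq i
  haveI : NeZero m := ⟨hm.ne'⟩
  haveI : ∀ i, NeZero (q i) := fun i => ⟨(hq i).ne'⟩
  let e : ZMod m ≃+* ∀ i, ZMod (q i) := ZMod.prodEquivPi q hc
  have he : ∀ (z : ℤ) i, e (z : ZMod m) i = (z : ZMod (q i)) := by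
    intro z i
    rw [map_intCast]; simp
  let E : (Fin n → ZMod m) ≃ ∀ i, (Fin n → ZMod (q i)) :=
    { toFun := fun ρ i j => e (ρ j) i
      invFun := fun σ j => e.symm (fun i => σ i j)
      left_inv := fun ρ => by funext j; simp
      right_inv := fun σ => by funext i j; simp }
  let GG : Finset (Fin n → ZMod m) := Finset.univ.filter fun ρ => ∀ i, E ρ i ∈ G i
  have hGG : (GG.card : ℝ) = ∏ i, ((G i).ncard : ℝ) := by
    have h1 : GG.map E.toEmbedding = Fintype.piFinset fun i => (G i).toFinset := by
      ext σ
      simp only [Finset.mem_map_equiv, GG, Finset.mem_filter, Finset.mem_univ, true_and,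
        Equiv.apply_symm_apply, Fintype.mem_piFinset, Set.mem_toFinset]
    rw [← Finset.card_map E.toEmbedding, h1, Fintype.card_piFinset]
    push_cast
    refine Finset.prod_congr rfl fun i _ => ?_
    rw [Set.ncard_eq_toFinset_card']
  have hlim : Tendsto (fun l : ℝ => ∑ ρ ∈ GG, ((lat m (fun j => ((ρ j).val : ℤ)) l s).ncard : ℝ) / l ^ n)
      atTop (𝓝 (∑ ρ ∈ GG, (volume s).toReal / (m : ℝ) ^ n)) :=
    tendsto_finsetSum _ fun ρ _ => lattice_count hm _ hb hf
  have hval : ∑ ρ ∈ GG, (volume s).toReal / (m : ℝ) ^ n =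
      (volume s).toReal * ∏ i, ((G i).ncard : ℝ) / (q i : ℝ) ^ n := by
    rw [Finset.sum_const, nsmul_eq_mul, hGG, Finset.prod_div_distrib, Finset.prod_pow, hmdef]
    push_cast
    ring
  rw [hval] at hlim
  refine hlim.congr' ?_
  filter_upwards [eventually_gt_atTop 0] with l hl
  rw [← Finset.sum_div, ← Nat.cast_sum]
  congr 2
  have hfin : {x : Fin n → ℤ | (fun i => (x i : ℝ) / l) ∈ s ∧
        ∀ i, (fun j => (x j : ZMod (q i))) ∈ G i}.Finite :=
    (lat_finite hb hl).subset fun x hx => hx.1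
  rw [Set.ncard_eq_toFinset_card _ hfin]
  rw [Finset.card_eq_sum_card_fiberwise (f := fun x : Fin n → ℤ => fun j => (x j : ZMod m)) (t := GG)]
  · refine Finset.sum_congr rfl fun ρ hρ => ?_
    rw [← Set.ncard_coe_finset]
    have hinj : Function.Injective (fun (x : Fin n → ℤ) (j : Fin n) => (((ρ j).val : ℤ) + m * x j)) := by
      intro x y hxy
      funext j
      have := congrFun hxy j
      simp only [add_right_inj] at this
      exact mul_left_cancel₀ (by exact_mod_cast hm.ne') this
    rw [← Set.ncard_image_of_injective _ hinj]
    congr 1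
    ext x
    simp only [Set.mem_image, Finset.coe_filter, Set.Finite.mem_toFinset, Set.mem_setOf_eq, lat]
    constructor
    · rintro ⟨y, hy, rfl⟩
      have hx : (fun j => (((((ρ j).val : ℤ) + m * y j : ℤ)) : ZMod m)) = ρ := by
        funext j; simp
      refine ⟨⟨?_, ?_⟩, hx⟩
      · convert hy using 2
        push_cast; ring
      · intro i
        have h3 := (Finset.mem_filter.1 hρ).2 i
        rw [← hx] at h3
        convert h3 using 1
        funext j
        exact (he _ i).symm
    · rintro ⟨⟨h1, h2⟩, h3⟩
      have hd : ∀ j, ∃ y : ℤ, x j = ((ρ j).val : ℤ) + m * y := by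
        intro j
        have h4 : (((ρ j).val : ℤ) : ZMod m) = (x j : ZMod m) := by
          rw [← h3]; simp
        rw [ZMod.intCast_eq_intCast_iff_dvd_sub] at h4
        obtain ⟨y, hy⟩ := h4
        exact ⟨y, by linarith⟩
      choose y hy using hd
      refine ⟨y, ?_, funext fun j => (hy j).symm⟩
      convert h1 using 2 with j
      rw [hy j]; push_cast; ring
  · intro x hx
    have hx := (Set.Finite.mem_toFinset _).1 hx
    refine Finset.mem_coe.2 (Finset.mem_filter.2 ⟨Finset.mem_univ _, fun i => ?_⟩)
    convert hx.2 i using 1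
    funext j
    exact he _ i

end lattice
end DH

namespace DH
set_option linter.unusedSectionVars false

section odd
variable {p : ℕ} [hp : Fact p.Prime]

local notation "R" => ZMod (p ^ 2)

instance : NeZero (p ^ 2) := ⟨pow_ne_zero 2 hp.out.ne_zero⟩

lemma isUnit_iff_R (x : R) : IsUnit x ↔ ¬ p ∣ x.val := by
  conv_lhs => rw [← ZMod.natCast_zmod_val x]
  rw [ZMod.isUnit_iff_coprime, Nat.coprime_pow_right_iff (by norm_num), Nat.coprime_comm,
    hp.out.coprime_iff_not_dvd]

lemma nonunit_iff (x : R) : ¬ IsUnit x ↔ ∃ k : R, x = (p : R) * k := by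
  rw [isUnit_iff_R, not_not]
  constructor
  · rintro ⟨k, hk⟩
    refine ⟨k, ?_⟩
    rw [← ZMod.natCast_zmod_val x, hk]; push_cast; rfl
  · rintro ⟨k, rfl⟩
    have h : ((p * k.val : ℕ) : R) = (p : R) * k := by push_cast; rw [ZMod.natCast_zmod_val]
    rw [← h, ZMod.val_natCast]
    rw [Nat.dvd_mod_iff (dvd_pow_self p two_ne_zero)]
    exact dvd_mul_right _ _

lemma p_sq : (p : R) * p = 0 := by
  have : ((p ^ 2 : ℕ) : R) = 0 := ZMod.natCast_self _
  push_cast at this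
  rw [← sq]; exact this

lemma nn_mul {x y : R} (hx : ¬ IsUnit x) (hy : ¬ IsUnit y) : x * y = 0 := by
  obtain ⟨k, rfl⟩ := (nonunit_iff x).1 hx
  obtain ⟨l, rfl⟩ := (nonunit_iff y).1 hy
  linear_combination k * l * p_sq (p := p)

lemma nn_mul_left {x : R} (y : R) (hx : ¬ IsUnit x) : ¬ IsUnit (x * y) := by
  rw [IsUnit.mul_iff]; tauto

lemma nn_sub {x y : R} (hx : ¬ IsUnit x) (hy : ¬ IsUnit y) : ¬ IsUnit (x - y) := by
  obtain ⟨k, rfl⟩ := (nonunit_iff x).1 hx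
  obtain ⟨l, rfl⟩ := (nonunit_iff y).1 hy
  exact (nonunit_iff _).2 ⟨k - l, by ring⟩

lemma unit_of_sq {x : R} (h : x * x = 0) : ¬ IsUnit x := fun hu => by
  have h1 := hu.mul hu
  rw [h, isUnit_zero_iff] at h1
  have : Fact (1 < p ^ 2) := ⟨Nat.one_lt_pow two_ne_zero hp.out.one_lt⟩
  exact zero_ne_one h1

open scoped Classical in
lemma card_units : (Finset.univ.filter (fun x : R => IsUnit x)).card = p ^ 2 - p := by
  have h1 : Fintype.card (R)ˣ = p ^ 2 - p := by
    rw [ZMod.card_units_eq_totient, Nat.totient_prime_pow hp.out (by norm_num)]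
    rw [Nat.mul_sub]; simp [sq]
  rw [← h1, ← Fintype.card_coe]
  symm
  apply Fintype.card_congr
  refine Equiv.ofBijective (fun u => ⟨(u : R), by simp⟩) ⟨fun u v h => ?_, fun ⟨x, hx⟩ => ?_⟩
  · simpa [Units.ext_iff] using h
  · obtain ⟨u, hu⟩ := (Finset.mem_filter.1 hx).2
    exact ⟨u, by simp [hu]⟩

lemma p_le : p ≤ p ^ 2 := Nat.le_self_pow two_ne_zero p

open scoped Classical in
lemma card_nonunits : (Finset.univ.filter (fun x : R => ¬ IsUnit x)).card = p := by
  have h := Finset.card_filter_add_card_filter_not (s := Finset.univ) (fun x : R => IsUnit x)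
  rw [card_units, Finset.card_univ, ZMod.card] at h
  have := p_le (p := p)
  omega

variable (h2 : p ≠ 2)
include h2 in
lemma two_unit : IsUnit (2 : R) := by
  have : IsUnit ((2 : ℕ) : R) := by
    rw [ZMod.isUnit_iff_coprime]
    exact Nat.Coprime.pow_right 2 ((Nat.coprime_primes Nat.prime_two hp.out).2 h2.symm)
  exact_mod_cast this

/-- number of solutions of `y² = 4x³` -/
lemma cusp_count (h2 : p ≠ 2) : Nat.card {z : R × R // z.2 ^ 2 = 4 * z.1 ^ 3} = 2 * p ^ 2 - p := by
  classical
  have h4 := two_unit h2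
  rw [Nat.card_eq_fintype_card, Fintype.card_subtype]
  rw [← Finset.card_filter_add_card_filter_not (fun z : R × R => IsUnit z.1)]
  have e1 : ((Finset.univ.filter (fun z : R × R => z.2 ^ 2 = 4 * z.1 ^ 3)).filter
      (fun z => IsUnit z.1)).card = p ^ 2 - p := by
    rw [← card_units (p := p)]
    symm
    apply Finset.card_bij (fun t _ => ((t ^ 2, 2 * t ^ 3) : R × R))
    · intro t ht
      have ht := (Finset.mem_filter.1 ht).2
      simp only [Finset.mem_filter, Finset.mem_univ, true_and]
      exact ⟨by ring, ht.pow 2⟩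
    · intro t ht t' ht' h
      have ht := (Finset.mem_filter.1 ht).2
      rw [Prod.mk.injEq] at h
      have h3 := h4.mul_left_cancel h.2
      have : t ^ 2 * t = t ^ 2 * t' := by
        calc t ^ 2 * t = t ^ 3 := by ring
          _ = t' ^ 3 := h3
          _ = t' ^ 2 * t' := by ring
          _ = _ := by rw [h.1]
      exact (ht.pow 2).mul_left_cancel this
    · rintro ⟨x, y⟩ hz
      simp only [Finset.mem_filter, Finset.mem_univ, true_and] at hz
      obtain ⟨u, hu⟩ := (h4.mul hz.2)
      refine ⟨y * (↑u⁻¹ : R), ?_, ?_⟩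
      · have hy : IsUnit (y ^ 2) := by
          rw [hz.1, show (4 : R) = 2 ^ 2 by norm_num]; exact (h4.pow 2).mul (hz.2.pow 3)
        have hy : IsUnit y := (isUnit_pow_iff two_ne_zero).1 hy
        exact Finset.mem_filter.2 ⟨Finset.mem_univ _, hy.mul (Units.isUnit _)⟩
      · have hi : (2 * x) * (↑u⁻¹ : R) = 1 := by rw [← hu]; simp
        set i := (↑u⁻¹ : R)
        have hx : (y * i) ^ 2 = x := by
          linear_combination i ^ 2 * hz.1 + x * (2 * x * i + 1) * hi
        rw [Prod.mk.injEq]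
        refine ⟨hx, ?_⟩
        calc 2 * (y * i) ^ 3 = 2 * (y * i) ^ 2 * (y * i) := by ring
          _ = 2 * x * (y * i) := by rw [hx]
          _ = y := by linear_combination y * hi
  have e2 : ((Finset.univ.filter (fun z : R × R => z.2 ^ 2 = 4 * z.1 ^ 3)).filter
      (fun z => ¬ IsUnit z.1)).card = p * p := by
    have : ((Finset.univ.filter (fun z : R × R => z.2 ^ 2 = 4 * z.1 ^ 3)).filter
      (fun z => ¬ IsUnit z.1)) = (Finset.univ.filter (fun x : R => ¬ IsUnit x)) ×ˢ
        (Finset.univ.filter (fun x : R => ¬ IsUnit x)) := by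
      ext ⟨x, y⟩
      simp only [Finset.mem_filter, Finset.mem_univ, true_and, Finset.mem_product]
      constructor
      · rintro ⟨h, hx⟩
        refine ⟨hx, ?_⟩
        apply unit_of_sq
        rw [← sq, h]
        have := nn_mul hx hx
        linear_combination 4 * x * this
      · rintro ⟨hx, hy⟩
        refine ⟨?_, hx⟩
        linear_combination nn_mul hy hy - 4 * x * nn_mul hx hx
    rw [this, Finset.card_product, card_nonunits]
  rw [e1, e2]
  have := p_le (p := p)
  have h3 : p * p = p ^ 2 := (sq p).symm
  omega

/-- `Z(a,b)` -/
noncomputable def Zab (a b : R) : ℕ := Nat.card {z : R × R // fdisc ![a, b, z.1, z.2] = 0}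

lemma fdisc_vec {S : Type*} [CommRing S] (a b c d : S) : fdisc ![a, b, c, d] =
  a ^ 2 * d ^ 2 - 6 * a * b * c * d - 3 * b ^ 2 * c ^ 2 + 4 * a * c ^ 3 + 4 * b ^ 3 * d := rfl

lemma Z_unit (h2 : p ≠ 2) {a b : R} (ha : IsUnit a) : Zab a b = 2 * p ^ 2 - p := by
  rw [← cusp_count h2, Zab]
  obtain ⟨u, rfl⟩ := ha
  have hi : (u : R) * (↑u⁻¹ : R) = 1 := by simp
  set a := (u : R)
  set i := (↑u⁻¹ : R)
  refine Nat.card_congr (Equiv.subtypeEquiv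
    { toFun := fun z => (b ^ 2 - a * z.1, 2 * b ^ 3 - 3 * a * b * z.1 + a ^ 2 * z.2)
      invFun := fun w => (i * (b ^ 2 - w.1), i ^ 2 * (w.2 - 2 * b ^ 3 + 3 * b * (b ^ 2 - w.1)))
      left_inv := ?_
      right_inv := ?_ } ?_)
  · rintro ⟨c, d⟩
    simp only [Prod.mk.injEq]
    constructor
    · linear_combination c * hi
    · linear_combination d * (a * i + 1) * hi
  · rintro ⟨x, y⟩
    simp only [Prod.mk.injEq]
    constructor
    · linear_combination (x - b ^ 2) * hi
    · linear_combination (-3 * b * (b ^ 2 - x) + (a * i + 1) * (y - 2 * b ^ 3 + 3 * b * (b ^ 2 - x))) * hi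
  · rintro ⟨c, d⟩
    simp only [Equiv.coe_fn_mk, fdisc_vec]
    constructor
    · intro h
      linear_combination a ^ 2 * h
    · intro h
      linear_combination i ^ 2 * h - (a * i + 1) * (a ^ 2 * d ^ 2 - 6 * a * b * c * d - 3 * b ^ 2 * c ^ 2 + 4 * a * c ^ 3 + 4 * b ^ 3 * d) * hi

lemma Z_nn_unit (h2 : p ≠ 2) {a b : R} (ha : ¬ IsUnit a) (hb : IsUnit b) : Zab a b = p ^ 2 := by
  have ha2 := nn_mul ha ha
  have hu : ∀ c : R, IsUnit (4 * b ^ 3 - 6 * a * b * c) := by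
    intro c
    by_contra hcon
    have h3 : ¬ IsUnit (6 * a * b * c) := by
      rw [show 6 * a * b * c = a * (6 * b * c) by ring]; exact nn_mul_left _ ha
    have h4 : ¬ IsUnit (4 * b ^ 3) := by
      obtain ⟨k, hk⟩ := (nonunit_iff _).1 hcon
      obtain ⟨l, hl⟩ := (nonunit_iff _).1 h3
      exact (nonunit_iff _).2 ⟨k + l, by linear_combination hk + hl⟩
    apply h4
    rw [show (4 : R) = 2 ^ 2 by norm_num]
    exact ((two_unit h2).pow 2).mul (hb.pow 3)
  choose u hu using hu
  have e : {z : R × R // fdisc ![a, b, z.1, z.2] = 0} ≃ R :=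
    { toFun := fun z => z.1.1
      invFun := fun c => ⟨(c, (↑(u c)⁻¹ : R) * (3 * b ^ 2 * c ^ 2 - 4 * a * c ^ 3)), by
        have hi : (u c : R) * (↑(u c)⁻¹ : R) = 1 := by simp
        rw [hu c] at hi
        set i := (↑(u c)⁻¹ : R)
        simp only [fdisc_vec]
        linear_combination (i * (3 * b ^ 2 * c ^ 2 - 4 * a * c ^ 3)) ^ 2 * ha2 +
          (3 * b ^ 2 * c ^ 2 - 4 * a * c ^ 3) * hi⟩
      left_inv := by
        rintro ⟨⟨c, d⟩, h⟩
        have hi : (u c : R) * (↑(u c)⁻¹ : R) = 1 := by simp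
        rw [hu c] at hi
        simp only [fdisc_vec] at h
        apply Subtype.ext
        refine Prod.ext rfl ?_
        change (↑(u c)⁻¹ : R) * (3 * b ^ 2 * c ^ 2 - 4 * a * c ^ 3) = d
        set i := (↑(u c)⁻¹ : R)
        linear_combination d * hi - i * h + i * d ^ 2 * ha2
      right_inv := fun c => rfl }
  rw [Zab, Nat.card_congr e, Nat.card_zmod]

lemma Z_zero {b : R} (hb : ¬ IsUnit b) : Zab 0 b = p ^ 4 := by
  have e : {z : R × R // fdisc ![0, b, z.1, z.2] = 0} ≃ R × R :=
    Equiv.subtypeUnivEquiv (by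
      rintro ⟨c, d⟩
      simp only [fdisc_vec]
      linear_combination (-3 * c ^ 2 + 4 * b * d) * nn_mul hb hb)
  rw [Zab, Nat.card_congr e, Nat.card_prod, Nat.card_zmod]; ring

lemma Z_nn_nn (h2 : p ≠ 2) {a b : R} (ha : ¬ IsUnit a) (ha0 : a ≠ 0) (hb : ¬ IsUnit b) : Zab a b = p ^ 3 := by
  classical
  have e : {z : R × R // fdisc ![a, b, z.1, z.2] = 0} ≃ {c : R // ¬ IsUnit c} × R :=
    { toFun := fun z => (⟨z.1.1, by
        obtain ⟨⟨c, d⟩, h⟩ := z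
        simp only [fdisc_vec] at h
        intro hc
        have h5 : 4 * c ^ 3 * a = 0 := by
          linear_combination h - d ^ 2 * nn_mul ha ha + 6 * c * d * nn_mul ha hb -
            (-3 * c ^ 2 + 4 * b * d) * nn_mul hb hb
        have h6 : IsUnit (4 * c ^ 3) := by
          rw [show (4 : R) = 2 ^ 2 by norm_num]
          exact ((two_unit h2).pow 2).mul (hc.pow 3)
        exact ha0 (h6.mul_right_eq_zero.1 h5)⟩, z.1.2)
      invFun := fun w => ⟨(w.1.1, w.2), by
        obtain ⟨⟨c, hc⟩, d⟩ := w
        simp only [fdisc_vec]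
        linear_combination d ^ 2 * nn_mul ha ha - 6 * c * d * nn_mul ha hb +
            (-3 * c ^ 2 + 4 * b * d) * nn_mul hb hb + 4 * a * c * nn_mul hc hc⟩
      left_inv := fun z => rfl
      right_inv := fun w => rfl }
  rw [Zab, Nat.card_congr e, Nat.card_prod, Nat.card_zmod, Nat.card_eq_fintype_card,
    Fintype.card_subtype, card_nonunits]; ring

theorem count_zero (h2 : p ≠ 2) : {f : Fin 4 → R | fdisc f = 0}.ncard = p ^ 4 * (2 * p ^ 2 - 1) := by
  classical
  have e : {f : Fin 4 → R | fdisc f = 0} ≃ Σ ab : R × R, {z : R × R // fdisc ![ab.1, ab.2, z.1, z.2] = 0} :=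
    { toFun := fun f => ⟨(f.1 0, f.1 1), ⟨(f.1 2, f.1 3), f.2⟩⟩
      invFun := fun w => ⟨![w.1.1, w.1.2, w.2.1.1, w.2.1.2], w.2.2⟩
      left_inv := fun f => Subtype.ext (ext4 rfl rfl rfl rfl)
      right_inv := fun w => rfl }
  rw [← Nat.card_coe_set_eq, Nat.card_congr e, Nat.card_sigma]
  change ∑ ab : R × R, Zab ab.1 ab.2 = _
  rw [Fintype.sum_prod_type]
  simp only
  have hU : (∑ a ∈ Finset.univ.filter (fun a : R => IsUnit a), ∑ b : R, Zab a b) =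
      (p ^ 2 - p) * (p ^ 2 * (2 * p ^ 2 - p)) := by
    rw [Finset.sum_congr rfl (g := fun _ => p ^ 2 * (2 * p ^ 2 - p)), Finset.sum_const, card_units,
      smul_eq_mul]
    intro a ha
    rw [Finset.sum_congr rfl (g := fun _ => 2 * p ^ 2 - p) (fun b _ => Z_unit h2 (Finset.mem_filter.1 ha).2)]
    simp [ZMod.card]
  have hin : ∀ a : R, ¬ IsUnit a → ∑ b : R, Zab a b = (p ^ 2 - p) * p ^ 2 + p * (if a = 0 then p ^ 4 else p ^ 3) := by
    intro a ha
    rw [← Finset.sum_filter_add_sum_filter_not _ (fun b : R => IsUnit b)]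
    congr 1
    · rw [Finset.sum_congr rfl (g := fun _ => p ^ 2)
        (fun b hb => Z_nn_unit h2 ha (Finset.mem_filter.1 hb).2), Finset.sum_const, card_units, smul_eq_mul]
    · rw [Finset.sum_congr rfl (g := fun _ => (if a = 0 then p ^ 4 else p ^ 3)), Finset.sum_const,
        card_nonunits, smul_eq_mul]
      intro b hb
      have hb := (Finset.mem_filter.1 hb).2
      split_ifs with h0
      · rw [h0]; exact Z_zero hb
      · exact Z_nn_nn h2 ha h0 hb
  have h0 : ¬ IsUnit (0 : R) := unit_of_sq (by ring)
  have hN : (∑ a ∈ Finset.univ.filter (fun a : R => ¬ IsUnit a), ∑ b : R, Zab a b) =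
      p * ((p ^ 2 - p) * p ^ 2) + p * (p ^ 4 + (p - 1) * p ^ 3) := by
    rw [Finset.sum_congr rfl (fun a ha => hin a (Finset.mem_filter.1 ha).2), Finset.sum_add_distrib,
      Finset.sum_const, card_nonunits, smul_eq_mul, ← Finset.mul_sum]
    congr 2
    have hm0 : (0 : R) ∈ Finset.univ.filter (fun a : R => ¬ IsUnit a) := Finset.mem_filter.2 ⟨Finset.mem_univ _, h0⟩
    rw [← Finset.add_sum_erase _ _ hm0]
    congr 1
    · simp
    · rw [Finset.sum_congr rfl (g := fun _ => p ^ 3), Finset.sum_const, Finset.card_erase_of_mem hm0,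
        card_nonunits, smul_eq_mul]
      intro a ha
      rw [if_neg (Finset.ne_of_mem_erase ha)]
  rw [← Finset.sum_filter_add_sum_filter_not _ (fun a : R => IsUnit a), hU, hN]
  have hp1 := hp.out.one_lt
  have hle := p_le (p := p)
  zify [hle, show p ≤ 2 * p ^ 2 by omega, show 1 ≤ p by omega, show 1 ≤ 2 * p ^ 2 by omega]
  ring

theorem count_good (h2 : p ≠ 2) : {f : Fin 4 → R | fdisc f ≠ 0}.ncard = p ^ 4 * (p ^ 2 - 1) ^ 2 := by
  have h1 := Set.ncard_add_ncard_compl {f : Fin 4 → R | fdisc f = 0}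
  rw [count_zero h2] at h1
  have h3 : Nat.card (Fin 4 → R) = p ^ 8 := by
    rw [Nat.card_fun, Nat.card_zmod, Nat.card_fin]; ring
  rw [h3] at h1
  have h4 : {f : Fin 4 → R | fdisc f = 0}ᶜ = {f : Fin 4 → R | fdisc f ≠ 0} := rfl
  rw [h4] at h1
  have hp1 := hp.out.one_lt
  have hle := p_le (p := p)
  zify [show 1 ≤ p ^ 2 by omega, show 1 ≤ 2 * p ^ 2 by omega] at h1 ⊢
  linear_combination h1

lemma fundAt_iff (h2 : p ≠ 2) (f : Fin 4 → ℤ) :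
    FundAt p (fdisc f) ↔ (fun j => (f j : R)) ∈ {f : Fin 4 → R | fdisc f ≠ 0} := by
  have := fdisc_map f (Int.castRingHom R)
  simp only [eq_intCast] at this
  simp only [Set.mem_setOf_eq, this, FundAt, if_neg h2, ne_eq]
  rw [ZMod.intCast_zmod_eq_zero_iff_dvd]
  push_cast; rfl
end odd


section two

instance (D : ℤ) : Decidable (FundAt 2 D) :=
  inferInstanceAs (Decidable (if 2 = 2 then D % 4 = 1 ∨ D % 16 = 8 ∨ D % 16 = 12 else _))

def liftv (g : Fin 4 → ZMod 4) : Fin 4 → ℤ := fun i => ((g i).val : ℤ)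

lemma count_two : {g : Fin 4 → ZMod 4 | FundAt 2 (fdisc (liftv g))}.ncard = 144 := by
  rw [Set.ncard_eq_toFinset_card']
  decide +kernel

lemma fund2_iff (D : ℤ) : FundAt 2 D ↔ D % 4 = 1 ∨ D % 16 = 8 ∨ D % 16 = 12 := by
  simp [FundAt]

lemma fund2_add {f h : Fin 4 → ℤ} :
    FundAt 2 (fdisc (fun i => f i + 4 * h i)) ↔ FundAt 2 (fdisc f) := by
  have e : ∃ K L : ℤ, fdisc (fun i => f i + 4 * h i) = fdisc f + 8 * (hB f * K) + 16 * L := by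
    refine ⟨f 0 * h 3 + h 0 * f 3 - f 1 * h 2 - h 1 * f 2 + 4 * (h 0 * h 3 - h 1 * h 2),
      (f 0 * h 3 + h 0 * f 3 - f 1 * h 2 - h 1 * f 2 + 4 * (h 0 * h 3 - h 1 * h 2)) ^ 2
      - (hA f * (2 * f 2 * h 2 - f 1 * h 3 - h 1 * f 3 + 4 * (h 2 ^ 2 - h 1 * h 3))
        + hC f * (2 * f 1 * h 1 - f 0 * h 2 - h 0 * f 2 + 4 * (h 1 ^ 2 - h 0 * h 2)))
      - 4 * ((2 * f 2 * h 2 - f 1 * h 3 - h 1 * f 3 + 4 * (h 2 ^ 2 - h 1 * h 3)) *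
        (2 * f 1 * h 1 - f 0 * h 2 - h 0 * f 2 + 4 * (h 1 ^ 2 - h 0 * h 2))), ?_⟩
    simp only [fdisc, hA, hB, hC]; ring
  obtain ⟨K, L, e⟩ := e
  rw [fund2_iff, fund2_iff, e]
  have hD := fdisc_eq f
  rcases Int.even_or_odd (hB f) with ⟨b, hb⟩ | ⟨b, hb⟩
  · rw [hb, show 8 * ((b + b) * K) = 16 * (b * K) by ring]
    omega
  · have : fdisc f = 4 * (b ^ 2 + b - hA f * hC f) + 1 := by rw [hD, hb]; ring
    omega

lemma fundAt_two_iff (f : Fin 4 → ℤ) : FundAt 2 (fdisc f) ↔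
    (fun j => (f j : ZMod 4)) ∈ {g : Fin 4 → ZMod 4 | FundAt 2 (fdisc (liftv g))} := by
  change _ ↔ FundAt 2 (fdisc (liftv _))
  have : f = fun i => liftv (fun j => (f j : ZMod 4)) i + 4 * (f i / 4) := by
    funext i
    have : liftv (fun j => (f j : ZMod 4)) i = f i % 4 := by
      simp only [liftv]; rw [ZMod.val_intCast]; rfl
    rw [this]; omega
  conv_lhs => rw [this]
  exact fund2_add (h := fun i => f i / 4)

lemma count1_two : {g : Fin 1 → ZMod 16 | FundAt 2 ((g 0).val : ℤ)}.ncard = 6 := by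
  rw [Set.ncard_eq_toFinset_card']
  decide +kernel

lemma fundAt1_two_iff (f : Fin 1 → ℤ) : FundAt 2 (f 0) ↔
    (fun j => (f j : ZMod 16)) ∈ {g : Fin 1 → ZMod 16 | FundAt 2 ((g 0).val : ℤ)} := by
  change _ ↔ FundAt 2 (((f 0 : ZMod 16)).val : ℤ)
  rw [ZMod.val_intCast, fund2_iff, fund2_iff]
  push_cast
  omega

lemma count1_odd (p : ℕ) [hp : Fact p.Prime] :
    {g : Fin 1 → ZMod (p ^ 2) | g 0 ≠ 0}.ncard = p ^ 2 - 1 := by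
  have e : {g : Fin 1 → ZMod (p ^ 2) | g 0 ≠ 0} = {0}ᶜ := by
    ext g; simp [funext_iff]
  rw [e, Set.ncard_compl, Set.ncard_singleton, Nat.card_eq_fintype_card]
  simp [ZMod.card]

lemma fundAt1_odd_iff (p : ℕ) [hp : Fact p.Prime] (h2 : p ≠ 2) (f : Fin 1 → ℤ) : FundAt p (f 0) ↔
    (fun j => (f j : ZMod (p ^ 2))) ∈ {g : Fin 1 → ZMod (p ^ 2) | g 0 ≠ 0} := by
  change _ ↔ ((f 0 : ℤ) : ZMod (p ^ 2)) ≠ 0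
  rw [Ne, ZMod.intCast_zmod_eq_zero_iff_dvd, FundAt, if_neg h2]
  push_cast; rfl

end two

end DH

namespace DH
set_option linter.unusedSectionVars false
open Filter Topology MeasureTheory

/-- truncated Euler product -/
noncomputable def EP (M : ℕ) : ℝ := ∏ p ∈ Nat.primesBelow M, (1 - 1 / (p : ℝ) ^ 2)

lemma EP_tendsto : Tendsto EP atTop (𝓝 (6 / Real.pi ^ 2)) := by
  have h := riemannZeta_eulerProduct (s := 2) (by norm_num)
  rw [riemannZeta_two] at h
  have h2 : Tendsto (fun n : ℕ => ((EP n)⁻¹ : ℝ)) atTop (𝓝 (Real.pi ^ 2 / 6)) := by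
    have h3 := (Complex.continuous_re.tendsto _).comp h
    have e : ((Real.pi : ℂ) ^ 2 / 6).re = Real.pi ^ 2 / 6 := by
      rw [show ((Real.pi : ℂ) ^ 2 / 6) = ((Real.pi ^ 2 / 6 : ℝ) : ℂ) by push_cast; rfl, Complex.ofReal_re]
    rw [e] at h3
    refine h3.congr fun n => ?_
    have e2 : (∏ p ∈ Nat.primesBelow n, (1 - (p : ℂ) ^ (-2 : ℂ))⁻¹) = (((EP n)⁻¹ : ℝ) : ℂ) := by
      rw [EP, ← Finset.prod_inv_distrib]
      push_cast
      refine Finset.prod_congr rfl fun p _ => ?_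
      rw [Complex.cpow_neg, show ((p : ℂ) ^ (2 : ℂ)) = (p : ℂ) ^ 2 by exact_mod_cast Complex.cpow_natCast (p : ℂ) 2, one_div]
    simp only [Function.comp_apply, e2, Complex.ofReal_re]
  have h4 := h2.inv₀ (by positivity)
  simp only [inv_inv, inv_div] at h4
  exact h4

lemma EP_sq (M : ℕ) : EP M ^ 2 = ∏ p ∈ Nat.primesBelow M, (1 - 1 / (p : ℝ) ^ 2) ^ 2 := by
  rw [EP, Finset.prod_pow]

lemma local4 (p : ℕ) (hp : p.Prime) : ∃ G : Set (Fin 4 → ZMod (p ^ 2)),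
    (∀ f : Fin 4 → ℤ, FundAt p (fdisc f) ↔ (fun j => (f j : ZMod (p ^ 2))) ∈ G) ∧
    (G.ncard : ℝ) / ((p ^ 2 : ℕ) : ℝ) ^ 4 = (1 - 1 / (p : ℝ) ^ 2) ^ 2 := by
  by_cases h2 : p = 2
  · subst h2
    refine ⟨{g : Fin 4 → ZMod 4 | FundAt 2 (fdisc (liftv g))}, fundAt_two_iff, ?_⟩
    have := count_two
    rw [show (Set.ncard (α := Fin 4 → ZMod (2 ^ 2)) {g : Fin 4 → ZMod 4 | FundAt 2 (fdisc (liftv g))}) = 144 from count_two]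
    norm_num
  · have : Fact p.Prime := ⟨hp⟩
    refine ⟨_, fundAt_iff h2, ?_⟩
    rw [count_good h2]
    have h1 : 1 ≤ p ^ 2 := Nat.one_le_pow _ _ hp.pos
    have h0 : (p : ℝ) ≠ 0 := by exact_mod_cast hp.ne_zero
    push_cast [h1]
    field_simp

lemma local1 (p : ℕ) (hp : p.Prime) : ∃ G : Set (Fin 1 → ZMod (if p = 2 then 16 else p ^ 2)),
    (∀ f : Fin 1 → ℤ, FundAt p (f 0) ↔ (fun j => (f j : ZMod (if p = 2 then 16 else p ^ 2))) ∈ G) ∧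
    (G.ncard : ℝ) / ((if p = 2 then 16 else p ^ 2 : ℕ) : ℝ) ^ 1 =
      (1 - 1 / (p : ℝ) ^ 2) * (if p = 2 then 1 / 2 else 1) := by
  by_cases h2 : p = 2
  · subst h2
    refine ⟨{g : Fin 1 → ZMod 16 | FundAt 2 ((g 0).val : ℤ)}, fundAt1_two_iff, ?_⟩
    rw [show (Set.ncard (α := Fin 1 → ZMod (if 2 = 2 then 16 else 2 ^ 2))
      {g : Fin 1 → ZMod 16 | FundAt 2 ((g 0).val : ℤ)}) = 6 from count1_two]
    norm_num
  · have : Fact p.Prime := ⟨hp⟩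
    generalize hm : (if p = 2 then 16 else p ^ 2) = m
    rw [if_neg h2] at hm ⊢
    subst hm
    refine ⟨_, fundAt1_odd_iff p h2, ?_⟩
    rw [count1_odd]
    have h1 : 1 ≤ p ^ 2 := Nat.one_le_pow _ _ hp.pos
    have h0 : (p : ℝ) ≠ 0 := by exact_mod_cast hp.ne_zero
    push_cast [h1]
    field_simp

lemma coprime_of_primes {p q : ℕ} (hp : p.Prime) (hq : q.Prime) (h : p ≠ q) (a b : ℕ) :
    Nat.Coprime (p ^ a) (q ^ b) := Nat.Coprime.pow _ _ ((Nat.coprime_primes hp hq).2 h)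

theorem dens4 (M : ℕ) {s : Set (Fin 4 → ℝ)} (hb : Bornology.IsBounded s)
    (hf : volume (frontier s) = 0) :
    Tendsto (fun l : ℝ => (({f : Fin 4 → ℤ | (fun i => (f i : ℝ) / l) ∈ s ∧
        ∀ p ∈ Nat.primesBelow M, FundAt p (fdisc f)}.ncard : ℕ) : ℝ) / l ^ 4) atTop
      (𝓝 ((volume s).toReal * EP M ^ 2)) := by
  have hpr : ∀ i : Nat.primesBelow M, i.1.Prime := fun i => Nat.prime_of_mem_primesBelow i.2
  choose G hG hc using fun i : Nat.primesBelow M => local4 i.1 (hpr i)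
  have h := density (fun i : Nat.primesBelow M => i.1 ^ 2) (fun i => pow_pos (hpr i).pos 2)
    (fun i j hij => coprime_of_primes (hpr i) (hpr j) (fun h => hij (Subtype.ext h)) 2 2) G hb hf
  rw [EP_sq, ← Finset.prod_coe_sort]
  rw [Finset.prod_congr rfl fun i _ => hc i] at h
  refine h.congr fun l => ?_
  congr 3
  ext f
  refine and_congr Iff.rfl ⟨fun h p hp => (hG ⟨p, hp⟩ f).2 (h _), fun h i => (hG i f).1 (h i.1 i.2)⟩

theorem dens1 (M : ℕ) (hM : 3 ≤ M) {s : Set (Fin 1 → ℝ)} (hb : Bornology.IsBounded s)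
    (hf : volume (frontier s) = 0) :
    Tendsto (fun l : ℝ => (({f : Fin 1 → ℤ | (fun i => (f i : ℝ) / l) ∈ s ∧
        ∀ p ∈ Nat.primesBelow M, FundAt p (f 0)}.ncard : ℕ) : ℝ) / l ^ 1) atTop
      (𝓝 ((volume s).toReal * (EP M / 2))) := by
  have hpr : ∀ i : Nat.primesBelow M, i.1.Prime := fun i => Nat.prime_of_mem_primesBelow i.2
  choose G hG hc using fun i : Nat.primesBelow M => local1 i.1 (hpr i)
  have h := density (fun i : Nat.primesBelow M => if i.1 = 2 then 16 else i.1 ^ 2)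
    (fun i => by split_ifs; norm_num; exact pow_pos (hpr i).pos 2)
    (fun i j hij => by
      have hne : i.1 ≠ j.1 := fun h => hij (Subtype.ext h)
      have e : ∀ k : ℕ, ∃ a, (if k = 2 then 16 else k ^ 2) = k ^ a := fun k => by
        split_ifs with h
        · exact ⟨4, by rw [h]; norm_num⟩
        · exact ⟨2, rfl⟩
      obtain ⟨a, ha⟩ := e i.1
      obtain ⟨b, hb⟩ := e j.1
      simp only [Function.onFun, ha, hb]
      exact coprime_of_primes (hpr i) (hpr j) hne _ _) G hb hf
  have e2 : EP M / 2 = ∏ p ∈ Nat.primesBelow M, ((1 - 1 / (p : ℝ) ^ 2) * (if p = 2 then 1 / 2 else 1)) := by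
    rw [Finset.prod_mul_distrib, Finset.prod_ite_eq', if_pos (Nat.mem_primesBelow.2 ⟨by omega, Nat.prime_two⟩), EP]
    ring
  rw [e2, ← Finset.prod_coe_sort]
  rw [Finset.prod_congr rfl fun i _ => hc i] at h
  refine h.congr fun l => ?_
  congr 3
  ext f
  refine and_congr Iff.rfl ⟨fun h p hp => (hG ⟨p, hp⟩ f).2 (h _), fun h i => (hG i f).1 (h i.1 i.2)⟩

end DH

namespace DH
set_option linter.unusedSectionVars false
open Filter Topology

/-- the two sign cases -/
structure Sg (σ e : ℝ) : Prop where
  h : (σ = -1 ∧ e = -1) ∨ (σ = 1 ∧ e = 1 / 3)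

/-- parametrisation of real cubic forms by `z = u + iv`, `w = p + iq`. -/
noncomputable def Psi (σ e u v p q : ℝ) : Fin 4 → ℝ :=
  act 1 (-u) 0 1 ![p, σ * e * q * v, e * p * v ^ 2, σ * q * v ^ 3]

section
variable {σ e : ℝ} (hs : Sg σ e) (u v p q : ℝ)

@[simp] lemma Psi_0 : Psi σ e u v p q 0 = p := by simp [Psi]
@[simp] lemma Psi_1 : Psi σ e u v p q 1 = σ * e * q * v - u * p := by simp [Psi]; ring
@[simp] lemma Psi_2 : Psi σ e u v p q 2 = e * p * v ^ 2 - 2 * u * (σ * e * q * v) + u ^ 2 * p := by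
  simp [Psi]; ring
@[simp] lemma Psi_3 : Psi σ e u v p q 3 = σ * q * v ^ 3 - 3 * u * (e * p * v ^ 2)
    + 3 * u ^ 2 * (σ * e * q * v) - u ^ 3 * p := by
  simp [Psi]; ring

lemma Psi_smul (l : ℝ) : Psi σ e u v (l * p) (l * q) = fun i => l * Psi σ e u v p q i := by
  apply ext4 <;> simp only [Psi_0, Psi_1, Psi_2, Psi_3] <;> ring

include hs

lemma fdisc_Psi : fdisc (Psi σ e u v p q) = 4 * e ^ 3 * (v ^ 3 * (p ^ 2 + q ^ 2)) ^ 2 := by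
  rw [Psi, fdisc_act]
  rcases hs.h with ⟨rfl, rfl⟩ | ⟨rfl, rfl⟩ <;> simp [fdisc] <;> ring

lemma e_ne : e ≠ 0 := by rcases hs.h with ⟨rfl, rfl⟩ | ⟨rfl, rfl⟩ <;> norm_num
lemma s_ne : σ ≠ 0 := by rcases hs.h with ⟨rfl, rfl⟩ | ⟨rfl, rfl⟩ <;> norm_num

lemma Psi_inj_w {u v p q p' q' : ℝ} (hv : 0 < v) (h : Psi σ e u v p q = Psi σ e u v p' q') :
    p = p' ∧ q = q' := by
  have h0 := congrFun h 0
  have h1 := congrFun h 1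
  simp only [Psi_0, Psi_1] at h0 h1
  subst h0
  refine ⟨rfl, ?_⟩
  have h2 : σ * e * v * (q - q') = 0 := by linear_combination h1
  have h3 : σ * e * v ≠ 0 := mul_ne_zero (mul_ne_zero (s_ne hs) (e_ne hs)) hv.ne'
  have := (mul_eq_zero.1 h2).resolve_left h3
  linarith

lemma Psi_inj {u v p q u' v' p' q' : ℝ} (hv : 0 < v) (hv' : 0 < v') (hw : 0 < p ^ 2 + q ^ 2)
    (h : Psi σ e u v p q = Psi σ e u' v' p' q') : u = u' ∧ v = v' ∧ p = p' ∧ q = q' := by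
  have key : u = u' ∧ v = v' := by
    rcases hs.h with ⟨rfl, rfl⟩ | ⟨rfl, rfl⟩
    · have hhA : ∀ u v p q, hA (Psi (-1) (-1) u v p q) = v ^ 2 * (p ^ 2 + q ^ 2) := by
        intros; simp only [hA, Psi_0, Psi_1, Psi_2]; ring
      have hhB : ∀ u v p q, hB (Psi (-1) (-1) u v p q) = 2 * u * (v ^ 2 * (p ^ 2 + q ^ 2)) := by
        intros; simp only [hB, Psi_0, Psi_1, Psi_2, Psi_3]; ring
      have hhC : ∀ u v p q, hC (Psi (-1) (-1) u v p q) = (u ^ 2 + v ^ 2) * (v ^ 2 * (p ^ 2 + q ^ 2)) := by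
        intros; simp only [hC, Psi_1, Psi_2, Psi_3]; ring
      have eA : hA (Psi (-1) (-1) u v p q) = hA (Psi (-1) (-1) u' v' p' q') := by rw [h]
      have eB : hB (Psi (-1) (-1) u v p q) = hB (Psi (-1) (-1) u' v' p' q') := by rw [h]
      have eC : hC (Psi (-1) (-1) u v p q) = hC (Psi (-1) (-1) u' v' p' q') := by rw [h]
      rw [hhA, hhA] at eA
      rw [hhB, hhB, ← eA] at eB
      rw [hhC, hhC, ← eA] at eC
      have hpos : 0 < v ^ 2 * (p ^ 2 + q ^ 2) := by positivity
      have h1 := mul_right_cancel₀ hpos.ne' eB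
      have h2 := mul_right_cancel₀ hpos.ne' eC
      have hu : u = u' := by linarith
      subst hu
      refine ⟨rfl, ?_⟩
      have : v ^ 2 = v' ^ 2 := by linarith
      exact (pow_left_inj₀ hv.le hv'.le two_ne_zero).1 this
    · -- evaluate at z' = u' + i v'
      have hE : ∀ (u v p q s t : ℝ), feval (fun i => ((Psi 1 (1 / 3) u v p q i : ℝ) : ℂ)) (s + t * Complex.I) 1 =
          ((p * (s - u) + q * v : ℝ) + (p * t : ℝ) * Complex.I) *
          (((s - u) ^ 2 - t ^ 2 + v ^ 2 : ℝ) + (2 * (s - u) * t : ℝ) * Complex.I) := by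
        intro u v p q s t
        simp only [feval, Psi_0, Psi_1, Psi_2, Psi_3]
        push_cast
        have hI : Complex.I ^ 2 = -1 := Complex.I_sq
        have hI3 : Complex.I ^ 3 = -Complex.I := by rw [pow_succ, hI]; ring
        ring_nf
        rw [hI3, hI]; ring
      have h1 := hE u' v' p' q' u' v'
      rw [← h, hE] at h1
      have h2 : ((p * (u' - u) + q * v : ℝ) + (p * v' : ℝ) * Complex.I) *
          (((u' - u) ^ 2 - v' ^ 2 + v ^ 2 : ℝ) + (2 * (u' - u) * v' : ℝ) * Complex.I) = 0 := by
        rw [h1]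
        rw [show ((u' - u') ^ 2 - v' ^ 2 + v' ^ 2 : ℝ) = 0 by ring, show (2 * (u' - u') * v' : ℝ) = 0 by ring]
        simp
      rcases mul_eq_zero.1 h2 with h3 | h3
      · exfalso
        have him := congrArg Complex.im h3
        have hre := congrArg Complex.re h3
        simp at him hre
        rcases him with hp | hp
        · subst hp
          simp at hre
          rcases hre with hq | hq
          · subst hq; simp at hw
          · exact hv.ne' hq
        · exact hv'.ne' hp
      · have him := congrArg Complex.im h3
        have hre := congrArg Complex.re h3
        rw [Complex.add_im, Complex.ofReal_im, Complex.im_ofReal_mul, Complex.I_im, Complex.zero_im] at him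
        rw [Complex.add_re, Complex.ofReal_re, Complex.re_ofReal_mul, Complex.I_re, Complex.zero_re] at hre
        have hu : u' - u = 0 := by
          have : (u' - u) * v' = 0 := by linarith
          exact (mul_eq_zero.1 this).resolve_right hv'.ne'
        rw [hu] at hre
        refine ⟨by linarith, ?_⟩
        have : v ^ 2 = v' ^ 2 := by linear_combination hre
        exact (pow_left_inj₀ hv.le hv'.le two_ne_zero).1 this
  obtain ⟨rfl, rfl⟩ := key
  obtain ⟨h3, h4⟩ := Psi_inj_w hs hv h
  exact ⟨rfl, rfl, h3, h4⟩

lemma Psi_neg_one_surj (f : Fin 4 → ℝ) (hD : fdisc f < 0) :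
    ∃ u v p q, 0 < v ∧ f = Psi (-1) (-1) u v p q := by
  have hA0 : 0 < hA f := by
    have h1 := syzygy f
    have h2 : 0 ≤ hA f ^ 3 := by nlinarith [sq_nonneg (cG0 f), sq_nonneg (f 0)]
    have h3 : 0 ≤ hA f := by
      by_contra hneg
      push Not at hneg
      have : hA f ^ 3 < 0 := by
        have : Odd 3 := by decide
        exact this.pow_neg hneg
      linarith
    rcases h3.eq_or_lt with h4 | h4
    · exfalso
      have := fdisc_eq f
      rw [← h4] at this
      nlinarith [sq_nonneg (hB f)]
    · exact h4
  set A := hA f with hAdef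
  set B := hB f with hBdef
  set C := hC f with hCdef
  have hDe : fdisc f = B ^ 2 - 4 * A * C := fdisc_eq f
  set v := Real.sqrt (-fdisc f) / (2 * A) with hv
  have hsq : Real.sqrt (-fdisc f) ^ 2 = -fdisc f := Real.sq_sqrt (by linarith)
  have hspos : 0 < Real.sqrt (-fdisc f) := Real.sqrt_pos.2 (by linarith)
  have hvpos : 0 < v := by positivity
  have hv2 : 4 * A ^ 2 * v ^ 2 = 4 * A * C - B ^ 2 := by
    rw [hv]; field_simp; rw [hsq]; linarith
  set u := B / (2 * A) with hu
  have hu2 : 2 * A * u = B := by rw [hu]; field_simp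
  have hC2 : C = A * (u ^ 2 + v ^ 2) := by
    have : 4 * A * (C - A * (u ^ 2 + v ^ 2)) = 0 := by
      linear_combination -hv2 - (2 * A * u + B) * hu2
    have := (mul_eq_zero.1 this).resolve_left (by positivity)
    linarith
  refine ⟨u, v, f 0, (f 1 + u * f 0) / v, hvpos, ?_⟩
  have hBB : B = 2 * A * u := by linarith
  have i1 : f 0 * C + f 1 * B + f 2 * A = 0 := by rw [hAdef, hBdef, hCdef]; simp only [hA, hB, hC]; ring
  have i2 : f 1 * C + f 2 * B + f 3 * A = 0 := by rw [hAdef, hBdef, hCdef]; simp only [hA, hB, hC]; ring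
  have j1 : f 0 * (u ^ 2 + v ^ 2) + 2 * u * f 1 + f 2 = 0 := by
    have : A * (f 0 * (u ^ 2 + v ^ 2) + 2 * u * f 1 + f 2) = 0 := by
      rw [hC2, hBB] at i1; linear_combination i1
    exact (mul_eq_zero.1 this).resolve_left hA0.ne'
  have j2 : f 1 * (u ^ 2 + v ^ 2) + 2 * u * f 2 + f 3 = 0 := by
    have : A * (f 1 * (u ^ 2 + v ^ 2) + 2 * u * f 2 + f 3) = 0 := by
      rw [hC2, hBB] at i2; linear_combination i2
    exact (mul_eq_zero.1 this).resolve_left hA0.ne'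
  apply ext4 <;> simp only [Psi_0, Psi_1, Psi_2, Psi_3]
  · field_simp; ring
  · field_simp; linear_combination j1
  · field_simp; linear_combination j2 - 2 * u * j1

omit hs in
lemma exists_root (f : Fin 4 → ℝ) (h0 : f 0 ≠ 0) : ∃ t : ℝ, feval f t 1 = 0 := by
  set β := 3 * f 1 / f 0
  set γ := 3 * f 2 / f 0
  set δ := f 3 / f 0
  have e : ∀ t, feval f t 1 = f 0 * (t ^ 3 + β * t ^ 2 + γ * t + δ) := by
    intro t; simp only [feval, β, γ, δ]; field_simp
  set N := 1 + |β| + |γ| + |δ| with hN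
  have hN1 : 1 ≤ N := by rw [hN]; linarith [abs_nonneg β, abs_nonneg γ, abs_nonneg δ]
  have hNN : N ≤ N ^ 2 := by nlinarith
  have k1 : |γ| * N ≤ |γ| * N ^ 2 := mul_le_mul_of_nonneg_left hNN (abs_nonneg _)
  have k2 : |δ| ≤ |δ| * N ^ 2 := le_mul_of_one_le_right (abs_nonneg _) (by nlinarith)
  have k3 : N ^ 3 = N ^ 2 + |β| * N ^ 2 + |γ| * N ^ 2 + |δ| * N ^ 2 := by
    rw [pow_succ]; nth_rw 2 [hN]; ring
  have k4 : 0 < N ^ 2 := by positivity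
  have k5 : -(|β| * N ^ 2) ≤ β * N ^ 2 ∧ β * N ^ 2 ≤ |β| * N ^ 2 :=
    ⟨by nlinarith [neg_abs_le β], by nlinarith [le_abs_self β]⟩
  have k6 : -(|γ| * N) ≤ γ * N ∧ γ * N ≤ |γ| * N :=
    ⟨by nlinarith [neg_abs_le γ], by nlinarith [le_abs_self γ]⟩
  have k7 := neg_abs_le δ
  have k8 := le_abs_self δ
  have hc : Continuous fun t : ℝ => t ^ 3 + β * t ^ 2 + γ * t + δ := by fun_prop
  obtain ⟨t, -, ht⟩ := intermediate_value_Icc (show -N ≤ N by linarith) hc.continuousOn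
    (show (0 : ℝ) ∈ Set.Icc _ _ from ⟨by nlinarith [k5.1, k5.2, k6.1, k6.2], by nlinarith [k5.1, k5.2, k6.1, k6.2]⟩)
  exact ⟨t, by rw [e]; simp only at ht; rw [ht, mul_zero]⟩

omit hs in
lemma Psi_one_surj (f : Fin 4 → ℝ) (hD : 0 < fdisc f) :
    ∃ u v p q, 0 < v ∧ f = Psi 1 (1 / 3) u v p q := by
  by_cases h0 : f 0 = 0
  · have hD' : 0 < f 1 ^ 2 * (4 * f 1 * f 3 - 3 * f 2 ^ 2) := by
      simp only [fdisc, h0] at hD; nlinarith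
    have hb : f 1 ≠ 0 := by intro h; rw [h] at hD'; simp at hD'
    have hb2 : 0 < f 1 ^ 2 := by positivity
    have h4 : 0 < 4 * f 1 * f 3 - 3 * f 2 ^ 2 := by
      by_contra hh; push Not at hh; nlinarith
    set v := Real.sqrt (3 * (4 * f 1 * f 3 - 3 * f 2 ^ 2) / (36 * f 1 ^ 2)) with hv
    have hvpos : 0 < v := Real.sqrt_pos.2 (by positivity)
    have hv2 : v ^ 2 = 3 * (4 * f 1 * f 3 - 3 * f 2 ^ 2) / (36 * f 1 ^ 2) := Real.sq_sqrt (by positivity)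
    refine ⟨-f 2 / (2 * f 1), v, 0, 3 * f 1 / v, hvpos, ?_⟩
    apply ext4 <;> simp only [Psi_0, Psi_1, Psi_2, Psi_3, h0]
    · field_simp; ring
    · field_simp; ring
    · have : 1 * (3 * f 1 / v) * v ^ 3 = 3 * f 1 * v ^ 2 := by field_simp
      rw [this, hv2]; field_simp; ring
  · obtain ⟨t, ht⟩ := exists_root f h0
    simp only [feval] at ht
    -- f = (x - t y)(a x² + b' x y + c' y²)
    set a := f 0 with ha
    set b' := 3 * f 1 + a * t with hb'
    set c' := 3 * f 2 + b' * t with hc'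
    have hd : f 3 = -t * c' := by rw [hc', hb']; linear_combination ht
    have hb1 : f 1 = (b' - a * t) / 3 := by rw [hb']; ring
    have hc1 : f 2 = (c' - b' * t) / 3 := by rw [hc']; ring
    have hDD : 27 * fdisc f = (4 * a * c' - b' ^ 2) * (a * t ^ 2 + b' * t + c') ^ 2 := by
      simp only [fdisc, hd, hb1, hc1, ← ha]; ring
    have h4 : 0 < 4 * a * c' - b' ^ 2 := by
      by_contra hh; push Not at hh
      nlinarith [sq_nonneg (a * t ^ 2 + b' * t + c')]
    set v := Real.sqrt ((4 * a * c' - b' ^ 2) / (4 * a ^ 2)) with hv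
    have hvpos : 0 < v := Real.sqrt_pos.2 (by positivity)
    have hv2 : v ^ 2 = (4 * a * c' - b' ^ 2) / (4 * a ^ 2) := Real.sq_sqrt (by positivity)
    refine ⟨-b' / (2 * a), v, a, (-b' / (2 * a) - t) * a / v, hvpos, ?_⟩
    apply ext4 <;> simp only [Psi_0, Psi_1, Psi_2, Psi_3, hd, hb1, hc1]
    · exact ha.symm
    · field_simp; ring
    · rw [hv2]; field_simp; ring
    · have : 1 * ((-b' / (2 * a) - t) * a / v) * v ^ 3 = (-b' / (2 * a) - t) * a * v ^ 2 := by field_simp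
      rw [this, hv2]; field_simp; ring

lemma Psi_surj (f : Fin 4 → ℝ) (hD : 0 < e * fdisc f) : ∃ u v p q, 0 < v ∧ f = Psi σ e u v p q := by
  rcases hs.h with ⟨rfl, rfl⟩ | ⟨rfl, rfl⟩
  · exact Psi_neg_one_surj hs f (by linarith)
  · exact Psi_one_surj f (by linarith)

end

/-- complex cubic `w ∏ (x - z_i y)` -/
noncomputable def cubF (w z1 z2 z3 : ℂ) : Fin 4 → ℂ :=
  ![w, -w * (z1 + z2 + z3) / 3, w * (z1 * z2 + z1 * z3 + z2 * z3) / 3, -w * (z1 * z2 * z3)]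

lemma act_cubF (p q r s w z1 z2 z3 y1 y2 y3 : ℂ) (h1 : (p - r * z1) * y1 = s * z1 - q)
    (h2 : (p - r * z2) * y2 = s * z2 - q) (h3 : (p - r * z3) * y3 = s * z3 - q) :
    act p q r s (cubF w z1 z2 z3) =
      cubF (w * ((p - r * z1) * (p - r * z2) * (p - r * z3))) y1 y2 y3 := by
  have key : ∀ n1 n2 n3 m1 m2 m3 : ℂ, n1 * y1 = m1 → n2 * y2 = m2 → n3 * y3 = m3 →
      cubF (w * (n1 * n2 * n3)) y1 y2 y3 = ![w * (n1 * n2 * n3),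
        -w * (m1 * n2 * n3 + n1 * m2 * n3 + n1 * n2 * m3) / 3,
        w * (m1 * m2 * n3 + m1 * n2 * m3 + n1 * m2 * m3) / 3, -w * (m1 * m2 * m3)] := by
    rintro n1 n2 n3 _ _ _ rfl rfl rfl
    apply ext4 <;> simp [cubF] <;> ring
  rw [key _ _ _ _ _ _ h1 h2 h3]
  apply ext4 <;> simp [cubF] <;> ring

lemma re_act (p q r s : ℝ) (F : Fin 4 → ℂ) :
    (fun i => (act (p : ℂ) q r s F i).re) = act p q r s (fun i => (F i).re) := by
  apply ext4 <;> simp [pow_succ]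

/-- third root: `z` or its conjugate. -/
noncomputable def thd (σ : ℝ) (z : ℂ) : ℂ := if σ = 1 then (starRingEnd ℂ) z else z

lemma Psi_eq_re {σ e : ℝ} (hs : Sg σ e) (z w : ℂ) :
    Psi σ e z.re z.im w.re w.im = fun i => (cubF w z z (thd σ z) i).re := by
  rcases hs.h with ⟨rfl, rfl⟩ | ⟨rfl, rfl⟩
  · rw [thd, if_neg (by norm_num)]
    apply ext4 <;> simp [cubF] <;> ring
  · rw [thd, if_pos rfl]
    apply ext4 <;> simp [cubF] <;> ring


open UpperHalfPlane Matrix MatrixGroups in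
lemma mob (g : SL(2, ℤ)) (z : ℍ) :
    (((g 0 0 : ℝ) : ℂ) - ((g 1 0 : ℝ) : ℂ) * z) * ((g⁻¹ • z : ℍ) : ℂ) =
      ((g 1 1 : ℝ) : ℂ) * z - ((g 0 1 : ℝ) : ℂ) := by
  have hinv : g⁻¹ 0 0 = g 1 1 ∧ g⁻¹ 0 1 = - g 0 1 ∧ g⁻¹ 1 0 = -g 1 0 ∧ g⁻¹ 1 1 = g 0 0 := by
    rw [Matrix.SpecialLinearGroup.SL2_inv_expl]
    exact ⟨rfl, rfl, rfl, rfl⟩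
  rw [UpperHalfPlane.coe_specialLinearGroup_apply, hinv.1, hinv.2.1, hinv.2.2.1, hinv.2.2.2]
  have hne : ((g 0 0 : ℝ) : ℂ) - ((g 1 0 : ℝ) : ℂ) * z ≠ 0 := by
    intro h
    have him := congrArg Complex.im h
    have hre := congrArg Complex.re h
    simp at him hre
    have hd := sl_det g
    rcases him with h0 | h0
    · rw [h0] at hre hd
      simp at hre
      rw [hre] at hd; simp at hd
    · exact z.im_pos.ne' h0
  have e : ((algebraMap ℤ ℝ (-g 1 0) : ℝ) : ℂ) * z + ((algebraMap ℤ ℝ (g 0 0) : ℝ) : ℂ) =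
      ((g 0 0 : ℝ) : ℂ) - ((g 1 0 : ℝ) : ℂ) * z := by
    simp; ring
  rw [e, mul_div_cancel₀ _ hne]
  simp; ring

/-- the form attached to `z, w` -/
noncomputable def Ps (σ e : ℝ) (z : UpperHalfPlane) (w : ℂ) : Fin 4 → ℝ :=
  Psi σ e z.re z.im w.re w.im

def toR (f : Fin 4 → ℤ) : Fin 4 → ℝ := fun i => (f i : ℝ)

lemma fdisc_toR (f : Fin 4 → ℤ) : fdisc (toR f) = ((fdisc f : ℤ) : ℝ) := fdisc_map f (Int.castRingHom ℝ)

lemma toR_inj : Function.Injective toR := fun f f' h => by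
  funext i; have := congrFun h i; simp only [toR] at this; exact_mod_cast this

lemma toR_gact (g) (f : Fin 4 → ℤ) :
    toR (gact g f) = act (g 0 0 : ℝ) (g 0 1) (g 1 0) (g 1 1) (toR f) :=
  act_map f _ _ _ _ (Int.castRingHom ℝ)

open UpperHalfPlane Matrix MatrixGroups in
theorem Ps_gact {σ e : ℝ} (hs : Sg σ e) (g : SL(2, ℤ)) (z : ℍ) (w : ℂ) {f : Fin 4 → ℤ}
    (h : toR f = Ps σ e z w) : ∃ w', toR (gact g f) = Ps σ e (g⁻¹ • z) w' := by
  have h1 := mob g z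
  have h3 : (((g 0 0 : ℝ) : ℂ) - ((g 1 0 : ℝ) : ℂ) * thd σ z) * thd σ ((g⁻¹ • z : ℍ) : ℂ) =
      ((g 1 1 : ℝ) : ℂ) * thd σ z - ((g 0 1 : ℝ) : ℂ) := by
    rw [thd, thd]
    split_ifs
    · have := congrArg (starRingEnd ℂ) h1
      simpa using this
    · exact h1
  rw [toR_gact, h, Ps]
  rw [show Psi σ e z.re z.im w.re w.im = _ from Psi_eq_re hs (z : ℂ) w, ← re_act,
    act_cubF _ _ _ _ _ _ _ _ _ _ _ h1 h1 h3]
  exact ⟨_, (Psi_eq_re hs _ _).symm⟩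

lemma Ps_surj {σ e : ℝ} (hs : Sg σ e) (f : Fin 4 → ℤ) (hD : 0 < e * ((fdisc f : ℤ) : ℝ)) :
    ∃ z w, toR f = Ps σ e z w := by
  rw [← fdisc_toR] at hD
  obtain ⟨u, v, p, q, hv, h⟩ := Psi_surj hs (toR f) hD
  exact ⟨⟨⟨u, v⟩, hv⟩, ⟨p, q⟩, h⟩

lemma fdisc_Ps {σ e : ℝ} (hs : Sg σ e) (z : UpperHalfPlane) (w : ℂ) :
    fdisc (Ps σ e z w) = 4 * e ^ 3 * (z.im ^ 3 * (w.re ^ 2 + w.im ^ 2)) ^ 2 := fdisc_Psi hs _ _ _ _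

lemma Ps_inj {σ e : ℝ} (hs : Sg σ e) {z z' : UpperHalfPlane} {w w' : ℂ} (hw : w ≠ 0)
    (h : Ps σ e z w = Ps σ e z' w') : z = z' ∧ w = w' := by
  have hw' : 0 < w.re ^ 2 + w.im ^ 2 := by
    have := Complex.normSq_pos.2 hw
    rw [Complex.normSq_apply] at this
    nlinarith
  obtain ⟨h1, h2, h3, h4⟩ := Psi_inj hs z.im_pos z'.im_pos hw' h
  exact ⟨UpperHalfPlane.ext (Complex.ext h1 h2), Complex.ext h3 h4⟩

end DH

namespace DH
set_option linter.unusedSectionVars false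
open Filter Topology MeasureTheory ENNReal

noncomputable def Phi (σ e : ℝ) (x : Fin 4 → ℝ) : Fin 4 → ℝ := Psi σ e (x 0) (x 1) (x 2) (x 3)

noncomputable def Jac (σ e : ℝ) (x : Fin 4 → ℝ) : Matrix (Fin 4) (Fin 4) ℝ :=
  !![0, 0, 1, 0;
    -x 2, σ * e * x 3, -x 0, σ * e * x 1;
    -2 * σ * e * x 3 * x 1 + 2 * x 0 * x 2, 2 * e * x 2 * x 1 - 2 * x 0 * σ * e * x 3,
      e * x 1 ^ 2 + x 0 ^ 2, -2 * x 0 * σ * e * x 1;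
    -3 * e * x 2 * x 1 ^ 2 + 6 * x 0 * σ * e * x 3 * x 1 - 3 * x 0 ^ 2 * x 2,
      3 * σ * x 3 * x 1 ^ 2 - 6 * x 0 * e * x 2 * x 1 + 3 * x 0 ^ 2 * σ * e * x 3,
      -3 * x 0 * e * x 1 ^ 2 - x 0 ^ 3, σ * x 1 ^ 3 + 3 * x 0 ^ 2 * σ * e * x 1]

lemma det_Jac {σ e : ℝ} (hs : Sg σ e) (x : Fin 4 → ℝ) :
    (Jac σ e x).det = -4 * σ * e ^ 2 * (x 1 ^ 4 * (x 2 ^ 2 + x 3 ^ 2)) := by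
  rcases hs.h with ⟨rfl, rfl⟩ | ⟨rfl, rfl⟩ <;>
  · simp only [Jac, Matrix.det_succ_row_zero, Fin.sum_univ_succ]
    simp [Fin.succAbove]
    ring

lemma hasDeriv_Phi {σ e : ℝ} (x : Fin 4 → ℝ) :
    HasStrictFDerivAt (Phi σ e) (LinearMap.toContinuousLinearMap (Matrix.toLin' (Jac σ e x))) x := by
  have h0 : ∀ j : Fin 4, HasStrictFDerivAt (fun x : Fin 4 → ℝ => x j)
      (ContinuousLinearMap.proj (R := ℝ) (φ := fun _ : Fin 4 => ℝ) j) x := fun j =>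
    (ContinuousLinearMap.proj (R := ℝ) (φ := fun _ : Fin 4 => ℝ) j).hasStrictFDerivAt
  rw [hasStrictFDerivAt_pi']
  intro i
  fin_cases i
  · refine ((h0 2).congr_fderiv ?_).congr_of_eventuallyEq (Eventually.of_forall fun y => ?_)
    · ext v; simp [Jac, dotProduct, Fin.sum_univ_four]
    · simp [Phi]
  · refine (((((h0 3).mul (h0 1)).const_mul (σ * e)).sub ((h0 0).mul (h0 2))).congr_fderiv ?_).congr_of_eventuallyEq (Eventually.of_forall fun y => ?_)
    · ext v; simp [Jac, dotProduct, Fin.sum_univ_four]; ring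
    · simp [Phi]; ring
  · refine ((((((h0 2).mul ((h0 1).pow 2)).const_mul e).sub ((((h0 0).mul (h0 3)).mul (h0 1)).const_mul (2 * σ * e))).add
      (((h0 0).pow 2).mul (h0 2))).congr_fderiv ?_).congr_of_eventuallyEq (Eventually.of_forall fun y => ?_)
    · ext v; simp [Jac, dotProduct, Fin.sum_univ_four]; ring
    · simp [Phi]; ring
  · refine (((((((h0 3).mul ((h0 1).pow 3)).const_mul σ).sub ((((h0 0).mul (h0 2)).mul ((h0 1).pow 2)).const_mul (3 * e))).add
      (((((h0 0).pow 2).mul (h0 3)).mul (h0 1)).const_mul (3 * σ * e))).sub (((h0 0).pow 3).mul (h0 2))).congr_fderiv ?_).congr_of_eventuallyEq (Eventually.of_forall fun y => ?_)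
    · ext v; simp [Jac, dotProduct, Fin.sum_univ_four]; ring
    · simp [Phi]; ring

lemma absdet {σ e : ℝ} (hs : Sg σ e) (x : Fin 4 → ℝ) :
    |(LinearMap.toContinuousLinearMap (Matrix.toLin' (Jac σ e x))).det| =
      4 * e ^ 2 * (x 1 ^ 4 * (x 2 ^ 2 + x 3 ^ 2)) := by
  have : (LinearMap.toContinuousLinearMap (Matrix.toLin' (Jac σ e x))).det = (Jac σ e x).det := by
    rw [ContinuousLinearMap.det, LinearMap.coe_toContinuousLinearMap, LinearMap.det_toLin']
  rw [this, det_Jac hs]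
  have h1 : 0 ≤ x 1 ^ 4 * (x 2 ^ 2 + x 3 ^ 2) := by positivity
  rw [abs_mul, abs_of_nonneg h1]
  congr 1
  rcases hs.h with ⟨rfl, rfl⟩ | ⟨rfl, rfl⟩ <;> norm_num [abs_of_pos, abs_of_neg]

def Rc (Y T : ℝ) : Set (Fin 4 → ℝ) :=
  {x | |x 0| ≤ 1 / 2 ∧ 1 ≤ x 0 ^ 2 + x 1 ^ 2 ∧ 0 ≤ x 1 ∧ x 1 ≤ Y ∧ x 1 ^ 3 * (x 2 ^ 2 + x 3 ^ 2) ≤ T}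

def Ro (Y T : ℝ) : Set (Fin 4 → ℝ) :=
  {x | |x 0| < 1 / 2 ∧ 1 < x 0 ^ 2 + x 1 ^ 2 ∧ 0 < x 1 ∧ x 1 < Y ∧ x 1 ^ 3 * (x 2 ^ 2 + x 3 ^ 2) < T ∧ x 2 ≠ 0}

section
variable {Y T : ℝ}

lemma Ro_sub : Ro Y T ⊆ Rc Y T := fun _ ⟨h1, h2, h3, h4, h5, _⟩ => ⟨h1.le, h2.le, h3.le, h4.le, h5.le⟩

lemma Ro_open : IsOpen (Ro Y T) := by
  have e : Ro Y T = {x : Fin 4 → ℝ | |x 0| < 1 / 2} ∩ {x | 1 < x 0 ^ 2 + x 1 ^ 2} ∩ {x | 0 < x 1} ∩ {x | x 1 < Y} ∩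
      {x | x 1 ^ 3 * (x 2 ^ 2 + x 3 ^ 2) < T} ∩ {x | x 2 ≠ 0} := by
    ext x; simp [Ro, and_assoc]
  rw [e]
  refine ((((IsOpen.inter ?_ ?_).inter ?_).inter ?_).inter ?_).inter ?_
  · exact isOpen_lt (by fun_prop) (by fun_prop)
  · exact isOpen_lt (by fun_prop) (by fun_prop)
  · exact isOpen_lt (by fun_prop) (by fun_prop)
  · exact isOpen_lt (by fun_prop) (by fun_prop)
  · exact isOpen_lt (by fun_prop) (by fun_prop)
  · exact isOpen_ne_fun (by fun_prop) (by fun_prop)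

lemma Rc_closed : IsClosed (Rc Y T) := by
  have e : Rc Y T = {x : Fin 4 → ℝ | |x 0| ≤ 1 / 2} ∩ {x | 1 ≤ x 0 ^ 2 + x 1 ^ 2} ∩ {x | 0 ≤ x 1} ∩ {x | x 1 ≤ Y} ∩
      {x | x 1 ^ 3 * (x 2 ^ 2 + x 3 ^ 2) ≤ T} := by
    ext x; simp [Rc, and_assoc]
  rw [e]
  refine (((IsClosed.inter ?_ ?_).inter ?_).inter ?_).inter ?_
  · exact isClosed_le (by fun_prop) (by fun_prop)
  · exact isClosed_le (by fun_prop) (by fun_prop)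
  · exact isClosed_le (by fun_prop) (by fun_prop)
  · exact isClosed_le (by fun_prop) (by fun_prop)
  · exact isClosed_le (by fun_prop) (by fun_prop)

lemma half_le_of {u v : ℝ} (h1 : |u| ≤ 1 / 2) (h2 : 1 ≤ u ^ 2 + v ^ 2) (h3 : 0 ≤ v) : 4 / 5 ≤ v := by
  have : u ^ 2 ≤ 1 / 4 := by rw [← sq_abs]; nlinarith [abs_nonneg u]
  nlinarith

lemma Rc_bdd : Bornology.IsBounded (Rc Y T) := by
  refine (Metric.isBounded_closedBall (x := (0 : Fin 4 → ℝ)) (r := 1 + |Y| + 4 * |T|)).subset ?_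
  rintro x ⟨h1, h2, h3, h4, h5⟩
  have hv := half_le_of h1 h2 h3
  have hv3 : (1 : ℝ) / 2 ≤ x 1 ^ 3 := by
    calc (1 : ℝ) / 2 ≤ (4 / 5) ^ 3 := by norm_num
      _ ≤ _ := by gcongr
  have hT := le_abs_self T
  have hw : x 2 ^ 2 + x 3 ^ 2 ≤ 2 * |T| := by nlinarith [sq_nonneg (x 2), sq_nonneg (x 3)]
  have hq : ∀ t : ℝ, t ^ 2 ≤ 2 * |T| → |t| ≤ 1 + 4 * |T| := by
    intro t ht
    rw [← sq_abs] at ht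
    nlinarith [abs_nonneg t, abs_nonneg T]
  have hY := le_abs_self Y
  have hT0 := abs_nonneg T
  have hY0 := abs_nonneg Y
  rw [mem_closedBall_zero_iff, pi_norm_le_iff_of_nonneg (by positivity)]
  intro i
  rw [Real.norm_eq_abs]
  fin_cases i
  · simp only [Fin.zero_eta]; linarith
  · simp only [Fin.mk_one]; rw [abs_of_nonneg h3]; linarith
  · have := hq (x 2) (by nlinarith [sq_nonneg (x 3)])
    simp only [Fin.reduceFinMk]; linarith
  · have := hq (x 3) (by nlinarith [sq_nonneg (x 2)])
    simp only [Fin.reduceFinMk]; linarith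

lemma Rc_compact : IsCompact (Rc Y T) := Metric.isCompact_of_isClosed_isBounded Rc_closed Rc_bdd

end
end DH

namespace DH
set_option linter.unusedSectionVars false
open Filter Topology MeasureTheory ENNReal

lemma null_slice {s : Set (Fin 4 → ℝ)} (hs : MeasurableSet s) (i : Fin 4)
    (h : ∀ y : Fin 3 → ℝ, Set.Countable {t : ℝ | i.insertNth (α := fun _ => ℝ) t y ∈ s}) : volume s = 0 := by
  have hmp := (volume_preserving_piFinSuccAbove (fun _ : Fin 4 => ℝ) i).symm
  rw [← hmp.measure_preimage hs.nullMeasurableSet, Measure.volume_eq_prod,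
    Measure.prod_apply_symm (hmp.measurable hs)]
  rw [lintegral_congr (g := fun _ => 0), lintegral_zero]
  intro y
  exact (h y).measure_zero _

lemma countable_sq (a : ℝ) : Set.Countable {t : ℝ | t ^ 2 = a} := by
  refine (Set.Finite.subset (s := {√a, -√a}) (by simp) ?_).countable
  intro t ht
  have ht : t ^ 2 = a := ht
  rw [← ht, Real.sqrt_sq_eq_abs]
  rcases abs_choice t with h | h <;> rw [h] <;> simp

section
variable {Y T : ℝ}

lemma diff_null : volume (Rc Y T \ Ro Y T) = 0 := by
  have hsub : Rc Y T \ Ro Y T ⊆ ((({x : Fin 4 → ℝ | x 0 ^ 2 = 1 / 4} ∪ {x | x 0 ^ 2 + x 1 ^ 2 = 1}) ∪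
      {x | x 1 = Y}) ∪ {x | x 1 ≠ 0 ∧ x 1 ^ 3 * (x 2 ^ 2 + x 3 ^ 2) = T}) ∪ {x | x 2 = 0} := by
    rintro x ⟨⟨h1, h2, h3, h4, h5⟩, h6⟩
    by_contra hc
    simp only [Set.mem_union, Set.mem_ofPred_eq, not_or] at hc
    obtain ⟨⟨⟨⟨c1, c2⟩, c3⟩, c4⟩, c5⟩ := hc
    have hv := half_le_of h1 h2 h3
    have hv0 : x 1 ≠ 0 := by linarith
    apply h6
    refine ⟨lt_of_le_of_ne h1 ?_, lt_of_le_of_ne h2 (Ne.symm c2), by linarith, lt_of_le_of_ne h4 c3,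
      lt_of_le_of_ne h5 fun h => c4 ⟨hv0, h⟩, c5⟩
    intro h
    apply c1
    rw [← sq_abs, h]; norm_num
  refine measure_mono_null hsub ?_
  refine measure_union_null (measure_union_null (measure_union_null (measure_union_null ?_ ?_) ?_) ?_) ?_
  · refine null_slice (measurableSet_eq_fun (by fun_prop) (by fun_prop)) 0 fun y => ?_
    exact (countable_sq (1 / 4)).mono fun t ht => by simpa using ht
  · refine null_slice (measurableSet_eq_fun (by fun_prop) (by fun_prop)) 0 fun y => ?_
    refine (countable_sq (1 - y 0 ^ 2)).mono fun t ht => ?_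
    have ht : t ^ 2 + y 0 ^ 2 = 1 := ht
    change t ^ 2 = _; linarith
  · refine null_slice (measurableSet_eq_fun (by fun_prop) (by fun_prop)) 1 fun y => ?_
    exact (Set.countable_singleton Y).mono fun t ht => ht
  · refine null_slice (MeasurableSet.inter (measurableSet_eq_fun (by fun_prop) (by fun_prop)).compl
      (measurableSet_eq_fun (by fun_prop) (by fun_prop))) 2 fun y => ?_
    refine (countable_sq (T / y 1 ^ 3 - y 2 ^ 2)).mono fun t ht => ?_
    obtain ⟨h1, h2⟩ : y 1 ≠ 0 ∧ y 1 ^ 3 * (t ^ 2 + y 2 ^ 2) = T := ht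
    change t ^ 2 = _
    rw [← h2]; field_simp; ring
  · refine null_slice (measurableSet_eq_fun (by fun_prop) (by fun_prop)) 2 fun y => ?_
    exact (Set.countable_singleton 0).mono fun t ht => ht

variable {σ e : ℝ} (hs : Sg σ e)
include hs

lemma Phi_injOn : Set.InjOn (Phi σ e) (Ro Y T) := by
  rintro x ⟨-, -, h3, -, -, h6⟩ y ⟨-, -, g3, -, -, g6⟩ h
  obtain ⟨a, b, c, d⟩ := Psi_inj hs h3 g3 (by positivity) h
  exact ext4 a b c d

lemma Phi_img_open : IsOpen (Phi σ e '' Ro Y T) := by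
  rw [isOpen_iff_mem_nhds]
  rintro _ ⟨x, hx, rfl⟩
  have hd := hasDeriv_Phi (σ := σ) (e := e) x
  have hdet : (LinearMap.toContinuousLinearMap (Matrix.toLin' (Jac σ e x))).det ≠ 0 := by
    rw [← abs_ne_zero, absdet hs]
    have h1 := hx.2.2.1
    have h2 := hx.2.2.2.2.2
    have := e_ne hs
    positivity
  have hsurj : (LinearMap.toContinuousLinearMap (Matrix.toLin' (Jac σ e x))).range = ⊤ := by
    rw [← LinearMap.coe_toContinuousLinearMap (Matrix.toLin' (Jac σ e x))] at hdet ⊢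
    have := LinearMap.equivOfDetNeZero _ hdet
    exact LinearEquiv.range (LinearMap.equivOfDetNeZero _ hdet)
  rw [← hd.map_nhds_eq_of_surj hsurj]
  exact image_mem_map (Ro_open.mem_nhds hx)

omit hs in
lemma Phi_diff : Differentiable ℝ (Phi σ e) := fun x => (hasDeriv_Phi x).hasFDerivAt.differentiableAt

omit hs in
lemma Sc_compact : IsCompact (Phi σ e '' Rc Y T) := Rc_compact.image Phi_diff.continuous

omit hs in
lemma Sdiff_null : volume (Phi σ e '' Rc Y T \ Phi σ e '' Ro Y T) = 0 := by
  refine measure_mono_null (t := Phi σ e '' (Rc Y T \ Ro Y T)) ?_ ?_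
  · exact Set.subset_image_diff _ _ _
  · exact addHaar_image_eq_zero_of_differentiableOn_of_addHaar_eq_zero volume Phi_diff.differentiableOn diff_null

lemma So_front : volume (frontier (Phi σ e '' Ro Y T)) = 0 := by
  refine measure_mono_null ?_ (Sdiff_null (σ := σ) (e := e) (Y := Y) (T := T))
  rw [(Phi_img_open hs).frontier_eq]
  exact Set.diff_subset_diff_left (closure_minimal (Set.image_mono Ro_sub) Sc_compact.isClosed)

lemma Sc_front : volume (frontier (Phi σ e '' Rc Y T)) = 0 := by
  refine measure_mono_null ?_ (Sdiff_null (σ := σ) (e := e) (Y := Y) (T := T))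
  rw [Sc_compact.isClosed.frontier_eq]
  exact Set.diff_subset_diff_right (interior_maximal (Set.image_mono Ro_sub) (Phi_img_open hs))

lemma vol_Sc_eq : volume (Phi σ e '' Rc Y T) = volume (Phi σ e '' Ro Y T) := by
  refine le_antisymm ?_ (measure_mono (Set.image_mono Ro_sub))
  calc _ ≤ volume (Phi σ e '' Ro Y T ∪ (Phi σ e '' Rc Y T \ Phi σ e '' Ro Y T)) :=
        measure_mono (by rw [Set.union_diff_self]; exact Set.subset_union_right)
    _ ≤ _ := measure_union_le _ _
    _ = _ := by rw [Sdiff_null, add_zero]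

lemma vol_So_eq : volume (Phi σ e '' Ro Y T) =
    ∫⁻ x in Rc Y T, ENNReal.ofReal (4 * e ^ 2 * (x 1 ^ 4 * (x 2 ^ 2 + x 3 ^ 2))) := by
  rw [← lintegral_abs_det_fderiv_eq_addHaar_image volume Ro_open.measurableSet
    (fun x _ => (hasDeriv_Phi x).hasFDerivAt.hasFDerivWithinAt) (Phi_injOn hs)]
  simp only [absdet hs]
  refine setLIntegral_congr ?_
  refine Ro_sub.eventuallyLE.antisymm ?_
  exact ae_le_set.2 diff_null

end
end DH

namespace DH
set_option linter.unusedSectionVars false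
open Filter Topology MeasureTheory ENNReal

lemma lint_Icc {f G : ℝ → ℝ} {a b : ℝ} (hab : a ≤ b) (hc : ContinuousOn f (Set.Icc a b))
    (hn : ∀ x ∈ Set.Icc a b, 0 ≤ f x) (hd : ∀ x ∈ Set.Icc a b, HasDerivAt G (f x) x) :
    ∫⁻ x in Set.Icc a b, ENNReal.ofReal (f x) = ENNReal.ofReal (G b - G a) := by
  have hi : IntervalIntegrable f volume a b := by
    apply ContinuousOn.intervalIntegrable; rwa [Set.uIcc_of_le hab]
  rw [← intervalIntegral.integral_eq_sub_of_hasDerivAt (a := a) (b := b) (f := G) (f' := f)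
    (by rwa [Set.uIcc_of_le hab]) hi, intervalIntegral.integral_of_le hab,
    ← integral_Icc_eq_integral_Ioc, ofReal_integral_eq_lintegral_ofReal]
  · exact hc.integrableOn_Icc
  · exact (ae_restrict_iff' measurableSet_Icc).2 (Eventually.of_forall hn)

lemma lint4 (F : (Fin 4 → ℝ) → ℝ≥0∞) (hF : Measurable F) :
    ∫⁻ x, F x = ∫⁻ u : ℝ, ∫⁻ v : ℝ, ∫⁻ z : ℝ × ℝ, F ![u, v, z.1, z.2] := by
  have h1 := (volume_preserving_piFinSuccAbove (fun _ : Fin 4 => ℝ) 0).symm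
  have h2 := (volume_preserving_piFinSuccAbove (fun _ : Fin 3 => ℝ) 0).symm
  have h3 := (volume_preserving_finTwoArrow ℝ).symm
  rw [← h1.lintegral_comp hF, Measure.volume_eq_prod, lintegral_prod (fun a => F ((MeasurableEquiv.piFinSuccAbove (fun _ : Fin 4 => ℝ) 0).symm a)) (hF.comp h1.measurable).aemeasurable]
  refine lintegral_congr fun u => ?_
  have hFu : Measurable fun y : Fin 3 → ℝ => F ((MeasurableEquiv.piFinSuccAbove (fun _ : Fin 4 => ℝ) 0).symm (u, y)) :=
    hF.comp (h1.measurable.comp (by fun_prop))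
  have := h2.lintegral_comp hFu
  rw [← this, Measure.volume_eq_prod, lintegral_prod (fun a => F ((MeasurableEquiv.piFinSuccAbove (fun _ : Fin 4 => ℝ) 0).symm (u, (MeasurableEquiv.piFinSuccAbove (fun _ : Fin 3 => ℝ) 0).symm a))) (hFu.comp h2.measurable).aemeasurable]
  refine lintegral_congr fun v => ?_
  have hFv : Measurable fun y : Fin 2 → ℝ => F ((MeasurableEquiv.piFinSuccAbove (fun _ : Fin 4 => ℝ) 0).symm (u, (MeasurableEquiv.piFinSuccAbove (fun _ : Fin 3 => ℝ) 0).symm (v, y))) :=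
    hFu.comp (h2.measurable.comp (by fun_prop))
  have := h3.lintegral_comp hFv
  rw [← this]
  refine lintegral_congr fun z => ?_
  congr 1
  exact ext4 rfl rfl rfl rfl

lemma disc_int {ρ c : ℝ} (hρ : 0 ≤ ρ) (hc : 0 ≤ c) :
    ∫⁻ z : ℝ × ℝ, (if z.1 ^ 2 + z.2 ^ 2 ≤ ρ then ENNReal.ofReal (c * (z.1 ^ 2 + z.2 ^ 2)) else 0) =
      ENNReal.ofReal (Real.pi * c * ρ ^ 2 / 2) := by
  rw [← lintegral_comp_polarCoord_symm, polarCoord_target]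
  have hkey : ∀ p ∈ Set.Ioi (0:ℝ) ×ˢ Set.Ioo (-Real.pi) Real.pi,
      ENNReal.ofReal p.1 • (if (polarCoord.symm p).1 ^ 2 + (polarCoord.symm p).2 ^ 2 ≤ ρ then
        ENNReal.ofReal (c * ((polarCoord.symm p).1 ^ 2 + (polarCoord.symm p).2 ^ 2)) else 0) =
      (Set.Icc 0 √ρ).indicator (fun r => ENNReal.ofReal (c * r ^ 3)) p.1 := by
    rintro ⟨r, θ⟩ ⟨hr, -⟩
    have hr : 0 < r := hr
    have e : (r * Real.cos θ) ^ 2 + (r * Real.sin θ) ^ 2 = r ^ 2 := by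
      have := Real.cos_sq_add_sin_sq θ
      linear_combination r ^ 2 * this
    simp only [polarCoord_symm_apply, e]
    by_cases h : r ^ 2 ≤ ρ
    · rw [if_pos h, Set.indicator_of_mem (show r ∈ Set.Icc 0 √ρ from ⟨hr.le, (Real.le_sqrt' hr).2 h⟩), smul_eq_mul, ← ENNReal.ofReal_mul hr.le]
      congr 1; ring
    · rw [if_neg h, Set.indicator_of_notMem, smul_zero]
      rintro ⟨-, h'⟩
      exact h ((Real.le_sqrt' hr).1 h')
  rw [setLIntegral_congr_fun (measurableSet_Ioi.prod measurableSet_Ioo) hkey, Measure.volume_eq_prod,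
    ← Measure.prod_restrict, lintegral_prod _ (by
      refine Measurable.aemeasurable ?_
      refine Measurable.comp (g := (Set.Icc 0 √ρ).indicator (fun r => ENNReal.ofReal (c * r ^ 3))) ?_ measurable_fst
      exact Measurable.indicator (by fun_prop) measurableSet_Icc)]
  simp only [lintegral_const, Measure.restrict_apply_univ, Real.volume_Ioo]
  rw [lintegral_mul_const _ (Measurable.indicator (by fun_prop) measurableSet_Icc),
    setLIntegral_congr Ioi_ae_eq_Ici, lintegral_indicator measurableSet_Icc, Measure.restrict_restrict measurableSet_Icc]
  rw [show Set.Icc 0 √ρ ∩ Set.Ici 0 = Set.Icc 0 √ρ from Set.inter_eq_left.2 fun x hx => hx.1]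
  rw [lint_Icc (G := fun r => c * r ^ 4 / 4) (Real.sqrt_nonneg ρ) (by fun_prop)
    (fun x hx => by have := hx.1; positivity) (fun x _ => by
      refine (((hasDerivAt_pow 4 x).const_mul c).div_const 4).congr_deriv ?_
      norm_num; ring), ← ENNReal.ofReal_mul (by simp; positivity)]
  congr 1
  have : √ρ ^ 4 = ρ ^ 2 := by rw [show 4 = 2 * 2 from rfl, pow_mul, Real.sq_sqrt hρ]
  simp only [this]; ring

open scoped Classical in
lemma vol_val {Y T e : ℝ} (hY : 1 ≤ Y) (hT : 0 ≤ T) :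
    ∫⁻ x in Rc Y T, ENNReal.ofReal (4 * e ^ 2 * (x 1 ^ 4 * (x 2 ^ 2 + x 3 ^ 2))) =
      ENNReal.ofReal (2 * Real.pi * e ^ 2 * T ^ 2 * (Real.pi / 3 - 1 / Y)) := by
  have hπ := Real.pi_pos
  rw [← lintegral_indicator Rc_closed.measurableSet, lint4 _ (Measurable.indicator (by fun_prop) Rc_closed.measurableSet)]
  have hu0 : ∀ u : ℝ, |u| ≤ 1 / 2 → 0 < 1 - u ^ 2 := fun u hu => by
    rw [← sq_abs]; nlinarith [abs_nonneg u]
  have hu1 : ∀ u : ℝ, √(1 - u ^ 2) ≤ 1 := fun u => by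
    rw [Real.sqrt_le_iff]; constructor <;> nlinarith [sq_nonneg u]
  have key : ∀ u v : ℝ, ∫⁻ z : ℝ × ℝ, (Rc Y T).indicator (fun x => ENNReal.ofReal (4 * e ^ 2 * (x 1 ^ 4 * (x 2 ^ 2 + x 3 ^ 2)))) ![u, v, z.1, z.2] =
      (Set.Icc (-(1/2):ℝ) (1/2)).indicator (fun u => (Set.Icc √(1 - u ^ 2) Y).indicator
        (fun v => ENNReal.ofReal (2 * Real.pi * e ^ 2 * T ^ 2 * (v ^ 2)⁻¹)) v) u := by
    intro u v
    by_cases hu : u ∈ Set.Icc (-(1/2):ℝ) (1/2)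
    · rw [Set.indicator_of_mem hu]
      have hu' := abs_le.2 hu
      by_cases hv : v ∈ Set.Icc √(1 - u ^ 2) Y
      · rw [Set.indicator_of_mem hv]
        have hv0 : 0 < v := lt_of_lt_of_le (Real.sqrt_pos.2 (hu0 u hu')) hv.1
        have hv1 : 1 ≤ u ^ 2 + v ^ 2 := by
          have := (Real.sqrt_le_left hv0.le).1 hv.1; linarith
        have e1 : ∀ z : ℝ × ℝ, (Rc Y T).indicator (fun x => ENNReal.ofReal (4 * e ^ 2 * (x 1 ^ 4 * (x 2 ^ 2 + x 3 ^ 2)))) ![u, v, z.1, z.2] =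
          if z.1 ^ 2 + z.2 ^ 2 ≤ T / v ^ 3 then ENNReal.ofReal (4 * e ^ 2 * v ^ 4 * (z.1 ^ 2 + z.2 ^ 2)) else 0 := by
          intro z
          rw [Set.indicator_apply]
          have : ![u, v, z.1, z.2] ∈ Rc Y T ↔ z.1 ^ 2 + z.2 ^ 2 ≤ T / v ^ 3 := by
            rw [le_div_iff₀ (by positivity)]
            simp only [Rc, Set.mem_ofPred_eq]
            constructor
            · rintro ⟨-, -, -, -, h⟩; simp at h; linarith
            · intro h; refine ⟨hu', hv1, hv0.le, hv.2, ?_⟩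
              simp; linarith
          simp only [this]
          refine if_congr Iff.rfl ?_ rfl
          congr 1; simp; ring
        simp only [e1]
        rw [disc_int (by positivity) (by positivity)]
        congr 1; field_simp; ring
      · rw [Set.indicator_of_notMem hv]
        rw [lintegral_congr (g := fun _ => 0), lintegral_zero]
        intro z
        rw [Set.indicator_of_notMem]
        rintro ⟨-, h2, h3, h4, -⟩
        have h2 : 1 ≤ u ^ 2 + v ^ 2 := h2
        have h3 : 0 ≤ v := h3
        exact hv ⟨Real.sqrt_le_iff.2 ⟨h3, by linarith⟩, h4⟩
    · rw [Set.indicator_of_notMem hu]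
      rw [lintegral_congr (g := fun _ => 0), lintegral_zero]
      intro z
      rw [Set.indicator_of_notMem]
      rintro ⟨h1, -⟩
      exact hu (abs_le.1 h1)
  simp only [key]
  have key2 : ∀ u : ℝ, ∫⁻ v : ℝ, (Set.Icc (-(1/2):ℝ) (1/2)).indicator (fun u => (Set.Icc √(1 - u ^ 2) Y).indicator
        (fun v => ENNReal.ofReal (2 * Real.pi * e ^ 2 * T ^ 2 * (v ^ 2)⁻¹)) v) u =
      (Set.Icc (-(1/2):ℝ) (1/2)).indicator (fun u => ENNReal.ofReal (2 * Real.pi * e ^ 2 * T ^ 2 * (1 / √(1 - u ^ 2) - 1 / Y))) u := by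
    intro u
    by_cases hu : u ∈ Set.Icc (-(1/2):ℝ) (1/2)
    · simp only [Set.indicator_of_mem hu]
      have hu' := abs_le.2 hu
      have hs : 0 < √(1 - u ^ 2) := Real.sqrt_pos.2 (hu0 u hu')
      have hne : ∀ x ∈ Set.Icc √(1 - u ^ 2) Y, x ≠ 0 := fun x hx => (lt_of_lt_of_le hs hx.1).ne'
      rw [lintegral_indicator measurableSet_Icc, lint_Icc (G := fun v => 2 * Real.pi * e ^ 2 * T ^ 2 * (-(v⁻¹)))
        ((hu1 u).trans hY)]
      · congr 1; simp only [one_div]; ring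
      · exact ContinuousOn.mul continuousOn_const (ContinuousOn.inv₀ (by fun_prop) fun x hx => pow_ne_zero 2 (hne x hx))
      · intro x hx; positivity
      · intro x hx
        refine (((hasDerivAt_inv (hne x hx)).neg).const_mul (2 * Real.pi * e ^ 2 * T ^ 2)).congr_deriv ?_
        ring
    · simp only [Set.indicator_of_notMem hu, lintegral_zero]
  simp only [key2]
  rw [lintegral_indicator measurableSet_Icc, lint_Icc (G := fun u => 2 * Real.pi * e ^ 2 * T ^ 2 * (Real.arcsin u - u / Y)) (by norm_num)]
  · congr 1
    have h : Real.arcsin (1/2) = Real.pi / 6 := by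
      rw [← Real.sin_pi_div_six, Real.arcsin_sin] <;> linarith
    rw [Real.arcsin_neg, h]; ring
  · refine ContinuousOn.mul continuousOn_const (ContinuousOn.sub (ContinuousOn.div continuousOn_const (by fun_prop) fun x hx => ?_) continuousOn_const)
    exact (Real.sqrt_pos.2 (hu0 x (abs_le.2 hx))).ne'
  · intro x hx
    have hs : 0 < √(1 - x ^ 2) := Real.sqrt_pos.2 (hu0 x (abs_le.2 hx))
    have : 1 / Y ≤ 1 / √(1 - x ^ 2) := one_div_le_one_div_of_le hs ((hu1 x).trans hY)
    have : 0 ≤ 1 / √(1 - x ^ 2) - 1 / Y := by linarith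
    positivity
  · intro x hx
    refine HasDerivAt.const_mul _ (HasDerivAt.sub ?_ ?_)
    · apply Real.hasDerivAt_arcsin <;> [have := hx.1; have := hx.2] <;> intro h <;> linarith
    · exact (hasDerivAt_id x).div_const Y

lemma vol_So {σ e Y T : ℝ} (hs : Sg σ e) (hY : 1 ≤ Y) (hT : 0 ≤ T) :
    (volume (Phi σ e '' Ro Y T)).toReal = 2 * Real.pi * e ^ 2 * T ^ 2 * (Real.pi / 3 - 1 / Y) := by
  have h1 : 1 / Y ≤ 1 := by rw [div_le_one (by linarith)]; exact hY
  have := Real.pi_gt_three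
  rw [vol_So_eq hs, vol_val hY hT, ENNReal.toReal_ofReal]
  have : 0 ≤ Real.pi / 3 - 1 / Y := by linarith
  positivity

end DH

namespace DH
set_option linter.unusedSectionVars false
open Filter Topology Matrix MatrixGroups UpperHalfPlane

/-- unipotent matrix -/
def trM (n : ℤ) : SL(2, ℤ) := ⟨!![1, n; 0, 1], by simp [Matrix.det_fin_two]⟩

lemma gact_trM (n : ℤ) (f : Fin 4 → ℤ) : gact (trM n) f = act 1 n 0 1 f := by
  simp [gact, trM]

lemma Psi_tr {σ e : ℝ} (n u v p q : ℝ) : act 1 n 0 1 (Psi σ e u v p q) = Psi σ e (u - n) v p q := by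
  apply ext4 <;> simp only [Psi_0, Psi_1, Psi_2, Psi_3, act_0, act_1, act_2, act_3] <;> ring

lemma toR_tr {σ e : ℝ} {n : ℤ} {u v p q : ℝ} {f : Fin 4 → ℤ} (h : toR f = Psi σ e u v p q) :
    toR (gact (trM n) f) = Psi σ e (u - n) v p q := by
  rw [toR_gact, h, ← Psi_tr]; simp [trM]

variable {σ e : ℝ} (hs : Sg σ e)
include hs

lemma red_exists (f : Fin 4 → ℤ) (hD : 0 < e * ((fdisc f : ℤ) : ℝ)) :
    ∃ g u v p q, toR (gact g f) = Psi σ e u v p q ∧ |u| ≤ 1 / 2 ∧ 1 ≤ u ^ 2 + v ^ 2 ∧ 0 < v := by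
  obtain ⟨z, w, h⟩ := Ps_surj hs f hD
  obtain ⟨g, hg⟩ := ModularGroup.exists_smul_mem_fd z
  obtain ⟨w', hw⟩ := Ps_gact hs g⁻¹ z w h
  rw [inv_inv] at hw
  refine ⟨g⁻¹, _, _, _, _, hw, hg.2, ?_, (g • z).im_pos⟩
  have := hg.1
  rw [Complex.normSq_apply] at this
  simp only [coe_re, coe_im] at this
  nlinarith

lemma red_unique {f : Fin 4 → ℤ} {g : SL(2, ℤ)} {u v p q u' v' p' q' : ℝ}
    (h : toR f = Psi σ e u v p q) (h1 : |u| < 1 / 2) (h2 : 1 < u ^ 2 + v ^ 2) (h3 : 0 < v) (hw : 0 < p ^ 2 + q ^ 2)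
    (h' : toR (gact g f) = Psi σ e u' v' p' q') (h1' : |u'| ≤ 1 / 2) (h2' : 1 ≤ u' ^ 2 + v' ^ 2) (h3' : 0 < v') :
    gact g f = f ∨ gact g f = -f := by
  let z : ℍ := ⟨⟨u, v⟩, h3⟩
  let z' : ℍ := ⟨⟨u', v'⟩, h3'⟩
  obtain ⟨w2, hw2⟩ := Ps_gact hs g z ⟨p, q⟩ (f := f) h
  have hz' : toR (gact g f) = Ps σ e z' ⟨p', q'⟩ := h'
  have hw' : (⟨p', q'⟩ : ℂ) ≠ 0 := by
    intro h0
    have e1 := fdisc_gact g f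
    have e2 : fdisc (toR (gact g f)) = fdisc (toR f) := by rw [fdisc_toR, fdisc_toR, e1]
    rw [hz', h0, h, fdisc_Ps hs, fdisc_Psi hs] at e2
    have := e_ne hs
    have : 4 * e ^ 3 * (v ^ 3 * (p ^ 2 + q ^ 2)) ^ 2 ≠ 0 := by positivity
    apply this
    rw [← e2]; simp
  obtain ⟨hz, -⟩ := Ps_inj hs hw' (hz'.symm.trans hw2)
  have hd : z ∈ ModularGroup.fdo := by
    refine ⟨?_, h1⟩
    rw [Complex.normSq_apply]; change 1 < u * u + v * v; nlinarith
  have hd' : g⁻¹ • z ∈ ModularGroup.fd := by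
    rw [← hz]
    refine ⟨?_, h1'⟩
    rw [Complex.normSq_apply]; change 1 ≤ u' * u' + v' * v'; nlinarith
  rcases ModularGroup.eq_one_or_neg_one_of_mem_fdo_mem_fd hd hd' with h | h
  · left; rw [inv_eq_one.1 h, gact_one]
  · right
    have : g = -1 := by rw [← inv_inv g, h]; simp
    rw [this, gact_neg, gact_one]

omit hs in
lemma fund_b {b m : ℤ} (h : Fund (b ^ 2 * m)) (hm : m % 4 = 0 ∨ m % 4 = 1 ∨ (¬ 2 ∣ b)) : b = 1 ∨ b = -1 := by
  rw [← Int.natAbs_eq_natAbs_iff (b := 1)]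
  by_contra hc
  obtain ⟨p, hp, hpb⟩ := Nat.exists_prime_and_dvd (n := b.natAbs) (by simpa using hc)
  have hd : (p : ℤ) ∣ b := Int.natCast_dvd.2 hpb
  have hF := h p hp
  unfold FundAt at hF
  split_ifs at hF with h2
  · subst h2
    have hd : (2 : ℤ) ∣ b := by exact_mod_cast hd
    obtain ⟨c, rfl⟩ := hd
    have hm : m % 4 = 0 ∨ m % 4 = 1 := by
      rcases hm with h | h | h
      · exact Or.inl h
      · exact Or.inr h
      · exact absurd (Dvd.intro c rfl) h
    have hc2 : c ^ 2 % 4 = 0 ∨ c ^ 2 % 4 = 1 := by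
      rcases Int.even_or_odd' c with ⟨k, rfl | rfl⟩ <;> ring_nf <;> omega
    have e : (2 * c) ^ 2 * m = 4 * (c ^ 2 * m) := by ring
    have e2 : (c ^ 2 * m) % 4 = 0 ∨ (c ^ 2 * m) % 4 = 1 := by
      rw [Int.mul_emod]
      rcases hc2 with h | h <;> rcases hm with h' | h' <;> rw [h, h'] <;> simp
    rw [e] at hF
    omega
  · exact hF (Dvd.dvd.mul_right (pow_dvd_pow_of_dvd hd 2) m)

omit hs in
lemma fdisc_zero {f : Fin 4 → ℤ} (h0 : f 0 = 0) : fdisc f = f 1 ^ 2 * (4 * f 1 * f 3 - 3 * f 2 ^ 2) := by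
  simp only [fdisc, h0]; ring

omit hs in
lemma zero_b {f : Fin 4 → ℤ} (h0 : f 0 = 0) (h : Fund (fdisc f)) : f 1 = 1 ∨ f 1 = -1 := by
  rw [fdisc_zero h0] at h
  by_cases hb : (2 : ℤ) ∣ f 1
  · refine fund_b h ?_
    obtain ⟨c, hc⟩ := hb
    have hc2 : f 2 ^ 2 % 4 = 0 ∨ f 2 ^ 2 % 4 = 1 := by
      rcases Int.even_or_odd' (f 2) with ⟨k, h | h⟩ <;> rw [h] <;> ring_nf <;> omega
    have : 4 * f 1 * f 3 = 4 * (f 1 * f 3) := by ring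
    rw [this]; omega
  · exact fund_b h (Or.inr (Or.inr hb))

/-- the distinguished form of discriminant `D`. -/
def zf (D : ℤ) : Fin 4 → ℤ := ![0, 1, D % 2, (D + 3 * (D % 2) ^ 2) / 4]

omit hs in
lemma zf_disc {D : ℤ} (h : Fund D) : fdisc (zf D) = D := by
  have h4 := h 2 Nat.prime_two
  simp only [FundAt, if_true] at h4
  rw [fdisc_zero (by simp [zf])]
  have : (D + 3 * (D % 2) ^ 2) % 4 = 0 := by
    rcases Int.emod_two_eq D with h | h <;> rw [h] <;> omega
  simp only [zf]
  simp
  omega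

omit hs in
lemma zf_uniq {f : Fin 4 → ℤ} (h0 : f 0 = 0) (h : Fund (fdisc f)) : toOrb f = toOrb (zf (fdisc f)) := by
  have key : ∀ f : Fin 4 → ℤ, f 0 = 0 → f 1 = 1 → Fund (fdisc f) → toOrb f = toOrb (zf (fdisc f)) := by
    intro f h0 h1 h
    rw [toOrb_eq]
    refine ⟨trM (-(f 2 / 2)), ?_⟩
    rw [gact_trM]
    have hf2 := Int.emod_add_mul_ediv (f 2) 2
    have hD : fdisc f = 4 * f 3 - 3 * f 2 ^ 2 := by rw [fdisc_zero h0, h1]; ring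
    have hpar : fdisc f % 2 = f 2 % 2 := by
      rw [hD]
      have : f 2 ^ 2 % 2 = f 2 % 2 := by
        rcases Int.even_or_odd' (f 2) with ⟨k, h | h⟩ <;> rw [h] <;> ring_nf <;> omega
      omega
    have e : fdisc f + 3 * (f 2 % 2) ^ 2 = 4 * (f 3 + 3 * (f 2 / 2) ^ 2 - 3 * f 2 * (f 2 / 2)) := by
      rw [hD]
      generalize f 2 / 2 = k at *
      generalize f 2 % 2 = r at *
      rw [← hf2]; ring
    apply ext4
    · simp [zf, h0]
    · simp [zf, h0, h1]
    · simp [zf, h0, h1, hpar]; linarith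
    · simp only [zf, act_3, h0, h1, hpar, e]
      simp
      ring
  rcases zero_b h0 h with h1 | h1
  · exact key f h0 h1 h
  · have := key (-f) (by simp [h0]) (by simp [h1])
    have e : toOrb (-f) = toOrb f := by
      have := toOrb_gact (-1) f
      rwa [gact_neg, gact_one] at this
    have ed : fdisc (-f) = fdisc f := fdisc_of_toOrb e
    rw [ed, e] at this
    exact this h

/-- forms in the interior of the reduction domain are not equivalent to forms with `a = 0`. -/
lemma int_not_zero {f f' : Fin 4 → ℤ} {u v p q : ℝ}
    (h : toR f = Psi σ e u v p q) (h1 : |u| < 1 / 2) (h2 : 1 < u ^ 2 + v ^ 2) (h3 : 0 < v) (hf0 : f 0 ≠ 0)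
    (hF : Fund (fdisc f)) (hbig : 4 ≤ e * ((fdisc f : ℤ) : ℝ)) (h0 : f' 0 = 0) (ho : toOrb f = toOrb f') : False := by
  have hp : p ≠ 0 := by
    have := congrFun h 0
    simp only [toR, Psi_0] at this
    rw [← this]; exact_mod_cast hf0
  have hd := fdisc_of_toOrb ho
  obtain ⟨z, w, hz⟩ := Ps_surj hs f' (by rw [← hd]; linarith)
  have hz' : toR f' = Psi σ e z.re z.im w.re w.im := hz
  set n := round z.re
  have ht := toR_tr (n := n) hz'
  set f'' := gact (trM n) f' with hf''
  have h0'' : f'' 0 = 0 := by rw [hf'', gact_trM]; simp [h0]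
  have ho'' : toOrb f = toOrb f'' := by rw [ho, hf'', toOrb_gact]
  obtain ⟨g, hg⟩ := toOrb_eq.1 ho''
  have hd'' := fdisc_of_toOrb ho''
  have hb := zero_b h0'' (hd'' ▸ hF)
  have hw0 : w.re = 0 := by
    have := congrFun ht 0
    simp only [toR, Psi_0, h0''] at this
    simpa using this.symm
  have hdisc := fdisc_toR f''
  rw [ht, fdisc_Psi hs, hw0, ← hd''] at hdisc
  have hb2 : (σ * e * w.im * z.im) ^ 2 = 1 := by
    have := congrFun ht 1
    simp only [toR, Psi_1, hw0, mul_zero, sub_zero] at this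
    rw [← this]
    rcases hb with h | h <;> rw [h] <;> norm_num
  have hσ : σ ^ 2 = 1 := by rcases hs.h with ⟨rfl, -⟩ | ⟨rfl, -⟩ <;> norm_num
  have hv : 4 * z.im ^ 2 = e * ((fdisc f : ℤ) : ℝ) := by
    rw [← hdisc]
    have hb3 : e ^ 2 * w.im ^ 2 * z.im ^ 2 = 1 := by
      have : (σ * e * w.im * z.im) ^ 2 = σ ^ 2 * (e ^ 2 * w.im ^ 2 * z.im ^ 2) := by ring
      rw [this, hσ, one_mul] at hb2; exact hb2
    have : e * (4 * e ^ 3 * (z.im ^ 3 * (0 ^ 2 + w.im ^ 2)) ^ 2) = 4 * z.im ^ 2 * (e ^ 2 * w.im ^ 2 * z.im ^ 2) ^ 2 := by ring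
    rw [this, hb3]; ring
  rw [← hg] at ht h0''
  have hr : |z.re - n| ≤ 1 / 2 := abs_sub_round _
  rcases red_unique hs h h1 h2 h3 (by positivity) ht hr (by nlinarith [sq_nonneg (z.re - n)]) z.im_pos with h | h
  · rw [h] at h0''; exact hf0 h0''
  · rw [h] at h0''; exact hf0 (by simpa using h0'')

end DH

namespace DH
set_option linter.unusedSectionVars false
open Filter Topology Matrix MatrixGroups UpperHalfPlane

def redS (σ e V T : ℝ) : Set (Fin 4 → ℤ) := {f | f 0 ≠ 0 ∧ ∃ u v p q, toR f = Psi σ e u v p q ∧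
  |u| ≤ 1 / 2 ∧ 1 ≤ u ^ 2 + v ^ 2 ∧ 0 < v ∧ V ≤ v ∧ v ^ 3 * (p ^ 2 + q ^ 2) ≤ T}

def dyS (σ e V T : ℝ) : Set (Fin 4 → ℤ) := {f | f 0 ≠ 0 ∧ ∃ u v p q, toR f = Psi σ e u v p q ∧
  |u| ≤ 1 / 2 ∧ 1 ≤ u ^ 2 + v ^ 2 ∧ 0 < v ∧ V ≤ v ∧ v ^ 3 * (p ^ 2 + q ^ 2) ≤ T ∧ v < 2 * V}

/-- integer box -/
noncomputable def bx (B : Fin 4 → ℝ) : Finset (Fin 4 → ℤ) := Fintype.piFinset fun i => Finset.Icc (-⌊B i⌋) ⌊B i⌋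

lemma mem_bx {B : Fin 4 → ℝ} {f : Fin 4 → ℤ} : f ∈ bx B ↔ ∀ i, |(f i : ℝ)| ≤ B i := by
  simp only [bx, Fintype.mem_piFinset, Finset.mem_Icc]
  refine forall_congr' fun i => ?_
  rw [← abs_le, Int.le_floor]; push_cast; rfl

lemma card_bx {B : Fin 4 → ℝ} (hB : ∀ i, 1 ≤ B i) : ((bx B).card : ℝ) ≤ ∏ i, (3 * B i) := by
  rw [bx, Fintype.card_piFinset]
  push_cast
  refine Finset.prod_le_prod (fun _ _ => by positivity) fun i _ => ?_
  rw [Int.card_Icc]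
  have h1 : (1 : ℤ) ≤ ⌊B i⌋ := Int.le_floor.2 (by exact_mod_cast hB i)
  have h2 := Int.floor_le (B i)
  have h3 : (((⌊B i⌋ + 1 - -⌊B i⌋).toNat : ℤ) : ℝ) = 2 * ⌊B i⌋ + 1 := by
    rw [Int.toNat_of_nonneg (by linarith)]; push_cast; ring
  have h4 : (((⌊B i⌋ + 1 - -⌊B i⌋).toNat : ℕ) : ℝ) = 2 * ⌊B i⌋ + 1 := by rw [← h3, Int.cast_natCast]
  rw [h4]
  have := hB i
  linarith

variable {σ e : ℝ} (hs : Sg σ e)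
include hs

lemma Sg_abs : |σ| ≤ 1 ∧ |e| ≤ 1 := by
  rcases hs.h with ⟨rfl, rfl⟩ | ⟨rfl, rfl⟩ <;> norm_num

lemma Psi_bound {u v p q V W : ℝ} (hV : 0 < V) (hu : |u| ≤ 4 * V) (hv0 : 0 < v) (hv : v ≤ 2 * V)
    (hp : |p| ≤ W) (hq : |q| ≤ W) : ∀ i : Fin 4, |Psi σ e u v p q i| ≤ 6 ^ (i : ℕ) * W * V ^ (i : ℕ) := by
  obtain ⟨hσ, he⟩ := Sg_abs hs
  have hv' : |v| ≤ 2 * V := by rw [abs_of_pos hv0]; exact hv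
  have hW : 0 ≤ W := (abs_nonneg p).trans hp
  have hse : |σ * e| ≤ 1 := by rw [abs_mul]; nlinarith [abs_nonneg σ, abs_nonneg e]
  have m1 : |σ * e * q * v| ≤ 2 * (W * V) := by
    rw [abs_mul, abs_mul]
    calc _ ≤ 1 * W * (2 * V) := by gcongr
      _ = _ := by ring
  have m2 : |u * p| ≤ 4 * (W * V) := by
    rw [abs_mul]
    calc _ ≤ 4 * V * W := by gcongr
      _ = _ := by ring
  have m3 : |e * p * v ^ 2| ≤ 4 * (W * V ^ 2) := by
    rw [abs_mul, abs_mul, abs_pow]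
    calc _ ≤ 1 * W * (2 * V) ^ 2 := by gcongr
      _ = _ := by ring
  have m4 : |u * (σ * e * q * v)| ≤ 8 * (W * V ^ 2) := by
    rw [abs_mul]
    calc _ ≤ 4 * V * (2 * (W * V)) := by gcongr
      _ = _ := by ring
  have m5 : |u ^ 2 * p| ≤ 16 * (W * V ^ 2) := by
    rw [abs_mul, abs_pow]
    calc _ ≤ (4 * V) ^ 2 * W := by gcongr
      _ = _ := by ring
  have m6 : |σ * q * v ^ 3| ≤ 8 * (W * V ^ 3) := by
    rw [abs_mul, abs_mul, abs_pow]
    calc _ ≤ 1 * W * (2 * V) ^ 3 := by gcongr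
      _ = _ := by ring
  have m7 : |u * (e * p * v ^ 2)| ≤ 16 * (W * V ^ 3) := by
    rw [abs_mul]
    calc _ ≤ 4 * V * (4 * (W * V ^ 2)) := by gcongr
      _ = _ := by ring
  have m8 : |u ^ 2 * (σ * e * q * v)| ≤ 32 * (W * V ^ 3) := by
    rw [abs_mul, abs_pow]
    calc _ ≤ (4 * V) ^ 2 * (2 * (W * V)) := by gcongr
      _ = _ := by ring
  have m9 : |u ^ 3 * p| ≤ 64 * (W * V ^ 3) := by
    rw [abs_mul, abs_pow]
    calc _ ≤ (4 * V) ^ 3 * W := by gcongr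
      _ = _ := by ring
  rw [abs_le] at m1 m2 m3 m4 m5 m6 m7 m8 m9
  intro i
  fin_cases i
  · simpa [Psi_0] using hp
  · simp only [Fin.mk_one, Psi_1, Fin.val_one]
    rw [abs_le]; constructor <;> linarith
  · simp only [Fin.reduceFinMk, Psi_2]
    change |_| ≤ 6 ^ 2 * W * V ^ 2
    rw [abs_le]; constructor <;> linarith
  · simp only [Fin.reduceFinMk, Psi_3]
    change |_| ≤ 6 ^ 3 * W * V ^ 3
    rw [abs_le]; constructor <;> linarith

lemma dy_bound {V T : ℝ} (hV : 4 / 5 ≤ V) : (dyS σ e V T).Finite ∧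
    ((dyS σ e V T).ncard : ℝ) ≤ 4000000 * T ^ 2 / V := by
  have hV0 : 0 < V := by linarith
  rcases Set.eq_empty_or_nonempty (dyS σ e V T) with h | ⟨f0, hf0, u0, v0, p0, q0, e0, -, -, h00, h01, h02, -⟩
  · rw [h]; simp; positivity
  have hT : V ^ 3 ≤ T := by
    have h1 : (1 : ℝ) ≤ p0 ^ 2 := by
      have := congrFun e0 0
      simp only [toR, Psi_0] at this
      rw [← this]
      exact_mod_cast Int.one_le_abs (pow_ne_zero 2 hf0) |>.trans (le_of_eq (abs_of_nonneg (sq_nonneg _)))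
    calc V ^ 3 ≤ v0 ^ 3 := by gcongr
      _ ≤ v0 ^ 3 * (p0 ^ 2 + q0 ^ 2) := le_mul_of_one_le_right (by positivity) (by nlinarith [sq_nonneg q0])
      _ ≤ T := h02
  have hT0 : 0 < T := lt_of_lt_of_le (by positivity) hT
  set W := √(T / V ^ 3) with hWdef
  have hW2 : W ^ 2 = T / V ^ 3 := Real.sq_sqrt (by positivity)
  have hW1 : 1 ≤ W := Real.one_le_sqrt.2 ((one_le_div (by positivity)).2 hT)
  let B : Fin 4 → ℝ := fun i => 6 ^ (i : ℕ) * W * V ^ (i : ℕ)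
  have hB : ∀ i, 1 ≤ B i := fun i => by
    have : B i = (6 * V) ^ (i : ℕ) * W := by simp only [B, mul_pow]; ring
    rw [this]
    exact one_le_mul_of_one_le_of_one_le (one_le_pow₀ (by linarith)) hW1
  have hmap : ∀ f ∈ dyS σ e V T, ∀ m : ℕ, m ≤ ⌊V⌋₊ → gact (trM (-(2 * m))) f ∈ bx B := by
    rintro f ⟨-, u, v, p, q, h, h1, h2, h3, h4, h5, h6⟩ m hm
    rw [mem_bx]
    have hmV : (m : ℝ) ≤ V := (Nat.le_floor_iff hV0.le).1 hm
    have := toR_tr (n := -(2 * m)) h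
    have hpq : p ^ 2 + q ^ 2 ≤ W ^ 2 := by
      rw [hW2, le_div_iff₀ (by positivity)]
      calc _ ≤ (p ^ 2 + q ^ 2) * v ^ 3 := by gcongr
        _ ≤ T := by linarith
    intro i
    have e1 : ((gact (trM (-(2 * m))) f i : ℤ) : ℝ) = Psi σ e (u - ((-(2 * m) : ℤ) : ℝ)) v p q i := congrFun this i
    rw [e1]
    refine Psi_bound hs hV0 ?_ h3 h6.le ?_ ?_ i
    · push_cast
      rw [abs_le] at h1 ⊢
      have : (0 : ℝ) ≤ m := Nat.cast_nonneg m
      constructor <;> linarith [h1.1, h1.2]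
    · exact abs_le_of_sq_le_sq (by nlinarith [sq_nonneg q]) (by linarith)
    · exact abs_le_of_sq_le_sq (by nlinarith [sq_nonneg p]) (by linarith)
  have hinj : Set.InjOn (fun x : (Fin 4 → ℤ) × ℕ => gact (trM (-(2 * x.2))) x.1)
      (dyS σ e V T ×ˢ (Finset.range (⌊V⌋₊ + 1) : Set ℕ)) := by
    rintro ⟨f, m⟩ ⟨⟨hf, u, v, p, q, h, h1, h2, h3, -⟩, -⟩ ⟨f', m'⟩ ⟨⟨-, u', v', p', q', h', h1', h2', h3', -⟩, -⟩ hh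
    simp only at h h' hh hf
    have t1 := toR_tr (n := -(2 * m)) h
    have t2 := toR_tr (n := -(2 * m')) h'
    rw [hh, t2] at t1
    have hp : p ≠ 0 := by
      have := congrFun h 0
      simp only [toR, Psi_0] at this
      rw [← this]; exact_mod_cast hf
    obtain ⟨c1, c2, c3, c4⟩ := Psi_inj hs h3 h3' (by positivity) t1.symm
    push_cast at c1
    have hmm : m = m' := by
      rw [abs_le] at h1 h1'
      have d1 : (2 * m : ℝ) < 2 * m' + 2 := by linarith
      have d2 : (2 * m' : ℝ) < 2 * m + 2 := by linarith
      norm_cast at d1 d2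
      omega
    subst hmm
    have : u = u' := by linarith
    subst this c2 c3 c4
    rw [toR_inj (h.trans h'.symm)]
  have hsub : dyS σ e V T ⊆ bx B := fun f hf => by
    have := hmap f hf 0 (by simp)
    rwa [gact_trM, show (-(2 * ((0 : ℕ) : ℤ))) = 0 by simp, act_one] at this
  have hfin : (dyS σ e V T).Finite := (bx B).finite_toSet.subset hsub
  refine ⟨hfin, ?_⟩
  have hle := Set.ncard_le_ncard_of_injOn (t := (bx B : Set (Fin 4 → ℤ))) _ (fun x hx => hmap x.1 hx.1 x.2 (by
    have := hx.2; simp at this; omega)) hinj (bx B).finite_toSet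
  rw [Set.ncard_prod, Set.ncard_coe_finset, Set.ncard_coe_finset, Finset.card_range] at hle
  have hle' : ((dyS σ e V T).ncard : ℝ) * (⌊V⌋₊ + 1) ≤ (bx B).card := by exact_mod_cast hle
  have hc := card_bx hB
  rw [Fin.prod_univ_four] at hc
  have hcB : 3 * B 0 * (3 * B 1) * (3 * B 2) * (3 * B 3) = 3779136 * T ^ 2 := by
    have : 3 * B 0 * (3 * B 1) * (3 * B 2) * (3 * B 3) = 3779136 * ((W ^ 2) ^ 2 * V ^ 6) := by
      simp only [B]
      norm_num
      ring
    rw [this, hW2]; field_simp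
  have hfl : V ≤ ⌊V⌋₊ + 1 := (Nat.lt_floor_add_one V).le
  rw [le_div_iff₀ hV0]
  calc ((dyS σ e V T).ncard : ℝ) * V ≤ (dyS σ e V T).ncard * (⌊V⌋₊ + 1) := by gcongr
    _ ≤ 3779136 * T ^ 2 := by rw [← hcB]; exact hle'.trans hc
    _ ≤ _ := by nlinarith [sq_nonneg T]

lemma red_bound {V T : ℝ} (hV : 4 / 5 ≤ V) : (redS σ e V T).Finite ∧
    ((redS σ e V T).ncard : ℝ) ≤ 8000000 * T ^ 2 / V := by
  have key : ∀ K : ℕ, ∀ V, 4 / 5 ≤ V → |T| + 1 < 2 ^ K * V → (redS σ e V T).Finite ∧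
    ((redS σ e V T).ncard : ℝ) ≤ 8000000 * T ^ 2 / V := by
    intro K
    induction K with
    | zero =>
      intro V hV hT
      have hV0 : 0 < V := by linarith
      have : redS σ e V T = ∅ := by
        rw [Set.eq_empty_iff_forall_notMem]
        rintro f ⟨hf0, u0, v0, p0, q0, e0, -, -, h00, h01, h02⟩
        have h1 : (1 : ℝ) ≤ p0 ^ 2 := by
          have := congrFun e0 0
          simp only [toR, Psi_0] at this
          rw [← this]
          exact_mod_cast Int.one_le_abs (pow_ne_zero 2 hf0) |>.trans (le_of_eq (abs_of_nonneg (sq_nonneg _)))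
        have h2 : v0 ^ 3 ≤ T := le_trans (le_mul_of_one_le_right (by positivity) (by nlinarith [sq_nonneg q0])) h02
        have h3 : 1 ≤ v0 := by linarith [abs_nonneg T]
        have h4 : v0 ≤ v0 ^ 3 := le_self_pow₀ h3 (by norm_num)
        linarith [le_abs_self T]
      rw [this]; simp; positivity
    | succ K ih =>
      intro V hV hT
      have hV0 : 0 < V := by linarith
      obtain ⟨a1, a2⟩ := ih (2 * V) (by linarith) (by rw [pow_succ] at hT; linarith)
      obtain ⟨b1, b2⟩ := dy_bound hs (T := T) hV
      have hsub : redS σ e V T ⊆ dyS σ e V T ∪ redS σ e (2 * V) T := by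
        rintro f ⟨hf0, u, v, p, q, h, h1, h2, h3, h4, h5⟩
        rcases lt_or_ge v (2 * V) with h6 | h6
        · exact Or.inl ⟨hf0, u, v, p, q, h, h1, h2, h3, h4, h5, h6⟩
        · exact Or.inr ⟨hf0, u, v, p, q, h, h1, h2, h3, h6, h5⟩
      refine ⟨(b1.union a1).subset hsub, ?_⟩
      have := (Set.ncard_le_ncard hsub (b1.union a1)).trans (Set.ncard_union_le _ _)
      have h' : ((redS σ e V T).ncard : ℝ) ≤ (dyS σ e V T).ncard + (redS σ e (2 * V) T).ncard := by exact_mod_cast this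
      have : 8000000 * T ^ 2 / V = 4000000 * T ^ 2 / V + 8000000 * T ^ 2 / (2 * V) := by field_simp; ring
      linarith
  obtain ⟨K, hK⟩ := pow_unbounded_of_one_lt ((|T| + 1) / V) (one_lt_two (α := ℝ))
  exact key K V hV ((div_lt_iff₀ (by linarith)).1 hK)

end DH

namespace DH
set_option linter.unusedSectionVars false
open Filter Topology Matrix MatrixGroups UpperHalfPlane

lemma int_ivl (x r : ℝ) (hr : 0 ≤ r) : ((Finset.Icc ⌈x - r⌉ ⌊x + r⌋).card : ℝ) ≤ 2 * r + 1 := by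
  rw [Int.card_Icc]
  have h1 := Int.floor_le (x + r)
  have h2 := Int.le_ceil (x - r)
  rcases le_total 0 (⌊x + r⌋ + 1 - ⌈x - r⌉) with h | h
  · have : (((⌊x + r⌋ + 1 - ⌈x - r⌉).toNat : ℕ) : ℝ) = (((⌊x + r⌋ + 1 - ⌈x - r⌉).toNat : ℤ) : ℝ) := by rw [Int.cast_natCast]
    rw [this, Int.toNat_of_nonneg h]; push_cast; linarith
  · rw [Int.toNat_of_nonpos h]; push_cast; linarith

def zeroS (X : ℝ) : Set (Fin 4 → ℤ) := {f | f 0 = 0 ∧ 1 ≤ f 1 ∧ 0 ≤ f 2 ∧ f 2 < 2 * f 1 ∧ fdisc f ≠ 0 ∧ |((fdisc f : ℤ) : ℝ)| ≤ X}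

lemma zeroS_bound {X : ℝ} (hX : 0 ≤ X) : (zeroS X).Finite ∧ ((zeroS X).ncard : ℝ) ≤ 4 * X := by
  classical
  set N := ⌊√X⌋₊ with hN
  let I : ℕ → ℕ → Finset ℤ := fun b c => Finset.Icc ⌈(3 * (c : ℝ) ^ 2 / (4 * b)) - X / (4 * b ^ 3)⌉ ⌊(3 * (c : ℝ) ^ 2 / (4 * b)) + X / (4 * b ^ 3)⌋
  let S : Finset (Fin 4 → ℤ) := (Finset.Ioo 0 (N + 1)).biUnion fun b => (Finset.range (2 * b)).biUnion fun c =>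
    (I b c).image fun d => (![0, (b : ℤ), (c : ℤ), d] : Fin 4 → ℤ)
  have hsub : zeroS X ⊆ S := by
    rintro f ⟨h0, h1, h2, h3, h4, h5⟩
    obtain ⟨b, hb⟩ := Int.eq_ofNat_of_zero_le (show 0 ≤ f 1 by linarith)
    obtain ⟨c, hc⟩ := Int.eq_ofNat_of_zero_le h2
    have hb1 : 1 ≤ b := by rw [hb] at h1; exact_mod_cast h1
    have hbR : (1 : ℝ) ≤ b := by exact_mod_cast hb1
    rw [fdisc_zero h0] at h4 h5
    have hm : 4 * f 1 * f 3 - 3 * f 2 ^ 2 ≠ 0 := fun h => h4 (by rw [h, mul_zero])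
    have hm1 : (1 : ℝ) ≤ |((4 * f 1 * f 3 - 3 * f 2 ^ 2 : ℤ) : ℝ)| := by exact_mod_cast Int.one_le_abs hm
    simp only [S, Finset.coe_biUnion, Set.mem_iUnion, Finset.mem_coe, Finset.mem_image]
    rw [Int.cast_mul, abs_mul] at h5
    have hb2 : |((f 1 ^ 2 : ℤ) : ℝ)| = (b : ℝ) ^ 2 := by rw [hb]; push_cast; rw [abs_of_nonneg (by positivity)]
    rw [hb2] at h5
    refine ⟨b, ?_, c, ?_, f 3, ?_, ?_⟩
    · rw [Finset.mem_Ioo]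
      refine ⟨hb1, ?_⟩
      rw [Nat.lt_succ_iff, hN, Nat.le_floor_iff (Real.sqrt_nonneg X)]
      apply Real.le_sqrt_of_sq_le
      nlinarith [sq_nonneg (b : ℝ)]
    · rw [Finset.mem_range]
      rw [hb, hc] at h3; exact_mod_cast h3
    · simp only [I, Finset.mem_Icc, Int.ceil_le, Int.le_floor]
      rw [hb, hc] at h5; push_cast at h5
      have h6 : |(f 3 : ℝ) - 3 * (c : ℝ) ^ 2 / (4 * b)| ≤ X / (4 * b ^ 3) := by
        rw [le_div_iff₀ (by positivity)]
        calc |(f 3 : ℝ) - 3 * (c : ℝ) ^ 2 / (4 * b)| * (4 * (b:ℝ) ^ 3) =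
            |((f 3 : ℝ) - 3 * (c : ℝ) ^ 2 / (4 * b)) * (4 * (b:ℝ) ^ 3)| := by
              rw [abs_mul, abs_of_nonneg (show (0:ℝ) ≤ 4 * b ^ 3 by positivity)]
          _ = |(b : ℝ) ^ 2 * (4 * (b:ℝ) * f 3 - 3 * (c:ℝ) ^ 2)| := by congr 1; field_simp
          _ = (b:ℝ) ^ 2 * |4 * (b:ℝ) * f 3 - 3 * (c : ℝ) ^ 2| := by rw [abs_mul, abs_of_nonneg (show (0:ℝ) ≤ b ^ 2 by positivity)]
          _ ≤ X := h5
      rw [abs_le] at h6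
      constructor <;> linarith
    · exact ext4 h0.symm hb.symm hc.symm rfl
  refine ⟨S.finite_toSet.subset hsub, ?_⟩
  have h1 : (zeroS X).ncard ≤ S.card := by
    rw [← Set.ncard_coe_finset]; exact Set.ncard_le_ncard hsub S.finite_toSet
  have h2 : (S.card : ℝ) ≤ ∑ b ∈ Finset.Ioo 0 (N + 1), ∑ c ∈ Finset.range (2 * b), ((I b c).card : ℝ) := by
    have : S.card ≤ ∑ b ∈ Finset.Ioo 0 (N + 1), ∑ c ∈ Finset.range (2 * b), (I b c).card := by
      refine Finset.card_biUnion_le.trans (Finset.sum_le_sum fun b _ => ?_)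
      exact Finset.card_biUnion_le.trans (Finset.sum_le_sum fun c _ => Finset.card_image_le)
    exact_mod_cast this
  have h3 : ∀ b ∈ Finset.Ioo 0 (N + 1), ∑ c ∈ Finset.range (2 * b), ((I b c).card : ℝ) ≤ X * ((b : ℝ) ^ 2)⁻¹ + 2 * N := by
    intro b hb
    rw [Finset.mem_Ioo] at hb
    have hb0 : (0 : ℝ) < b := by exact_mod_cast hb.1
    have hbN : (b : ℝ) ≤ N := by exact_mod_cast Nat.lt_succ_iff.1 hb.2
    calc _ ≤ ∑ c ∈ Finset.range (2 * b), (2 * (X / (4 * (b : ℝ) ^ 3)) + 1) :=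
          Finset.sum_le_sum fun c _ => int_ivl _ _ (by positivity)
      _ = X * ((b : ℝ) ^ 2)⁻¹ + 2 * b := by
          rw [Finset.sum_const, Finset.card_range, nsmul_eq_mul]; push_cast; field_simp; ring
      _ ≤ _ := by linarith
  have h4 := Finset.sum_le_sum h3
  rw [Finset.sum_add_distrib, ← Finset.mul_sum, Finset.sum_const, Nat.card_Ioo] at h4
  have h5 := sum_Ioo_inv_sq_le (α := ℝ) 0 (N + 1)
  have h6 : (N : ℝ) ≤ √X := Nat.floor_le (Real.sqrt_nonneg X)
  have h7 : (N : ℝ) ^ 2 ≤ X := by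
    rw [← Real.sq_sqrt hX]; gcongr
  have h8 : ((zeroS X).ncard : ℝ) ≤ S.card := by exact_mod_cast h1
  have h9 : X * ∑ i ∈ Finset.Ioo 0 (N + 1), ((i : ℝ) ^ 2)⁻¹ ≤ X * 2 := by
    gcongr
    simpa using h5
  simp at h4
  linarith

/-- all orbits of given sign and bounded discriminant -/
def Ob (e X : ℝ) : Set Orb := toOrb '' {f | 0 < e * ((fdisc f : ℤ) : ℝ) ∧ |((fdisc f : ℤ) : ℝ)| ≤ X}

lemma zero_rep {f : Fin 4 → ℤ} (h0 : f 0 = 0) (hD : fdisc f ≠ 0) :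
    ∃ f', toOrb f' = toOrb f ∧ f' 0 = 0 ∧ 1 ≤ f' 1 ∧ 0 ≤ f' 2 ∧ f' 2 < 2 * f' 1 := by
  have key : ∀ f : Fin 4 → ℤ, f 0 = 0 → 0 < f 1 → ∃ f', toOrb f' = toOrb f ∧ f' 0 = 0 ∧ 1 ≤ f' 1 ∧ 0 ≤ f' 2 ∧ f' 2 < 2 * f' 1 := by
    intro f h0 h1
    refine ⟨gact (trM (-(f 2 / (2 * f 1)))) f, toOrb_gact _ _, ?_⟩
    have e := Int.emod_add_mul_ediv (f 2) (2 * f 1)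
    have e1 := Int.emod_nonneg (f 2) (show 2 * f 1 ≠ 0 by omega)
    have e2 := Int.emod_lt_of_pos (f 2) (show 0 < 2 * f 1 by omega)
    rw [gact_trM]
    simp only [act_0, act_1, act_2, h0]
    generalize f 2 / (2 * f 1) = k at *
    refine ⟨by ring, by linarith, by nlinarith, by nlinarith⟩
  have hb : f 1 ≠ 0 := by
    intro h; apply hD; rw [fdisc_zero h0, h]; ring
  rcases lt_or_gt_of_ne hb with h | h
  · obtain ⟨f', h1, h2⟩ := key (-f) (by simp [h0]) (by simpa using h)
    refine ⟨f', h1.trans ?_, h2⟩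
    have := toOrb_gact (-1) f
    rwa [gact_neg, gact_one] at this
  · exact key f h0 h

section
variable {σ e : ℝ} (hs : Sg σ e)
include hs

lemma T_bound {u v p q X : ℝ} {f : Fin 4 → ℤ} (h : toR f = Psi σ e u v p q) (hv : 0 < v) (hX : 0 ≤ X) :
    |((fdisc f : ℤ) : ℝ)| ≤ X ↔ v ^ 3 * (p ^ 2 + q ^ 2) ≤ √(X / (4 * |e| ^ 3)) := by
  have he : 0 < |e| := abs_pos.2 (e_ne hs)
  have h1 : |((fdisc f : ℤ) : ℝ)| = 4 * |e| ^ 3 * (v ^ 3 * (p ^ 2 + q ^ 2)) ^ 2 := by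
    rw [← fdisc_toR, h, fdisc_Psi hs, abs_mul, abs_mul, abs_pow, abs_pow (v ^ 3 * _), sq_abs]
    norm_num
  have h2 : 0 ≤ v ^ 3 * (p ^ 2 + q ^ 2) := by positivity
  rw [h1, Real.le_sqrt h2, le_div_iff₀ (by positivity)]
  · constructor <;> intro h <;> linarith
  · positivity

lemma Ob_sub (X : ℝ) : Ob e X ⊆ toOrb '' (redS σ e (4 / 5) √(X / (4 * |e| ^ 3))) ∪ toOrb '' zeroS X := by
  rintro _ ⟨f, ⟨h1, h2⟩, rfl⟩
  obtain ⟨g, u, v, p, q, h, a1, a2, a3⟩ := red_exists hs f h1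
  by_cases h0 : gact g f 0 = 0
  · right
    have hD : fdisc (gact g f) ≠ 0 := by
      rw [fdisc_gact]; rintro h; rw [h] at h1; simp at h1
    obtain ⟨f', hf', b⟩ := zero_rep h0 hD
    refine ⟨f', ⟨b.1, b.2.1, b.2.2.1, b.2.2.2, ?_, ?_⟩, ?_⟩
    · rwa [fdisc_of_toOrb hf']
    · rwa [fdisc_of_toOrb hf', fdisc_gact]
    · rw [hf', toOrb_gact]
  · left
    refine ⟨gact g f, ⟨h0, u, v, p, q, h, a1, a2, a3, ?_, ?_⟩, toOrb_gact _ _⟩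
    · have : u ^ 2 ≤ 1 / 4 := by rw [← sq_abs]; nlinarith [abs_nonneg u]
      nlinarith
    · rw [← T_bound hs h a3 ((abs_nonneg _).trans h2), fdisc_gact]; exact h2

lemma Ob_bound {X : ℝ} (hX : 0 ≤ X) : (Ob e X).Finite ∧ ((Ob e X).ncard : ℝ) ≤ 10 ^ 8 * X := by
  obtain ⟨a1, a2⟩ := red_bound hs (V := 4 / 5) (T := √(X / (4 * |e| ^ 3))) le_rfl
  obtain ⟨b1, b2⟩ := zeroS_bound hX
  have hfin := (a1.image toOrb).union (b1.image toOrb)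
  refine ⟨hfin.subset (Ob_sub hs X), ?_⟩
  have h1 := (Set.ncard_le_ncard (Ob_sub hs X) hfin).trans (Set.ncard_union_le _ _)
  have h2 := h1.trans (add_le_add (Set.ncard_image_le a1) (Set.ncard_image_le b1))
  have h3 : ((Ob e X).ncard : ℝ) ≤ (redS σ e (4 / 5) √(X / (4 * |e| ^ 3))).ncard + (zeroS X).ncard := by exact_mod_cast h2
  have he : 0 < |e| := abs_pos.2 (e_ne hs)
  rw [Real.sq_sqrt (by positivity)] at a2
  have h4 : X / (4 * |e| ^ 3) ≤ 27 / 4 * X := by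
    rcases hs.h with ⟨-, rfl⟩ | ⟨-, rfl⟩
    · norm_num; linarith
    · norm_num [abs_of_pos]; linarith
  have h5 : 8000000 * (X / (4 * |e| ^ 3)) / (4 / 5) ≤ 8000000 * (27 / 4 * X) / (4 / 5) := by gcongr
  linarith
end

end DH

namespace DH
set_option linter.unusedSectionVars false
open Filter Topology Matrix MatrixGroups

lemma cong_card (N p : ℕ) (hp : 0 < p) (s : Finset ℤ) (hI : ∀ x ∈ s, |x| ≤ N)
    (hc : ∀ x ∈ s, ∀ y ∈ s, (p : ℤ) ∣ x - y) : s.card ≤ 2 * N / p + 1 := by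
  rw [← Finset.card_range (2 * N / p + 1)]
  refine Finset.card_le_card_of_injOn (fun x => ((x + N) / (p : ℤ)).toNat) ?_ ?_
  · intro x hx
    have h1 := abs_le.1 (hI x hx)
    rw [Finset.mem_coe, Finset.mem_range, Nat.lt_succ_iff]
    have h2 : (x + N) / (p : ℤ) ≤ (2 * N) / (p : ℤ) := Int.ediv_le_ediv (by exact_mod_cast hp) (by linarith)
    have h3 : ((2 * N / p : ℕ) : ℤ) = (2 * N) / (p : ℤ) := by push_cast; rfl
    have h4 : 0 ≤ (x + N) / (p : ℤ) := Int.ediv_nonneg (by linarith) (by positivity)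
    simp only
    omega
  · intro x hx y hy hxy
    have h1 := abs_le.1 (hI x hx)
    have h1' := abs_le.1 (hI y hy)
    have h4 : 0 ≤ (x + N) / (p : ℤ) := Int.ediv_nonneg (by linarith) (by positivity)
    have h4' : 0 ≤ (y + N) / (p : ℤ) := Int.ediv_nonneg (by linarith) (by positivity)
    have h5 : (x + N) / (p : ℤ) = (y + N) / (p : ℤ) := by simp only at hxy; omega
    have h6 : (x + N) % (p : ℤ) = (y + N) % (p : ℤ) := by
      apply Int.ModEq.symm
      rw [Int.modEq_iff_dvd]
      have := hc x hx y hy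
      convert this using 1; ring
    have h7 := Int.mul_ediv_add_emod (x + N) p
    have h8 := Int.mul_ediv_add_emod (y + N) p
    rw [h5, h6] at h7
    linarith

lemma fib_card {α β : Type*} [DecidableEq α] [DecidableEq β] (N p : ℕ) (hp : 0 < p) (s : Finset α) (g : α → β) (h : α → ℤ)
    (hi : ∀ x ∈ s, ∀ y ∈ s, g x = g y → h x = h y → x = y) (hI : ∀ x ∈ s, |h x| ≤ N)
    (hc : ∀ x ∈ s, ∀ y ∈ s, g x = g y → (p : ℤ) ∣ h x - h y) :
    s.card ≤ (2 * N / p + 1) * (s.image g).card := by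
  refine Finset.card_le_mul_card_image _ _ ?_
  intro b _
  rw [← Finset.card_image_of_injOn (s := s.filter (fun a => g a = b)) (f := h)]
  · refine cong_card N p hp _ ?_ ?_
    · intro x hx
      rw [Finset.mem_image] at hx
      obtain ⟨a, ha, rfl⟩ := hx
      exact hI a (Finset.mem_filter.1 ha).1
    · intro x hx y hy
      rw [Finset.mem_image] at hx hy
      obtain ⟨a, ha, rfl⟩ := hx
      obtain ⟨a', ha', rfl⟩ := hy
      rw [Finset.mem_filter] at ha ha'
      exact hc a ha.1 a' ha'.1 (ha.2.trans ha'.2.symm)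
  · intro x hx y hy hxy
    rw [Finset.mem_coe, Finset.mem_filter] at hx hy
    exact hi x hx.1 y hy.1 (hx.2.trans hy.2.symm) hxy

noncomputable def IN (N : ℕ) : Finset ℤ := Finset.Icc (-(N : ℤ)) N
lemma mem_IN {N : ℕ} {x : ℤ} : x ∈ IN N ↔ |x| ≤ N := by rw [IN, Finset.mem_Icc, abs_le]
lemma card_IN (N : ℕ) : (IN N).card = 2 * N + 1 := by rw [IN, Int.card_Icc]; omega

def hdv (p : ℕ) (f : Fin 4 → ℤ) : Prop := (p : ℤ) ∣ hA f ∧ (p : ℤ) ∣ hB f ∧ (p : ℤ) ∣ hC f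

def p3 (f : Fin 4 → ℤ) : ℤ × ℤ × ℤ := (f 0, f 1, f 2)
lemma p3_inj {f g : Fin 4 → ℤ} (h : p3 f = p3 g) (h3 : f 3 = g 3) : f = g := by
  simp only [p3, Prod.mk.injEq] at h
  exact ext4 h.1 h.2.1 h.2.2 h3

lemma d_cong {p : ℕ} (hp : p.Prime) {f g : Fin 4 → ℤ} (ha : ¬ (p : ℤ) ∣ f 0) (hf : hdv p f) (hg : hdv p g)
    (h : p3 f = p3 g) : (p : ℤ) ∣ f 3 - g 3 := by
  have hpZ : Prime (p : ℤ) := Nat.prime_iff_prime_int.1 hp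
  simp only [p3, Prod.mk.injEq] at h
  have : (p : ℤ) ∣ f 0 * (f 3 - g 3) := by
    have e : f 0 * (f 3 - g 3) = hB f - hB g := by simp only [hB, h.1, h.2.1, h.2.2]; ring
    rw [e]; exact dvd_sub hf.2.1 hg.2.1
  exact (hpZ.dvd_or_dvd this).resolve_left ha

/-- primes `≤ N` -/
lemma small_p {N p : ℕ} (hp : p.Prime) (s : Finset (Fin 4 → ℤ)) (hs : ∀ f ∈ s, (∀ i, |f i| ≤ N) ∧ hdv p f) :
    s.card ≤ (2 * N / p + 1) ^ 2 * (2 * N + 1) ^ 2 + (2 * N / p + 1) ^ 3 * (2 * N + 1) := by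
  classical
  have hpZ : Prime (p : ℤ) := Nat.prime_iff_prime_int.1 hp
  rw [← Finset.card_filter_add_card_filter_not (s := s) (fun f => ¬ (p : ℤ) ∣ f 0)]
  refine Nat.add_le_add ?_ ?_
  · set t := s.filter (fun f => ¬ (p : ℤ) ∣ f 0)
    have ht : ∀ f ∈ t, (∀ i, |f i| ≤ N) ∧ hdv p f ∧ ¬ (p : ℤ) ∣ f 0 := by
      intro f hf
      rw [Finset.mem_filter] at hf
      exact ⟨(hs f hf.1).1, (hs f hf.1).2, hf.2⟩
    have h1 := fib_card N p hp.pos t p3 (fun f => f 3) (fun x _ y _ h h' => p3_inj h h') (fun x hx => (ht x hx).1 3)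
      (fun x hx y hy h => d_cong hp (ht x hx).2.2 (ht x hx).2.1 (ht y hy).2.1 h)
    have h2 := fib_card N p hp.pos (t.image p3) (fun x => (x.1, x.2.1)) (fun x => x.2.2)
      (fun x _ y _ h h' => by
        simp only [Prod.mk.injEq] at h; exact Prod.ext h.1 (Prod.ext h.2 h'))
      (fun x hx => by
        rw [Finset.mem_image] at hx
        obtain ⟨f, hf, rfl⟩ := hx
        exact (ht f hf).1 2)
      (fun x hx y hy h => by
        rw [Finset.mem_image] at hx hy
        obtain ⟨f, hf, rfl⟩ := hx
        obtain ⟨g, hg, rfl⟩ := hy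
        simp only [p3, Prod.mk.injEq] at h ⊢
        have : (p : ℤ) ∣ f 0 * (f 2 - g 2) := by
          have e : f 0 * (f 2 - g 2) = hA g - hA f := by simp only [hA, h.1, h.2]; ring
          rw [e]; exact dvd_sub (ht g hg).2.1.1 (ht f hf).2.1.1
        exact (hpZ.dvd_or_dvd this).resolve_left (ht f hf).2.2)
    have h3 : ((t.image p3).image (fun x => (x.1, x.2.1))).card ≤ (IN N ×ˢ IN N).card := by
      refine Finset.card_le_card ?_
      intro x hx
      rw [Finset.mem_image] at hx
      obtain ⟨y, hy, rfl⟩ := hx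
      rw [Finset.mem_image] at hy
      obtain ⟨f, hf, rfl⟩ := hy
      rw [Finset.mem_product, mem_IN, mem_IN]
      exact ⟨(ht f hf).1 0, (ht f hf).1 1⟩
    rw [Finset.card_product, card_IN] at h3
    calc t.card ≤ (2 * N / p + 1) * (t.image p3).card := h1
      _ ≤ (2 * N / p + 1) * ((2 * N / p + 1) * ((2 * N + 1) * (2 * N + 1))) := by
        refine Nat.mul_le_mul_left _ (h2.trans (Nat.mul_le_mul_left _ h3))
      _ = _ := by ring
  · set Z := (IN N).filter (fun x => (p : ℤ) ∣ x)
    have hZ : Z.card ≤ 2 * N / p + 1 := by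
      refine cong_card N p hp.pos _ ?_ ?_
      · intro x hx; exact mem_IN.1 (Finset.mem_filter.1 hx).1
      · intro x hx y hy; exact dvd_sub (Finset.mem_filter.1 hx).2 (Finset.mem_filter.1 hy).2
    calc _ ≤ (Z ×ˢ Z ×ˢ Z ×ˢ IN N).card := by
          refine Finset.card_le_card_of_injOn (fun f => (f 0, f 1, f 2, f 3)) ?_ ?_
          · intro f hf
            rw [Finset.mem_coe, Finset.mem_filter, not_not] at hf
            obtain ⟨h1, h2, h3, h4⟩ := hs f hf.1
            have hb : (p : ℤ) ∣ f 1 := by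
              apply hpZ.dvd_of_dvd_pow (n := 2)
              have e : f 1 ^ 2 = hA f + f 0 * f 2 := by simp only [hA]; ring
              rw [e]; exact dvd_add h2 (hf.2.mul_right _)
            have hc : (p : ℤ) ∣ f 2 := by
              apply hpZ.dvd_of_dvd_pow (n := 2)
              have e : f 2 ^ 2 = hC f + f 1 * f 3 := by simp only [hC]; ring
              rw [e]; exact dvd_add h4 (hb.mul_right _)
            simp only [Finset.mem_coe, Finset.mem_product, Z, Finset.mem_filter, mem_IN]
            exact ⟨⟨h1 0, hf.2⟩, ⟨h1 1, hb⟩, ⟨h1 2, hc⟩, h1 3⟩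
          · intro f _ g _ h
            simp only [Prod.mk.injEq] at h
            exact ext4 h.1 h.2.1 h.2.2.1 h.2.2.2
      _ = Z.card ^ 3 * (2 * N + 1) := by simp only [Finset.card_product, card_IN]; ring
      _ ≤ _ := by gcongr

lemma large_p {N : ℕ} (s : Finset (Fin 4 → ℤ)) (hs : ∀ f ∈ s, (∀ i, |f i| ≤ N) ∧ f 0 ≠ 0 ∧ ∃ p : ℕ, p.Prime ∧ N < p ∧ hdv p f) :
    s.card ≤ 5 * (2 * N + 1) ^ 3 := by
  classical
  rw [← Finset.card_filter_add_card_filter_not (s := s) (fun f => hA f = 0)]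
  have hT : (IN N ×ˢ IN N ×ˢ IN N).card = (2 * N + 1) ^ 3 := by
    simp only [Finset.card_product, card_IN]; ring
  have h1 : (s.filter (fun f => hA f = 0)).card ≤ (2 * N + 1) ^ 3 := by
    rw [← hT]
    refine Finset.card_le_card_of_injOn (fun f => (f 0, f 1, f 3)) ?_ ?_
    · intro f hf
      rw [Finset.mem_coe, Finset.mem_filter] at hf
      have := (hs f hf.1).1
      simp only [Finset.mem_coe, Finset.mem_product, mem_IN]
      exact ⟨this 0, this 1, this 3⟩
    · intro f hf g hg h
      rw [Finset.mem_coe, Finset.mem_filter] at hf hg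
      simp only [Prod.mk.injEq] at h
      refine ext4 h.1 h.2.1 ?_ h.2.2
      apply mul_left_cancel₀ (hs f hf.1).2.1
      have e1 := hf.2
      have e2 := hg.2
      simp only [hA] at e1 e2
      rw [h.1, h.2.1] at e1
      rw [h.1]; linarith
  have h2 : (s.filter (fun f => ¬ hA f = 0)).card ≤ 4 * (2 * N + 1) ^ 3 := by
    set t := s.filter (fun f => ¬ hA f = 0)
    have h3 : t.card ≤ 4 * (t.image p3).card := by
      refine Finset.card_le_mul_card_image _ _ ?_
      intro x hx
      rw [Finset.mem_image] at hx
      obtain ⟨f0, hf0, rfl⟩ := hx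
      have hf0' := Finset.mem_filter.1 hf0
      have hb0 := (hs f0 hf0'.1).1
      set P := (hA f0).natAbs.primeFactors.filter (fun p => N < p)
      have hN1 : 1 ≤ N := by
        have h1 := Int.one_le_abs (hs f0 hf0'.1).2.1
        have h2 := hb0 0
        omega
      have hP : P.card ≤ 2 := by
        by_contra hcon
        push Not at hcon
        have e1 : (N + 1) ^ P.card ≤ ∏ p ∈ P, p := by
          refine Finset.pow_card_le_prod _ _ _ ?_
          intro p hp; exact (Finset.mem_filter.1 hp).2
        have e2 : ∏ p ∈ P, p ≤ ∏ p ∈ (hA f0).natAbs.primeFactors, p := by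
          refine Finset.prod_le_prod_of_subset_of_one_le' (Finset.filter_subset _ _) ?_
          intro p hp _; exact (Nat.prime_of_mem_primeFactors hp).one_le
        have e3 : ∏ p ∈ (hA f0).natAbs.primeFactors, p ≤ (hA f0).natAbs :=
          Nat.le_of_dvd (Int.natAbs_pos.2 hf0'.2) (Nat.prod_primeFactors_dvd _)
        have e4 : (N + 1) ^ 3 ≤ (N + 1) ^ P.card := Nat.pow_le_pow_right (by omega) hcon
        have e5 : |hA f0| ≤ 2 * (N : ℤ) ^ 2 := by
          have a1 : |f0 1 ^ 2| ≤ (N : ℤ) ^ 2 := by rw [abs_pow]; exact pow_le_pow_left₀ (abs_nonneg _) (hb0 1) 2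
          have a2 : |f0 0 * f0 2| ≤ (N : ℤ) * N := by
            rw [abs_mul]; exact mul_le_mul (hb0 0) (hb0 2) (abs_nonneg _) (by positivity)
          have a3 : |f0 1 ^ 2 - f0 0 * f0 2| ≤ _ := abs_sub _ _
          simp only [hA]; linarith
        have e6 : (hA f0).natAbs ≤ 2 * N ^ 2 := by
          zify; exact e5
        nlinarith [e1.trans (e2.trans (e3.trans e6))]
      have hsub : t.filter (fun f => p3 f = p3 f0) ⊆ P.biUnion (fun p => t.filter (fun f => p3 f = p3 f0 ∧ hdv p f)) := by
        intro f hf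
        rw [Finset.mem_filter] at hf
        have hf' := Finset.mem_filter.1 hf.1
        obtain ⟨-, -, p, hp, hNp, hd⟩ := hs f hf'.1
        have hAA : hA f = hA f0 := by
          have := hf.2
          simp only [p3, Prod.mk.injEq] at this
          simp only [hA, this.1, this.2.1, this.2.2]
        rw [Finset.mem_biUnion]
        refine ⟨p, Finset.mem_filter.2 ⟨?_, hNp⟩, Finset.mem_filter.2 ⟨hf.1, hf.2, hd⟩⟩
        rw [Nat.mem_primeFactors]
        refine ⟨hp, ?_, Int.natAbs_ne_zero.2 hf0'.2⟩
        rw [← hAA]; exact Int.natCast_dvd.1 hd.1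
      refine (Finset.card_le_card hsub).trans ((Finset.card_biUnion_le_card_mul _ _ 2 ?_).trans (by omega))
      intro p hp
      have hpp : p.Prime := Nat.prime_of_mem_primeFactors (Finset.mem_filter.1 hp).1
      have hNp : N < p := (Finset.mem_filter.1 hp).2
      have hq : 2 * N / p + 1 ≤ 2 := by
        have : 2 * N / p < 2 := by rw [Nat.div_lt_iff_lt_mul hpp.pos]; omega
        omega
      have hmem : ∀ x ∈ t.filter (fun f => p3 f = p3 f0 ∧ hdv p f), (∀ i, |x i| ≤ N) ∧ p3 x = p3 f0 ∧ hdv p x := by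
        intro x hx
        rw [Finset.mem_filter, Finset.mem_filter] at hx
        exact ⟨(hs x hx.1.1).1, hx.2.1, hx.2.2⟩
      have hna : ¬ (p : ℤ) ∣ f0 0 := by
        intro h
        have h1 := Int.le_of_dvd (abs_pos.2 (hs f0 hf0'.1).2.1) ((dvd_abs _ _).2 h)
        have h2 := hb0 0
        omega
      have := fib_card N p hpp.pos (t.filter (fun f => p3 f = p3 f0 ∧ hdv p f)) p3 (fun f => f 3)
        (fun x _ y _ h h' => p3_inj h h') (fun x hx => (hmem x hx).1 3)
        (fun x hx y hy h => d_cong hpp (by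
          have := (hmem x hx).2.1
          simp only [p3, Prod.mk.injEq] at this
          rw [this.1]; exact hna) (hmem x hx).2.2 (hmem y hy).2.2 h)
      have hone : ((t.filter (fun f => p3 f = p3 f0 ∧ hdv p f)).image p3).card ≤ 1 := by
        rw [Finset.card_le_one]
        intro a ha b hb
        rw [Finset.mem_image] at ha hb
        obtain ⟨x, hx, rfl⟩ := ha
        obtain ⟨y, hy, rfl⟩ := hb
        exact (hmem x hx).2.1.trans (hmem y hy).2.1.symm
      calc _ ≤ _ := this
        _ ≤ 2 * 1 := Nat.mul_le_mul hq hone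
        _ = 2 := by norm_num
    refine h3.trans (Nat.mul_le_mul_left _ ?_)
    rw [← hT]
    refine Finset.card_le_card ?_
    intro x hx
    rw [Finset.mem_image] at hx
    obtain ⟨f, hf, rfl⟩ := hx
    have := (hs f (Finset.mem_filter.1 hf).1).1
    simp only [Finset.mem_product, mem_IN]
    exact ⟨this 0, this 1, this 2⟩
  omega

/-- Type 1 estimate. -/
lemma ty1_bound {N M : ℕ} (hN : 1 ≤ N) (hM : 1 ≤ M) (s : Finset (Fin 4 → ℤ))
    (hs : ∀ f ∈ s, (∀ i, |f i| ≤ N) ∧ f 0 ≠ 0 ∧ ∃ p : ℕ, p.Prime ∧ M ≤ p ∧ hdv p f) :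
    (s.card : ℝ) ≤ 324 * N ^ 4 / M + 135 * N ^ 3 := by
  classical
  have hNr : (1 : ℝ) ≤ N := by exact_mod_cast hN
  set Q := (Finset.Ioo (M - 1) (N + 1)).filter Nat.Prime
  have hsub : s ⊆ Q.biUnion (fun p => s.filter (hdv p)) ∪ s.filter (fun f => ∃ p : ℕ, p.Prime ∧ N < p ∧ hdv p f) := by
    intro f hf
    obtain ⟨-, -, p, hp, hMp, hd⟩ := hs f hf
    rw [Finset.mem_union]
    by_cases hNp : N < p
    · right; exact Finset.mem_filter.2 ⟨hf, p, hp, hNp, hd⟩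
    · left
      rw [Finset.mem_biUnion]
      exact ⟨p, Finset.mem_filter.2 ⟨Finset.mem_Ioo.2 ⟨by omega, by omega⟩, hp⟩, Finset.mem_filter.2 ⟨hf, hd⟩⟩
  have h1 : (s.card : ℝ) ≤ ∑ p ∈ Q, ((s.filter (hdv p)).card : ℝ) + ((s.filter (fun f => ∃ p : ℕ, p.Prime ∧ N < p ∧ hdv p f)).card : ℝ) := by
    have := (Finset.card_le_card hsub).trans ((Finset.card_union_le _ _).trans (Nat.add_le_add_right Finset.card_biUnion_le _))
    exact_mod_cast this
  have h2 : ((s.filter (fun f => ∃ p : ℕ, p.Prime ∧ N < p ∧ hdv p f)).card : ℝ) ≤ 135 * N ^ 3 := by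
    have := large_p (N := N) (s.filter (fun f => ∃ p : ℕ, p.Prime ∧ N < p ∧ hdv p f)) (by
      intro f hf
      rw [Finset.mem_filter] at hf
      exact ⟨(hs f hf.1).1, (hs f hf.1).2.1, hf.2⟩)
    have h' : ((s.filter (fun f => ∃ p : ℕ, p.Prime ∧ N < p ∧ hdv p f)).card : ℝ) ≤ 5 * (2 * N + 1) ^ 3 := by exact_mod_cast this
    have : (2 * (N : ℝ) + 1) ^ 3 ≤ (3 * N) ^ 3 := by gcongr; linarith
    nlinarith
  have h3 : ∀ p ∈ Q, ((s.filter (hdv p)).card : ℝ) ≤ 162 * N ^ 4 * ((p : ℝ) ^ 2)⁻¹ := by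
    intro p hp
    rw [Finset.mem_filter, Finset.mem_Ioo] at hp
    have hp0 : (0 : ℝ) < p := by exact_mod_cast hp.2.pos
    have hp1 : (1 : ℝ) ≤ p := by exact_mod_cast hp.2.one_le
    have := small_p (N := N) hp.2 (s.filter (hdv p)) (by
      intro f hf
      rw [Finset.mem_filter] at hf
      exact ⟨(hs f hf.1).1, hf.2⟩)
    have h' : ((s.filter (hdv p)).card : ℝ) ≤ ((2 * N / p : ℕ) + 1) ^ 2 * (2 * N + 1) ^ 2 + ((2 * N / p : ℕ) + 1) ^ 3 * (2 * N + 1) := by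
      exact_mod_cast this
    have hw : ((2 * N / p : ℕ) : ℝ) + 1 ≤ 3 * N / p := by
      have a1 : ((2 * N / p : ℕ) : ℝ) ≤ ((2 * N : ℕ) : ℝ) / p := Nat.cast_div_le
      have a2 : (1 : ℝ) ≤ N / p := by
        rw [le_div_iff₀ hp0, one_mul]; exact_mod_cast (by omega : p ≤ N)
      push_cast at a1
      have : 3 * (N : ℝ) / p = 2 * N / p + N / p := by ring
      linarith
    have hw3 : (2 * (N : ℝ) + 1) ≤ 3 * N := by linarith
    calc _ ≤ _ := h'
      _ ≤ (3 * N / p) ^ 2 * (3 * (N : ℝ)) ^ 2 + (3 * N / p) ^ 3 * (3 * N) := by gcongr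
      _ = 81 * N ^ 4 * ((p : ℝ) ^ 2)⁻¹ + 81 * N ^ 4 * ((p : ℝ) ^ 2)⁻¹ * (p : ℝ)⁻¹ := by field_simp; ring
      _ ≤ 81 * N ^ 4 * ((p : ℝ) ^ 2)⁻¹ + 81 * N ^ 4 * ((p : ℝ) ^ 2)⁻¹ * 1 := by
        gcongr; exact inv_le_one_of_one_le₀ hp1
      _ = _ := by ring
  have h4 : ∑ p ∈ Q, ((p : ℝ) ^ 2)⁻¹ ≤ 2 / M := by
    have a1 := sum_Ioo_inv_sq_le (α := ℝ) (M - 1) (N + 1)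
    have a2 : (((M - 1 : ℕ) : ℝ) + 1) = M := by
      have : (M - 1) + 1 = M := by omega
      exact_mod_cast this
    rw [a2] at a1
    refine le_trans ?_ a1
    refine Finset.sum_le_sum_of_subset_of_nonneg (Finset.filter_subset _ _) ?_
    intros; positivity
  have h5 := Finset.sum_le_sum h3
  rw [← Finset.mul_sum] at h5
  have h6 : 162 * (N : ℝ) ^ 4 * ∑ p ∈ Q, ((p : ℝ) ^ 2)⁻¹ ≤ 162 * (N : ℝ) ^ 4 * (2 / M) := by gcongr
  have h7 : 162 * (N : ℝ) ^ 4 * (2 / M) = 324 * N ^ 4 / M := by ring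
  linarith

end DH

namespace DH
set_option linter.unusedSectionVars false
open Filter Topology Matrix MatrixGroups

def upF (p : ℤ) (f : Fin 4 → ℤ) : Fin 4 → ℤ := ![f 0, f 1, p * f 2, p ^ 2 * f 3]
def dnF (p : ℤ) (f : Fin 4 → ℤ) : Fin 4 → ℤ := ![p * f 0, f 1, f 2, f 3]

lemma fdisc_updn (p : ℤ) (f : Fin 4 → ℤ) : fdisc (upF p f) = p ^ 2 * fdisc (dnF p f) := by
  simp [fdisc, upF, dnF]; ring

lemma hess_tr (t : ℤ) (f : Fin 4 → ℤ) : hA (act 1 t 0 1 f) = hA f ∧ hB (act 1 t 0 1 f) = hB f - 2 * hA f * t ∧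
    hC (act 1 t 0 1 f) = hC f - hB f * t + hA f * t ^ 2 := by
  refine ⟨?_, ?_, ?_⟩ <;> simp only [hA, hB, hC, act_0, act_1, act_2, act_3] <;> ring

lemma hess_S (f : Fin 4 → ℤ) : hA (gact ModularGroup.S f) = hC f ∧ hB (gact ModularGroup.S f) = - hB f ∧
    hC (gact ModularGroup.S f) = hA f := by
  refine ⟨?_, ?_, ?_⟩ <;> simp [gact, ModularGroup.S, hA, hB, hC, act_0, act_1, act_2, act_3] <;> ring

lemma ty2_step0 {p : ℤ} (hp : Prime p) (h2 : ¬ p ∣ 2) {f : Fin 4 → ℤ} (hD : p ^ 2 ∣ fdisc f)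
    (hn : ¬ (p ∣ hA f ∧ p ∣ hB f ∧ p ∣ hC f)) :
    ∃ g, p ∣ hB (gact g f) ∧ p ∣ hC (gact g f) ∧ ¬ p ∣ hA (gact g f) := by
  have hpD : p ∣ hB f ^ 2 - 4 * hA f * hC f := by
    rw [← fdisc_eq]; exact (Dvd.intro_left p (by ring : p * p = p ^ 2)).trans hD
  by_cases hAp : p ∣ hA f
  · refine ⟨ModularGroup.S, ?_⟩
    obtain ⟨e1, e2, e3⟩ := hess_S f
    rw [e1, e2, e3]
    have hB' : p ∣ hB f := by
      apply hp.dvd_of_dvd_pow (n := 2)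
      have : hB f ^ 2 = (hB f ^ 2 - 4 * hA f * hC f) + hA f * (4 * hC f) := by ring
      rw [this]; exact dvd_add hpD (Dvd.dvd.mul_right hAp _)
    exact ⟨(dvd_neg).2 hB', hAp, fun h => hn ⟨hAp, hB', h⟩⟩
  · have hcop : IsCoprime p (2 * hA f) := (Prime.coprime_iff_not_dvd hp).2 fun h => (hp.dvd_or_dvd h).elim h2 hAp
    obtain ⟨x, y, hxy⟩ := hcop
    refine ⟨trM (hB f * y), ?_⟩
    rw [gact_trM]
    obtain ⟨e1, e2, e3⟩ := hess_tr (hB f * y) f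
    have hB' : p ∣ hB (act 1 (hB f * y) 0 1 f) := by
      rw [e2]
      exact ⟨hB f * x, by linear_combination (-hB f) * hxy⟩
    refine ⟨hB', ?_, by rwa [e1]⟩
    have h4 : p ∣ (2 * 2) * hA f * hC (act 1 (hB f * y) 0 1 f) := by
      have : (2 * 2) * hA f * hC (act 1 (hB f * y) 0 1 f) = hB (act 1 (hB f * y) 0 1 f) ^ 2 - (hB f ^ 2 - 4 * hA f * hC f) := by
        rw [e2, e3]; ring
      rw [this]; exact dvd_sub (Dvd.dvd.pow hB' two_ne_zero) hpD
    rcases hp.dvd_or_dvd h4 with h | h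
    · rcases hp.dvd_or_dvd h with h | h
      · exact absurd ((hp.dvd_or_dvd h).elim id id) h2
      · exact absurd h hAp
    · exact h

lemma ty2_rep {p : ℤ} (hp : Prime p) (h2 : ¬ p ∣ 2) {f : Fin 4 → ℤ} (hD : p ^ 2 ∣ fdisc f)
    (hn : ¬ (p ∣ hA f ∧ p ∣ hB f ∧ p ∣ hC f)) : ∃ F, toOrb (upF p F) = toOrb f ∧ ¬ p ∣ F 1 := by
  obtain ⟨g, hB', hC', hA'⟩ := ty2_step0 hp h2 hD hn
  have ho := toOrb_gact g f
  have hD' : p ^ 2 ∣ fdisc (gact g f) := by rwa [fdisc_gact]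
  set F := gact g f
  have hc : p ∣ F 2 := by
    have : p ∣ F 2 * hA F := by
      have : F 2 * hA F = - (F 0 * hC F + F 1 * hB F) := by simp only [hA, hB, hC]; ring
      rw [this]; exact (dvd_neg).2 (dvd_add (hC'.mul_left _) (hB'.mul_left _))
    exact (hp.dvd_or_dvd this).resolve_right hA'
  have hb : ¬ p ∣ F 1 := by
    intro h; apply hA'
    simp only [hA]; exact dvd_sub (Dvd.dvd.pow h two_ne_zero) (hc.mul_left _)
  have hC2 : p ^ 2 ∣ hC F := by
    have h1 : p ^ 2 ∣ (2 * 2 * hA F) * hC F := by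
      have : (2 * 2 * hA F) * hC F = hB F ^ 2 - fdisc F := by rw [fdisc_eq]; ring
      rw [this]; exact dvd_sub (pow_dvd_pow_of_dvd hB' 2) hD'
    refine hp.pow_dvd_of_dvd_mul_left 2 ?_ h1
    intro h
    rcases hp.dvd_or_dvd h with h | h
    · exact absurd ((hp.dvd_or_dvd h).elim id id) h2
    · exact hA' h
  have hd : p ^ 2 ∣ F 3 := by
    have h1 : p ^ 2 ∣ F 1 * F 3 := by
      have : F 1 * F 3 = F 2 ^ 2 - hC F := by simp only [hC]; ring
      rw [this]; exact dvd_sub (pow_dvd_pow_of_dvd hc 2) hC2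
    exact hp.pow_dvd_of_dvd_mul_left 2 hb h1
  obtain ⟨c, hc⟩ := hc
  obtain ⟨d, hd⟩ := hd
  refine ⟨![F 0, F 1, c, d], ?_, by simpa using hb⟩
  rw [← ho]
  congr 1
  apply ext4 <;> simp [upF, hc, hd]

/-- equal roots modulo `p` give equivalent lifts. -/
lemma up_equiv {p : ℤ} (hp : p ≠ 0) {F1 F2 : Fin 4 → ℤ} {k : SL(2, ℤ)} (h : gact k (dnF p F1) = dnF p F2)
    (hk : p ∣ k 1 0) : toOrb (upF p F1) = toOrb (upF p F2) := by
  obtain ⟨m, hm⟩ := hk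
  have hdet := sl_det k
  rw [toOrb_eq]
  refine ⟨⟨!![k 0 0, p * k 0 1; m, k 1 1], ?_⟩, ?_⟩
  · rw [Matrix.det_fin_two_of]; rw [hm] at hdet; linarith
  · have h0 := congrFun h 0
    have h1 := congrFun h 1
    have h2 := congrFun h 2
    have h3 := congrFun h 3
    simp [gact, hm, dnF] at h0 h1 h2 h3
    apply ext4
    · apply mul_left_cancel₀ hp
      simp [gact, upF]
      left
      apply mul_left_cancel₀ hp
      linear_combination h0
    · simp [gact, upF]
      linear_combination h1
    · simp [gact, upF]
      linear_combination p * h2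
    · simp [gact, upF]
      linear_combination p ^ 2 * h3

def ty2 (e : ℝ) (p : ℕ) (X : ℝ) : Set Orb := toOrb '' {f | 0 < e * ((fdisc f : ℤ) : ℝ) ∧ |((fdisc f : ℤ) : ℝ)| ≤ X ∧
  (p : ℤ) ^ 2 ∣ fdisc f ∧ ¬ ((p : ℤ) ∣ hA f ∧ (p : ℤ) ∣ hB f ∧ (p : ℤ) ∣ hC f)}

open Polynomial in
lemma ty2_bound {σ e : ℝ} (hs : Sg σ e) {p : ℕ} (hp : p.Prime) (h5 : 5 ≤ p) {X : ℝ} (hX : 0 ≤ X) :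
    ((ty2 e p X).ncard : ℝ) ≤ 4 * 10 ^ 8 * (X / p ^ 2) := by
  classical
  haveI := Fact.mk hp
  have hpZ : Prime (p : ℤ) := Nat.prime_iff_prime_int.1 hp
  have hp2 : ¬ (p : ℤ) ∣ 2 := fun h => by
    have := Int.le_of_dvd (by norm_num) h; omega
  have hp3 : (3 : ZMod p) ≠ 0 := by
    intro h
    have : ((3 : ℕ) : ZMod p) = 0 := by exact_mod_cast h
    rw [ZMod.natCast_eq_zero_iff] at this
    have := Nat.le_of_dvd (by norm_num) this; omega
  have hp0 : (0 : ℝ) < p := by exact_mod_cast hp.pos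
  have hsub : ty2 e p X ⊆ Ob e X := by
    rintro _ ⟨f, ⟨h1, h2, -⟩, rfl⟩; exact ⟨f, ⟨h1, h2⟩, rfl⟩
  have hfin : (ty2 e p X).Finite := (Ob_bound hs hX).1.subset hsub
  have hrep : ∀ o ∈ ty2 e p X, ∃ F, toOrb (upF p F) = o ∧ ¬ (p : ℤ) ∣ F 1 ∧ toOrb (dnF p F) ∈ Ob e (X / p ^ 2) := by
    rintro _ ⟨f, ⟨h1, h2, h3, h4⟩, rfl⟩
    obtain ⟨F, hF, hF1⟩ := ty2_rep hpZ hp2 h3 h4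
    refine ⟨F, hF, hF1, dnF p F, ?_, rfl⟩
    have e1 := fdisc_updn p F
    rw [fdisc_of_toOrb hF] at e1
    rw [e1] at h1 h2
    push_cast at h1 h2
    constructor
    · have : 0 < (p : ℝ) ^ 2 * (e * ((fdisc (dnF p F) : ℤ) : ℝ)) := by linarith
      exact (mul_pos_iff_of_pos_left (by positivity)).1 this
    · rw [abs_mul, abs_of_pos (show (0:ℝ) < (p : ℝ) ^ 2 by positivity)] at h2
      rw [le_div_iff₀ (by positivity)]; linarith
  choose! F hF1 hF2 hF3 using hrep
  set s := hfin.toFinset with hsdef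
  have hcard : s.card ≤ 4 * (s.image fun o => toOrb (dnF p (F o))).card := by
    refine Finset.card_le_mul_card_image _ _ ?_
    intro o' ho'
    rw [Finset.mem_image] at ho'
    obtain ⟨o0, ho0, rfl⟩ := ho'
    have ho0 : o0 ∈ ty2 e p X := hfin.mem_toFinset.1 ho0
    let P : (ZMod p)[X] := C (((dnF p (F o0) 0 : ℤ) : ZMod p)) + C (3 * ((dnF p (F o0) 1 : ℤ) : ZMod p)) * Polynomial.X +
      C (3 * ((dnF p (F o0) 2 : ℤ) : ZMod p)) * Polynomial.X ^ 2 + C ((dnF p (F o0) 3 : ℤ) : ZMod p) * Polynomial.X ^ 3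
    have hP0 : P ≠ 0 := by
      intro h
      have : P.coeff 1 = 0 := by rw [h]; simp
      simp only [P, coeff_add, coeff_C_mul, coeff_X_pow, coeff_C, coeff_X] at this
      norm_num at this
      rcases this with h | h
      · exact hp3 h
      · have : ((dnF p (F o0) 1 : ℤ) : ZMod p) = ((F o0 1 : ℤ) : ZMod p) := by simp [dnF]
        rw [this, ZMod.intCast_zmod_eq_zero_iff_dvd] at h
        exact hF2 o0 ho0 h
    have hdeg : P.natDegree ≤ 3 := by
      simp only [P]; compute_degree
    have hh : ∀ o ∈ s.filter (fun o => toOrb (dnF p (F o)) = toOrb (dnF p (F o0))),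
        ∃ h : SL(2, ℤ), gact h (dnF p (F o0)) = dnF p (F o) := by
      intro o ho
      rw [Finset.mem_filter] at ho
      exact toOrb_eq.1 ho.2.symm
    choose! h hh using hh
    let r : Orb → Option (ZMod p) := fun o => if ((h o 0 0 : ℤ) : ZMod p) = 0 then none else
      some (((h o 1 0 : ℤ) : ZMod p) / ((h o 0 0 : ℤ) : ZMod p))
    have hmaps : ∀ o ∈ s.filter (fun o => toOrb (dnF p (F o)) = toOrb (dnF p (F o0))),
        r o ∈ insert none (P.roots.toFinset.image some) := by
      intro o ho
      simp only [r]
      split_ifs with hz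
      · simp
      · refine Finset.mem_insert_of_mem (Finset.mem_image_of_mem _ ?_)
        rw [Multiset.mem_toFinset, mem_roots hP0, IsRoot.def]
        have h0 := congrFun (hh o ho) 0
        have h0' : ((gact (h o) (dnF p (F o0)) 0 : ℤ) : ZMod p) = 0 := by
          rw [h0]; simp [dnF]
        simp only [gact, act_0] at h0'
        push_cast at h0'
        simp only [P, eval_add, eval_mul, eval_C, eval_X, eval_pow]
        field_simp
        linear_combination h0'
    have hinj : Set.InjOn r (s.filter (fun o => toOrb (dnF p (F o)) = toOrb (dnF p (F o0))) : Finset Orb) := by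
      intro o ho o' ho' hr
      have ho1 := ho
      have ho1' := ho'
      rw [Finset.mem_coe, Finset.mem_filter, hfin.mem_toFinset] at ho1 ho1'
      rw [← hF1 o ho1.1, ← hF1 o' ho1'.1]
      have hk : gact ((h o)⁻¹ * h o') (dnF p (F o)) = dnF p (F o') := by
        rw [← hh o ho, ← gact_mul, mul_inv_cancel_left, hh o' ho']
      refine up_equiv (p := (p : ℤ)) (by exact_mod_cast hp.ne_zero) hk ?_
      rw [← ZMod.intCast_zmod_eq_zero_iff_dvd]
      have hval : ((h o)⁻¹ * h o') 1 0 = - h o 1 0 * h o' 0 0 + h o 0 0 * h o' 1 0 := by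
        have hinv : (h o)⁻¹ 1 0 = -h o 1 0 ∧ (h o)⁻¹ 1 1 = h o 0 0 := by
          rw [Matrix.SpecialLinearGroup.SL2_inv_expl]
          exact ⟨rfl, rfl⟩
        change ((h o)⁻¹.1 * (h o').1) 1 0 = _
        rw [Matrix.mul_apply, Fin.sum_univ_two]
        rw [← hinv.1, ← hinv.2]
      rw [hval]; push_cast
      simp only [r] at hr
      split_ifs at hr with z1 z2 z2
      · rw [z1, z2]; ring
      · rw [Option.some_inj, div_eq_div_iff z1 z2] at hr
        linear_combination -hr
    calc _ ≤ (insert none (P.roots.toFinset.image some)).card := Finset.card_le_card_of_injOn r hmaps hinj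
      _ ≤ (P.roots.toFinset.image some).card + 1 := Finset.card_insert_le _ _
      _ ≤ 3 + 1 := by
        gcongr
        exact Finset.card_image_le.trans ((Multiset.toFinset_card_le _).trans ((card_roots' P).trans hdeg))
  obtain ⟨o1, o2⟩ := Ob_bound hs (X := X / p ^ 2) (by positivity)
  have himg : ((s.image fun o => toOrb (dnF p (F o))).card) ≤ (Ob e (X / p ^ 2)).ncard := by
    rw [← Set.ncard_coe_finset]
    refine Set.ncard_le_ncard ?_ o1
    intro o ho
    rw [Finset.mem_coe, Finset.mem_image] at ho
    obtain ⟨o', ho', rfl⟩ := ho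
    exact hF3 o' (hfin.mem_toFinset.1 ho')
  rw [Set.ncard_eq_toFinset_card _ hfin]
  have h1 : (s.card : ℝ) ≤ 4 * (Ob e (X / p ^ 2)).ncard := by
    have h2 := hcard.trans (Nat.mul_le_mul_left 4 himg)
    have h3 : (s.card : ℝ) ≤ ((4 * (Ob e (X / (p : ℝ) ^ 2)).ncard : ℕ) : ℝ) := Nat.cast_le.2 h2
    simpa using h3
  linarith

end DH

namespace DH
set_option linter.unusedSectionVars false
open Filter Topology Matrix MatrixGroups

/-- orbits with fundamental discriminant -/
def FO (e X : ℝ) : Set Orb := toOrb '' {f | 0 < e * ((fdisc f : ℤ) : ℝ) ∧ |((fdisc f : ℤ) : ℝ)| ≤ X ∧ Fund (fdisc f)}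
def FD (e X : ℝ) : Set ℤ := {D | 0 < e * (D : ℝ) ∧ |(D : ℝ)| ≤ X ∧ Fund D}

lemma int_abs_fin (X : ℝ) : {D : ℤ | |(D : ℝ)| ≤ X}.Finite := by
  refine (Set.finite_Icc (-⌊X⌋) ⌊X⌋).subset ?_
  intro D hD
  have hD : |(D : ℝ)| ≤ X := hD
  rw [← Int.cast_abs, ← Int.le_floor] at hD
  exact abs_le.1 hD

lemma FD_fin (e X : ℝ) : (FD e X).Finite := (int_abs_fin X).subset fun _ h => h.2.1

noncomputable def T0 (e : ℝ) : ℝ := √(1 / (4 * |e| ^ 3))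

lemma T0_scale (e : ℝ) {l : ℝ} : √(l ^ 4 / (4 * |e| ^ 3)) = l ^ 2 * T0 e := by
  rw [T0, show l ^ 4 / (4 * |e| ^ 3) = (l ^ 2) ^ 2 * (1 / (4 * |e| ^ 3)) by ring,
    Real.sqrt_mul (by positivity), Real.sqrt_sq (by positivity)]

/-- scaled set -/
def SL (l : ℝ) (s : Set (Fin 4 → ℝ)) (M : ℕ) : Set (Fin 4 → ℤ) :=
  {f : Fin 4 → ℤ | (fun i => (f i : ℝ) / l) ∈ s ∧ ∀ p ∈ Nat.primesBelow M, FundAt p (fdisc f)}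

lemma FO_sub (e X : ℝ) : FO e X ⊆ Ob e X := by
  rintro _ ⟨f, h, rfl⟩; exact ⟨f, ⟨h.1, h.2.1⟩, rfl⟩

lemma neg_orb (f : Fin 4 → ℤ) : toOrb (-f) = toOrb f := by
  have := toOrb_gact (-1) f
  rwa [gact_neg, gact_one] at this

lemma fdisc_negf (f : Fin 4 → ℤ) : fdisc (-f) = fdisc f := fdisc_of_toOrb (neg_orb f)

lemma toR_neg {σ e u v p q : ℝ} {f : Fin 4 → ℤ} (h : toR f = Psi σ e u v p q) :
    toR (-f) = Psi σ e u v (-p) (-q) := by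
  have h1 : toR (-f) = fun i => (-1) * toR f i := by
    funext i; simp [toR]
  rw [h1, h]
  have := Psi_smul (σ := σ) (e := e) (u := u) (v := v) (p := p) (q := q) (-1)
  rw [← this]; simp

lemma scale_mem {σ e u v p q l : ℝ} (hl : 0 < l) {f : Fin 4 → ℤ} (h : toR f = Psi σ e u v p q) :
    (fun i => (f i : ℝ) / l) = Phi σ e ![u, v, p / l, q / l] := by
  have h1 := Psi_smul (σ := σ) (e := e) (u := u) (v := v) (p := p / l) (q := q / l) l
  rw [mul_div_cancel₀ _ hl.ne', mul_div_cancel₀ _ hl.ne', ← h] at h1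
  funext i
  have := congrFun h1 i
  simp only [toR] at this
  rw [this, mul_div_cancel_left₀ _ hl.ne']
  rfl

lemma scale_mem' {σ e l : ℝ} (hl : 0 < l) {f : Fin 4 → ℤ} {x : Fin 4 → ℝ} (h : Phi σ e x = (fun i => (f i : ℝ) / l)) :
    toR f = Psi σ e (x 0) (x 1) (l * x 2) (l * x 3) := by
  rw [Psi_smul]
  funext i
  have := congrFun h i
  simp only [Phi] at this
  rw [this, toR]
  field_simp

section
variable {σ e : ℝ} (hs : Sg σ e)
include hs

lemma FO_fin {X : ℝ} (hX : 0 ≤ X) : (FO e X).Finite := (Ob_bound hs hX).1.subset (FO_sub e X)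

lemma FO_upper {l Y : ℝ} (hl : 0 < l) (hY : 1 ≤ Y) (M : ℕ) :
    ((FO e (l ^ 4)).ncard : ℝ) ≤ (FD e (l ^ 4)).ncard + ((SL l (Phi σ e '' Rc Y (T0 e)) M).ncard : ℝ) / 2 +
      ((redS σ e Y (l ^ 2 * T0 e)).ncard : ℝ) / 2 := by
  classical
  have hfin := FO_fin hs (X := l ^ 4) (by positivity)
  set A := SL l (Phi σ e '' Rc Y (T0 e)) M with hA
  set B := redS σ e Y (l ^ 2 * T0 e) with hB
  have hBf : B.Finite := (red_bound hs (by linarith)).1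
  have hAf : A.Finite := (lat_finite Sc_compact.isBounded hl).subset fun f hf => hf.1
  set Z := (fun D => toOrb (zf D)) '' FD e (l ^ 4) with hZ
  have hZf : Z.Finite := (FD_fin _ _).image _
  have hsub : ∀ o ∈ FO e (l ^ 4) \ Z, ∃ f, toOrb f = o ∧ f 0 ≠ 0 ∧ f ∈ A ∪ B ∧ -f ∈ A ∪ B := by
    rintro _ ⟨⟨f, ⟨h1, h2, h3⟩, rfl⟩, hnZ⟩
    obtain ⟨g, u, v, p, q, h, a1, a2, a3⟩ := red_exists hs f h1
    have hd : fdisc (gact g f) = fdisc f := fdisc_gact g f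
    have h0 : gact g f 0 ≠ 0 := by
      intro h0
      apply hnZ
      refine ⟨fdisc f, ⟨h1, h2, h3⟩, ?_⟩
      have := zf_uniq h0 (by rwa [hd])
      rw [hd, toOrb_gact] at this
      exact this.symm
    have hT : v ^ 3 * (p ^ 2 + q ^ 2) ≤ l ^ 2 * T0 e := by
      rw [← T0_scale, ← T_bound hs h a3 (by positivity), hd]; exact h2
    refine ⟨gact g f, toOrb_gact _ _, h0, ?_⟩
    have key : ∀ f' : Fin 4 → ℤ, ∀ p q, toR f' = Psi σ e u v p q → f' 0 ≠ 0 → fdisc f' = fdisc f →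
        v ^ 3 * (p ^ 2 + q ^ 2) ≤ l ^ 2 * T0 e → f' ∈ A ∪ B := by
      intro f' p q h h0 hd hT
      rcases le_total v Y with hvY | hvY
      · left
        refine ⟨?_, fun r hr => ?_⟩
        · rw [scale_mem hl h]
          refine ⟨_, ⟨a1, a2, a3.le, hvY, ?_⟩, rfl⟩
          have : v ^ 3 * (p ^ 2 + q ^ 2) / l ^ 2 ≤ T0 e := by rw [div_le_iff₀ (by positivity)]; linarith
          calc _ = v ^ 3 * (p ^ 2 + q ^ 2) / l ^ 2 := by simp; field_simp
            _ ≤ _ := this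
        · rw [hd]; exact h3 r (Nat.prime_of_mem_primesBelow hr)
      · right
        exact ⟨h0, u, v, p, q, h, a1, a2, a3, hvY, hT⟩
    refine ⟨key _ p q h h0 hd hT, key _ (-p) (-q) (toR_neg h) (by simpa using h0) (by rw [fdisc_negf, hd]) ?_⟩
    simpa using hT
  choose! r hr1 hr2 hr3 hr4 using hsub
  have hdf : (FO e (l ^ 4) \ Z).Finite := hfin.subset Set.diff_subset
  have h2 : 2 * (FO e (l ^ 4) \ Z).ncard ≤ (A ∪ B).ncard := by
    rw [Set.ncard_eq_toFinset_card _ hdf, Set.ncard_eq_toFinset_card _ (hAf.union hBf)]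
    rw [show 2 * hdf.toFinset.card = (hdf.toFinset ×ˢ (Finset.univ : Finset Bool)).card by
      rw [Finset.card_product, Finset.card_univ, Fintype.card_bool, mul_comm]]
    refine Finset.card_le_card_of_injOn (fun x => if x.2 then r x.1 else - r x.1) ?_ ?_
    · rintro ⟨o, b⟩ hx
      simp only [Finset.mem_coe, Finset.mem_product, Set.Finite.mem_toFinset] at hx ⊢
      cases b
      · simpa using hr4 o hx.1
      · simpa using hr3 o hx.1
    · rintro ⟨o, b⟩ hx ⟨o', b'⟩ hx' heq
      simp only [Finset.mem_coe, Finset.mem_product, Set.Finite.mem_toFinset] at hx hx'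
      have e1 : ∀ o b, o ∈ FO e (l ^ 4) \ Z → toOrb (if b = true then r o else - r o) = o := by
        intro o b ho
        split_ifs
        · exact hr1 o ho
        · rw [neg_orb]; exact hr1 o ho
      simp only at heq
      have e2 := e1 o b hx.1
      rw [heq, e1 o' b' hx'.1] at e2
      subst e2
      have h0 := hr2 o' hx.1
      have h00 := congrFun heq 0
      congr 1
      cases b <;> cases b' <;> first | rfl | (simp at h00; omega)
  have h3 : (FO e (l ^ 4)).ncard ≤ (FD e (l ^ 4)).ncard + (FO e (l ^ 4) \ Z).ncard := by
    calc (FO e (l ^ 4)).ncard ≤ (Z ∪ (FO e (l ^ 4) \ Z)).ncard := by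
          refine Set.ncard_le_ncard ?_ (hZf.union hdf)
          rw [Set.union_diff_self]; exact Set.subset_union_right
      _ ≤ Z.ncard + (FO e (l ^ 4) \ Z).ncard := Set.ncard_union_le _ _
      _ ≤ _ := Nat.add_le_add_right (Set.ncard_image_le (FD_fin _ _)) _
  have h4 : (A ∪ B).ncard ≤ A.ncard + B.ncard := Set.ncard_union_le _ _
  have h5 : (2 * (FO e (l ^ 4)).ncard : ℝ) ≤ 2 * (FD e (l ^ 4)).ncard + A.ncard + B.ncard := by
    exact_mod_cast (by omega : 2 * (FO e (l ^ 4)).ncard ≤ 2 * (FD e (l ^ 4)).ncard + A.ncard + B.ncard)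
  linarith

/-- interior forms: at most two per orbit -/
lemma two_to_one {l Y T : ℝ} (hl : 0 < l) (G : Finset (Fin 4 → ℤ))
    (hG : ∀ f ∈ G, (fun i => (f i : ℝ) / l) ∈ Phi σ e '' Ro Y T) [DecidableEq Orb] :
    G.card ≤ 2 * (G.image toOrb).card := by
  refine Finset.card_le_mul_card_image _ _ ?_
  intro o ho
  rw [Finset.mem_image] at ho
  obtain ⟨f, hf, rfl⟩ := ho
  obtain ⟨x, ⟨x1, x2, x3, x4, x5, x6⟩, hx⟩ := hG f hf
  have hfx := scale_mem' hl hx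
  refine (Finset.card_le_card (t := {f, -f}) ?_).trans Finset.card_le_two
  intro f' hf'
  rw [Finset.mem_filter] at hf'
  obtain ⟨y, ⟨y1, y2, y3, y4, y5, y6⟩, hy⟩ := hG f' hf'.1
  have hfy := scale_mem' hl hy
  obtain ⟨g, hg⟩ := toOrb_eq.1 hf'.2.symm
  rw [← hg] at hfy
  have hw : 0 < (l * x 2) ^ 2 + (l * x 3) ^ 2 := by
    have : l * x 2 ≠ 0 := mul_ne_zero hl.ne' x6
    positivity
  have := red_unique hs hfx x1 x2 x3 hw hfy y1.le y2.le y3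
  rw [hg] at this
  simpa using this

lemma sgn_pos {u v p q : ℝ} {f : Fin 4 → ℤ} (h : toR f = Psi σ e u v p q) (hv : 0 < v) (hp : p ≠ 0) :
    0 < e * ((fdisc f : ℤ) : ℝ) := by
  rw [← fdisc_toR, h, fdisc_Psi hs]
  have he := e_ne hs
  have : e * (4 * e ^ 3 * (v ^ 3 * (p ^ 2 + q ^ 2)) ^ 2) = 4 * (e ^ 2 * (v ^ 3 * (p ^ 2 + q ^ 2))) ^ 2 := by ring
  rw [this]; positivity

lemma FO_lower1 {l Y : ℝ} (hl : 0 < l) (G : Finset (Fin 4 → ℤ))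
    (hG : ∀ f ∈ G, (fun i => (f i : ℝ) / l) ∈ Phi σ e '' Ro Y (T0 e) ∧ Fund (fdisc f) ∧ 4 ≤ e * ((fdisc f : ℤ) : ℝ)) :
    2 * (FD e (l ^ 4)).ncard + G.card ≤ 2 * (FO e (l ^ 4)).ncard := by
  classical
  have hfin := FO_fin hs (X := l ^ 4) (by positivity)
  have h1 := two_to_one hs hl G (fun f hf => (hG f hf).1)
  set Z := (fun D => toOrb (zf D)) '' FD e (l ^ 4) with hZ
  have hZc : Z.ncard = (FD e (l ^ 4)).ncard := by
    refine Set.ncard_image_of_injOn ?_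
    intro D hD D' hD' h
    have := fdisc_of_toOrb h
    rwa [zf_disc hD.2.2, zf_disc hD'.2.2] at this
  have hZf : Z.Finite := (FD_fin _ _).image _
  have hsub : Z ∪ (G.image toOrb : Finset Orb) ⊆ FO e (l ^ 4) := by
    apply Set.union_subset
    · rintro _ ⟨D, hD, rfl⟩
      refine ⟨zf D, ?_, rfl⟩
      change _ ∧ _ ∧ _
      rw [zf_disc hD.2.2]; exact hD
    · intro o ho
      rw [Finset.mem_coe, Finset.mem_image] at ho
      obtain ⟨f, hf, rfl⟩ := ho
      obtain ⟨⟨x, ⟨x1, x2, x3, x4, x5, x6⟩, hx⟩, g2, g3⟩ := hG f hf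
      have hfx := scale_mem' hl hx
      refine ⟨f, ⟨by linarith, ?_, g2⟩, rfl⟩
      rw [T_bound hs hfx x3 (by positivity), T0_scale]
      calc _ = l ^ 2 * (x 1 ^ 3 * (x 2 ^ 2 + x 3 ^ 2)) := by ring
        _ ≤ _ := by gcongr
  have hdis : Disjoint Z (G.image toOrb : Finset Orb) := by
    rw [Set.disjoint_left]
    rintro _ ⟨D, hD, rfl⟩ ho
    rw [Finset.mem_coe, Finset.mem_image] at ho
    obtain ⟨f, hf, hfo⟩ := ho
    obtain ⟨⟨x, ⟨x1, x2, x3, x4, x5, x6⟩, hx⟩, g2, g3⟩ := hG f hf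
    have hfx := scale_mem' hl hx
    have hf0 : f 0 ≠ 0 := by
      intro h
      have := congrFun hfx 0
      simp only [toR, Psi_0, h, Int.cast_zero] at this
      exact mul_ne_zero hl.ne' x6 this.symm
    exact int_not_zero hs hfx x1 x2 x3 hf0 g2 g3 (by simp [zf]) hfo
  have h2 := Set.ncard_le_ncard hsub hfin
  rw [Set.ncard_union_eq hdis hZf (Finset.finite_toSet _), hZc, Set.ncard_coe_finset] at h2
  omega

end

end DH

namespace DH
set_option linter.unusedSectionVars false
open Filter Topology Matrix MatrixGroups

lemma sum_sq_le {M L : ℕ} (hM : 1 ≤ M) : ∑ p ∈ (Finset.Ioo (M - 1) (L + 1)).filter Nat.Prime, ((p : ℝ) ^ 2)⁻¹ ≤ 2 / M := by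
  have a1 := sum_Ioo_inv_sq_le (α := ℝ) (M - 1) (L + 1)
  have a2 : (((M - 1 : ℕ) : ℝ) + 1) = M := by
    have : (M - 1) + 1 = M := by omega
    exact_mod_cast this
  rw [a2] at a1
  refine le_trans ?_ a1
  refine Finset.sum_le_sum_of_subset_of_nonneg (Finset.filter_subset _ _) ?_
  intros; positivity

lemma not_fund_prime {M : ℕ} (hM : 3 ≤ M) {D : ℤ} (h : ∀ p ∈ Nat.primesBelow M, FundAt p D) (hF : ¬ Fund D) :
    ∃ p : ℕ, p.Prime ∧ M ≤ p ∧ (p : ℤ) ^ 2 ∣ D := by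
  simp only [Fund, not_forall] at hF
  obtain ⟨p, hp, hn⟩ := hF
  have hMp : M ≤ p := by
    by_contra hlt
    exact hn (h p (Nat.mem_primesBelow.2 ⟨by omega, hp⟩))
  refine ⟨p, hp, hMp, ?_⟩
  rw [FundAt, if_neg (by omega), not_not] at hn
  exact hn

section
variable {σ e : ℝ} (hs : Sg σ e)
include hs

lemma FO_lower (Y : ℝ) : ∃ C R : ℝ, ∀ M : ℕ, 5 ≤ M → ∀ l : ℝ, 1 ≤ l →
    ((SL l (Phi σ e '' Ro Y (T0 e)) M).ncard : ℝ) ≤ 2 * ((FO e (l ^ 4)).ncard - (FD e (l ^ 4)).ncard) + C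
      + 324 * (R * l) ^ 4 / M + 135 * (R * l) ^ 3 + 16 * 10 ^ 8 * l ^ 4 / M := by
  classical
  obtain ⟨R0, hR0⟩ := (Sc_compact (σ := σ) (e := e) (Y := Y) (T := T0 e)).isBounded.subset_closedBall 0
  set R1 := max R0 1
  have hR1 : 1 ≤ R1 := le_max_right _ _
  set BS := redS σ e (4 / 5) √(12 / (4 * |e| ^ 3)) with hBS
  have hBf : BS.Finite := (red_bound hs le_rfl).1
  refine ⟨BS.ncard, 2 * R1, ?_⟩
  intro M hM l hl1
  have hl : 0 < l := by linarith
  have hsub0 : SL l (Phi σ e '' Ro Y (T0 e)) M ⊆ {f | (fun i => (f i : ℝ) / l) ∈ Phi σ e '' Rc Y (T0 e)} :=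
    fun f hf => Set.image_mono Ro_sub hf.1
  have hAf : (SL l (Phi σ e '' Ro Y (T0 e)) M).Finite := (lat_finite Sc_compact.isBounded hl).subset hsub0
  rw [Set.ncard_eq_toFinset_card _ hAf]
  set A := hAf.toFinset
  set N := ⌈R1 * l⌉₊
  have hRl : 1 ≤ R1 * l := one_le_mul_of_one_le_of_one_le hR1 hl1
  have hN1 : 1 ≤ N := Nat.one_le_ceil_iff.2 (by positivity)
  have hNle : (N : ℝ) ≤ 2 * R1 * l := by
    have := Nat.ceil_lt_add_one (show 0 ≤ R1 * l by positivity)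
    linarith
  have hmem : ∀ f ∈ A, (∃ x ∈ Ro Y (T0 e), toR f = Psi σ e (x 0) (x 1) (l * x 2) (l * x 3)) ∧
      (∀ i, |f i| ≤ N) ∧ f 0 ≠ 0 ∧ 0 < e * ((fdisc f : ℤ) : ℝ) ∧ |((fdisc f : ℤ) : ℝ)| ≤ l ^ 4 := by
    intro f hf
    have hf := hAf.mem_toFinset.1 hf
    obtain ⟨x, hxR, hx⟩ := hf.1
    obtain ⟨x1, x2, x3, x4, x5, x6⟩ := hxR
    have hfx := scale_mem' hl hx
    refine ⟨⟨x, ⟨x1, x2, x3, x4, x5, x6⟩, hfx⟩, ?_, ?_, ?_, ?_⟩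
    · intro i
      have h1 := hR0 (hsub0 hf)
      rw [mem_closedBall_zero_iff] at h1
      have h2 := (norm_le_pi_norm _ i).trans h1
      rw [Real.norm_eq_abs, abs_div, abs_of_pos hl, div_le_iff₀ hl] at h2
      have h3 : |(f i : ℝ)| ≤ N := h2.trans ((mul_le_mul_of_nonneg_right (le_max_left _ _) hl.le).trans (Nat.le_ceil _))
      exact_mod_cast h3
    · intro h
      have := congrFun hfx 0
      simp only [toR, Psi_0, h, Int.cast_zero] at this
      exact mul_ne_zero hl.ne' x6 this.symm
    · exact sgn_pos hs hfx x3 (mul_ne_zero hl.ne' x6)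
    · rw [T_bound hs hfx x3 (by positivity), T0_scale]
      calc _ = l ^ 2 * (x 1 ^ 3 * (x 2 ^ 2 + x 3 ^ 2)) := by ring
        _ ≤ _ := by gcongr
  set G := A.filter (fun f => Fund (fdisc f) ∧ 4 ≤ e * ((fdisc f : ℤ) : ℝ)) with hG
  set T1 := A.filter (fun f => ∃ p : ℕ, p.Prime ∧ M ≤ p ∧ hdv p f) with hT1
  set L := ⌊l ^ 2⌋₊
  set Q := (Finset.Ioo (M - 1) (L + 1)).filter Nat.Prime with hQ
  set T2 := Q.biUnion (fun p => A.filter (fun f => toOrb f ∈ ty2 e p (l ^ 4))) with hT2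
  have hcov : A ⊆ ((G ∪ hBf.toFinset) ∪ T1) ∪ T2 := by
    intro f hf
    obtain ⟨⟨x, ⟨x1, x2, x3, x4, x5, x6⟩, hfx⟩, b1, b2, b3, b4⟩ := hmem f hf
    have hfF := (hAf.mem_toFinset.1 hf).2
    simp only [Finset.mem_union]
    by_cases hF : Fund (fdisc f)
    · left; left
      by_cases h4 : 4 ≤ e * ((fdisc f : ℤ) : ℝ)
      · left; exact Finset.mem_filter.2 ⟨hf, hF, h4⟩
      · right
        rw [Set.Finite.mem_toFinset]
        refine ⟨b2, _, _, _, _, hfx, x1.le, x2.le, x3, ?_, ?_⟩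
        · have : x 0 ^ 2 ≤ 1 / 4 := by rw [← sq_abs]; nlinarith [abs_nonneg (x 0)]
          nlinarith
        · rw [← T_bound hs hfx x3 (by norm_num)]
          rw [abs_le]
          rcases hs.h with ⟨-, rfl⟩ | ⟨-, rfl⟩ <;> constructor <;> linarith
    · obtain ⟨p, hp, hMp, hpD⟩ := not_fund_prime (by omega) hfF hF
      by_cases hh : hdv p f
      · left; right; exact Finset.mem_filter.2 ⟨hf, p, hp, hMp, hh⟩
      · right
        rw [hT2, Finset.mem_biUnion]
        refine ⟨p, Finset.mem_filter.2 ⟨Finset.mem_Ioo.2 ⟨by omega, ?_⟩, hp⟩, Finset.mem_filter.2 ⟨hf, f, ⟨b3, b4, hpD, hh⟩, rfl⟩⟩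
        rw [Nat.lt_succ_iff, Nat.le_floor_iff (by positivity)]
        have hD0 : fdisc f ≠ 0 := by
          intro h; rw [h] at b3; simp at b3
        have h1 := Int.le_of_dvd (abs_pos.2 hD0) ((dvd_abs _ _).2 hpD)
        have h2 : (p : ℝ) ^ 2 ≤ (l ^ 2) ^ 2 := by
          calc (p : ℝ) ^ 2 ≤ ((|fdisc f| : ℤ) : ℝ) := by exact_mod_cast h1
            _ = |((fdisc f : ℤ) : ℝ)| := Int.cast_abs
            _ ≤ l ^ 4 := b4
            _ = _ := by ring
        exact (pow_le_pow_iff_left₀ (by positivity) (by positivity) two_ne_zero).1 h2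
  have c0 : A.card ≤ G.card + BS.ncard + T1.card + T2.card := by
    refine (Finset.card_le_card hcov).trans ?_
    rw [Set.ncard_eq_toFinset_card _ hBf]
    refine (Finset.card_union_le _ _).trans (Nat.add_le_add_right ?_ _)
    refine (Finset.card_union_le _ _).trans (Nat.add_le_add_right ?_ _)
    exact Finset.card_union_le _ _
  have c1 := FO_lower1 hs hl (Y := Y) G (fun f hf => by
    rw [Finset.mem_filter] at hf
    exact ⟨(hAf.mem_toFinset.1 hf.1).1, hf.2⟩)
  have c2 := ty1_bound hN1 (by omega : 1 ≤ M) T1 (fun f hf => by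
    rw [Finset.mem_filter] at hf
    obtain ⟨-, b1, b2, -⟩ := hmem f hf.1
    exact ⟨b1, b2, hf.2⟩)
  have hM0 : (0 : ℝ) < M := by exact_mod_cast (by omega : 0 < M)
  have c3 : (T2.card : ℝ) ≤ 16 * 10 ^ 8 * l ^ 4 / M := by
    have d1 : (T2.card : ℝ) ≤ ∑ p ∈ Q, ((A.filter (fun f => toOrb f ∈ ty2 e p (l ^ 4))).card : ℝ) := by
      exact_mod_cast Finset.card_biUnion_le
    have d2 : ∀ p ∈ Q, ((A.filter (fun f => toOrb f ∈ ty2 e p (l ^ 4))).card : ℝ) ≤ 8 * 10 ^ 8 * l ^ 4 * ((p : ℝ) ^ 2)⁻¹ := by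
      intro p hp
      rw [Finset.mem_filter, Finset.mem_Ioo] at hp
      have e1 := two_to_one hs hl (A.filter (fun f => toOrb f ∈ ty2 e p (l ^ 4))) (fun f hf => by
        rw [Finset.mem_filter] at hf
        exact (hAf.mem_toFinset.1 hf.1).1)
      have hfin : (ty2 e p (l ^ 4)).Finite := by
        refine (Ob_bound hs (X := l ^ 4) (by positivity)).1.subset ?_
        rintro _ ⟨f, ⟨h1, h2, -⟩, rfl⟩; exact ⟨f, ⟨h1, h2⟩, rfl⟩
      have e2 : ((A.filter (fun f => toOrb f ∈ ty2 e p (l ^ 4))).image toOrb).card ≤ (ty2 e p (l ^ 4)).ncard := by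
        rw [← Set.ncard_coe_finset]
        refine Set.ncard_le_ncard ?_ hfin
        intro o ho
        rw [Finset.mem_coe, Finset.mem_image] at ho
        obtain ⟨f, hf, rfl⟩ := ho
        exact (Finset.mem_filter.1 hf).2
      have e3 := ty2_bound hs hp.2 (by omega) (X := l ^ 4) (by positivity)
      have e4 : ((A.filter (fun f => toOrb f ∈ ty2 e p (l ^ 4))).card : ℝ) ≤ 2 * (ty2 e p (l ^ 4)).ncard := by
        exact_mod_cast e1.trans (Nat.mul_le_mul_left 2 e2)
      have e5 : 8 * 10 ^ 8 * l ^ 4 * ((p : ℝ) ^ 2)⁻¹ = 2 * (4 * 10 ^ 8 * (l ^ 4 / p ^ 2)) := by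
        rw [div_eq_mul_inv]; ring
      rw [e5]; linarith
    have d3 := Finset.sum_le_sum d2
    rw [← Finset.mul_sum] at d3
    have d4 : 8 * 10 ^ 8 * l ^ 4 * ∑ p ∈ Q, ((p : ℝ) ^ 2)⁻¹ ≤ 8 * 10 ^ 8 * l ^ 4 * (2 / M) := by
      gcongr
      exact sum_sq_le (by omega)
    calc _ ≤ _ := d1.trans (d3.trans d4)
      _ = _ := by ring
  have c4 : 324 * (N : ℝ) ^ 4 / M + 135 * N ^ 3 ≤ 324 * (2 * R1 * l) ^ 4 / M + 135 * (2 * R1 * l) ^ 3 := by gcongr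
  have c0' : (A.card : ℝ) ≤ G.card + BS.ncard + T1.card + T2.card := by exact_mod_cast c0
  have c1' : (2 * (FD e (l ^ 4)).ncard + G.card : ℝ) ≤ 2 * (FO e (l ^ 4)).ncard := by exact_mod_cast c1
  linarith

end

end DH

namespace DH
set_option linter.unusedSectionVars false
open Filter Topology Matrix MatrixGroups MeasureTheory

lemma squeeze_eps {g : ℝ → ℝ} {κ : ℝ}
    (hU : ∀ ε > 0, ∃ (u : ℝ → ℝ) (a : ℝ), Tendsto u atTop (𝓝 a) ∧ a < κ + ε ∧ ∀ᶠ l in atTop, g l ≤ u l)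
    (hL : ∀ ε > 0, ∃ (u : ℝ → ℝ) (a : ℝ), Tendsto u atTop (𝓝 a) ∧ κ - ε < a ∧ ∀ᶠ l in atTop, u l ≤ g l) :
    Tendsto g atTop (𝓝 κ) := by
  rw [tendsto_order]
  constructor
  · intro b hb
    obtain ⟨u, a, h1, h2, h3⟩ := hL (κ - b) (by linarith)
    filter_upwards [h3, h1.eventually (lt_mem_nhds (show b < a by linarith))] with l h4 h5
    linarith
  · intro b hb
    obtain ⟨u, a, h1, h2, h3⟩ := hU (b - κ) (by linarith)
    filter_upwards [h3, h1.eventually (gt_mem_nhds (show a < b by linarith))] with l h4 h5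
    linarith

section
variable {σ e : ℝ} (hs : Sg σ e)
include hs

lemma T0_sq : e ^ 2 * T0 e ^ 2 = 1 / (4 * |e|) := by
  have he : 0 < |e| := abs_pos.2 (e_ne hs)
  rw [T0, Real.sq_sqrt (by positivity), ← sq_abs e]
  field_simp

theorem FO_lim : Tendsto (fun l : ℝ => (((FO e (l ^ 4)).ncard : ℝ) - (FD e (l ^ 4)).ncard) / l ^ 4) atTop
    (𝓝 (3 / (Real.pi ^ 2 * |e|))) := by
  have he : 0 < |e| := abs_pos.2 (e_ne hs)
  have hT0 : 0 ≤ T0 e := Real.sqrt_nonneg _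
  have hpi := Real.pi_pos
  have hκ : (2 * Real.pi * e ^ 2 * T0 e ^ 2 * (Real.pi / 3 - 0)) * (6 / Real.pi ^ 2) ^ 2 / 2 = 3 / (Real.pi ^ 2 * |e|) := by
    rw [show 2 * Real.pi * e ^ 2 * T0 e ^ 2 = 2 * Real.pi * (e ^ 2 * T0 e ^ 2) by ring, T0_sq hs]
    field_simp; ring
  have hinv : Tendsto (fun n : ℕ => 1 / (n : ℝ)) atTop (𝓝 0) := tendsto_one_div_atTop_nhds_zero_nat
  apply squeeze_eps
  · intro ε hε
    have h1 : Tendsto (fun n : ℕ => (2 * Real.pi * e ^ 2 * T0 e ^ 2 * (Real.pi / 3 - 1 / (n : ℝ))) * EP n ^ 2 / 2 +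
        4000000 * T0 e ^ 2 * (1 / (n : ℝ))) atTop (𝓝 (3 / (Real.pi ^ 2 * |e|))) := by
      rw [← hκ]
      have := ((((hinv.const_sub (Real.pi / 3)).const_mul (2 * Real.pi * e ^ 2 * T0 e ^ 2)).mul (EP_tendsto.pow 2)).div_const 2).add
        (hinv.const_mul (4000000 * T0 e ^ 2))
      simpa using this
    obtain ⟨n, hn, hn1⟩ := ((h1.eventually (gt_mem_nhds (show _ < 3 / (Real.pi ^ 2 * |e|) + ε by linarith))).and (eventually_ge_atTop 1)).exists
    have hn1' : (1 : ℝ) ≤ n := by exact_mod_cast hn1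
    have hd := dens4 n (s := Phi σ e '' Rc n (T0 e)) Sc_compact.isBounded (Sc_front hs)
    rw [vol_Sc_eq hs, vol_So hs hn1' hT0] at hd
    refine ⟨_, _, (hd.div_const 2).add_const (4000000 * T0 e ^ 2 * (1 / (n : ℝ))), hn, ?_⟩
    filter_upwards [eventually_gt_atTop 0] with l hl
    have hu := FO_upper hs hl hn1' n
    have hr := (red_bound hs (V := n) (T := l ^ 2 * T0 e) (by linarith)).2
    rw [div_le_iff₀ (by positivity)]
    have e1 : ((((SL l (Phi σ e '' Rc n (T0 e)) n).ncard : ℕ) : ℝ) / l ^ 4 / 2 + 4000000 * T0 e ^ 2 * (1 / (n : ℝ))) * l ^ 4 =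
      ((SL l (Phi σ e '' Rc n (T0 e)) n).ncard : ℝ) / 2 + (8000000 * (l ^ 2 * T0 e) ^ 2 / n) / 2 := by
      field_simp; ring
    calc _ ≤ ((SL l (Phi σ e '' Rc n (T0 e)) n).ncard : ℝ) / 2 + (8000000 * (l ^ 2 * T0 e) ^ 2 / n) / 2 := by linarith
      _ = _ := e1.symm
  · intro ε hε
    have h1 : Tendsto (fun n : ℕ => (2 * Real.pi * e ^ 2 * T0 e ^ 2 * (Real.pi / 3 - 1 / (n : ℝ))) * (6 / Real.pi ^ 2) ^ 2 / 2)
        atTop (𝓝 (3 / (Real.pi ^ 2 * |e|))) := by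
      rw [← hκ]
      exact ((((hinv.const_sub (Real.pi / 3)).const_mul (2 * Real.pi * e ^ 2 * T0 e ^ 2)).mul_const _).div_const 2)
    obtain ⟨n, hn, hn1⟩ := ((h1.eventually (lt_mem_nhds (show 3 / (Real.pi ^ 2 * |e|) - ε < _ by linarith))).and (eventually_ge_atTop 1)).exists
    have hn1' : (1 : ℝ) ≤ n := by exact_mod_cast hn1
    obtain ⟨C, R, hCR⟩ := FO_lower hs (n : ℝ)
    have h2 : Tendsto (fun m : ℕ => ((2 * Real.pi * e ^ 2 * T0 e ^ 2 * (Real.pi / 3 - 1 / (n : ℝ))) * EP m ^ 2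
        - (0 + 324 * R ^ 4 * (1 / (m : ℝ)) + 0 + 16 * 10 ^ 8 * (1 / (m : ℝ)))) / 2)
        atTop (𝓝 ((2 * Real.pi * e ^ 2 * T0 e ^ 2 * (Real.pi / 3 - 1 / (n : ℝ))) * (6 / Real.pi ^ 2) ^ 2 / 2)) := by
      have := (((EP_tendsto.pow 2).const_mul (2 * Real.pi * e ^ 2 * T0 e ^ 2 * (Real.pi / 3 - 1 / (n : ℝ)))).sub
        (((hinv.const_mul (324 * R ^ 4)).const_add 0).add_const 0 |>.add (hinv.const_mul (16 * 10 ^ 8)))).div_const 2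
      simpa using this
    obtain ⟨m, hm, hm5⟩ := ((h2.eventually (lt_mem_nhds hn)).and (eventually_ge_atTop 5)).exists
    have hd := dens4 m (s := Phi σ e '' Ro n (T0 e)) (Sc_compact.isBounded.subset (Set.image_mono Ro_sub)) (So_front hs)
    rw [vol_So hs hn1' hT0] at hd
    have t1 : Tendsto (fun l : ℝ => C / l ^ 4) atTop (𝓝 0) :=
      tendsto_const_nhds.div_atTop (tendsto_pow_atTop (by norm_num))
    have t2 : Tendsto (fun l : ℝ => 135 * R ^ 3 / l) atTop (𝓝 0) := tendsto_const_nhds.div_atTop tendsto_id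
    refine ⟨_, _, (hd.sub (((t1.add_const (324 * R ^ 4 * (1 / (m : ℝ)))).add t2).add_const (16 * 10 ^ 8 * (1 / (m : ℝ))))).div_const 2, hm, ?_⟩
    filter_upwards [eventually_ge_atTop 1] with l hl
    have hl0 : 0 < l := by linarith
    have hb := hCR m hm5 l hl
    have hm0 : (0 : ℝ) < m := by exact_mod_cast (by omega : 0 < m)
    rw [le_div_iff₀ (by positivity)]
    have e1 : (((((SL l (Phi σ e '' Ro n (T0 e)) m).ncard : ℕ) : ℝ) / l ^ 4 -
        (C / l ^ 4 + 324 * R ^ 4 * (1 / (m : ℝ)) + 135 * R ^ 3 / l + 16 * 10 ^ 8 * (1 / (m : ℝ)))) / 2) * l ^ 4 =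
      (((SL l (Phi σ e '' Ro n (T0 e)) m).ncard : ℝ) - (C + 324 * (R * l) ^ 4 / m + 135 * (R * l) ^ 3 + 16 * 10 ^ 8 * l ^ 4 / m)) / 2 := by
      field_simp
    calc _ = _ := e1
      _ ≤ _ := by linarith

end

end DH

namespace DH
set_option linter.unusedSectionVars false
open Filter Topology Matrix MeasureTheory

def s1 (e : ℝ) : Set (Fin 1 → ℝ) := Set.pi Set.univ (fun _ => {t : ℝ | 0 < e * t ∧ |t| ≤ 1})

lemma mem_s1 {e : ℝ} {x : Fin 1 → ℝ} : x ∈ s1 e ↔ 0 < e * x 0 ∧ |x 0| ≤ 1 := by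
  simp [s1]

lemma s1_conv (e : ℝ) : Convex ℝ (s1 e) := by
  refine convex_pi fun i _ => ?_
  have h1 : Convex ℝ {t : ℝ | 0 < e * t} := convex_halfSpace_gt (f := fun t : ℝ => e * t) (IsLinearMap.isLinearMap_smul e) 0
  have h2 : Convex ℝ {t : ℝ | |t| ≤ 1} := by
    have : {t : ℝ | |t| ≤ 1} = Set.Icc (-1) 1 := by ext t; simp [abs_le]
    rw [this]; exact convex_Icc _ _
  exact h1.inter h2

lemma s1_vol {e : ℝ} (he : e ≠ 0) : (volume (s1 e)).toReal = 1 := by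
  rw [s1, volume_pi_pi]
  simp only [Finset.univ_unique, Finset.prod_singleton]
  rcases lt_or_gt_of_ne he with h | h
  · have : {t : ℝ | 0 < e * t ∧ |t| ≤ 1} = Set.Ico (-1) 0 := by
      ext t
      constructor
      · rintro ⟨h1, h2⟩
        exact ⟨(abs_le.1 h2).1, by by_contra hc; nlinarith⟩
      · rintro ⟨h1, h2⟩
        exact ⟨mul_pos_of_neg_of_neg h h2, abs_le.2 ⟨h1, by linarith⟩⟩
    rw [this]; simp
  · have : {t : ℝ | 0 < e * t ∧ |t| ≤ 1} = Set.Ioc 0 1 := by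
      ext t
      constructor
      · rintro ⟨h1, h2⟩
        exact ⟨by by_contra hc; nlinarith, (abs_le.1 h2).2⟩
      · rintro ⟨h1, h2⟩
        exact ⟨mul_pos h h1, abs_le.2 ⟨by linarith, h2⟩⟩
    rw [this]; simp

lemma s1_bdd (e : ℝ) : Bornology.IsBounded (s1 e) := by
  refine (Metric.isBounded_closedBall (x := (0 : Fin 1 → ℝ)) (r := 1)).subset ?_
  intro x hx
  rw [mem_closedBall_zero_iff, pi_norm_le_iff_of_nonneg zero_le_one]
  intro i
  rw [Subsingleton.elim i 0]
  exact (mem_s1.1 hx).2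

def S1 (e l : ℝ) (M : ℕ) : Set (Fin 1 → ℤ) :=
  {f : Fin 1 → ℤ | (fun i => (f i : ℝ) / l) ∈ s1 e ∧ ∀ p ∈ Nat.primesBelow M, FundAt p (f 0)}

lemma mem_S1 {e l : ℝ} (hl : 0 < l) {M : ℕ} {f : Fin 1 → ℤ} : f ∈ S1 e l M ↔
    (0 < e * (f 0 : ℝ) ∧ |(f 0 : ℝ)| ≤ l) ∧ ∀ p ∈ Nat.primesBelow M, FundAt p (f 0) := by
  refine and_congr ?_ Iff.rfl
  rw [mem_s1]
  refine and_congr ?_ ?_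
  · rw [mul_div_assoc']
    exact ⟨fun h => by rwa [div_pos_iff_of_pos_right hl] at h, fun h => div_pos h hl⟩
  · rw [abs_div, abs_of_pos hl, div_le_one hl]

lemma S1_fin {e l : ℝ} (hl : 0 < l) (M : ℕ) : (S1 e l M).Finite :=
  (lat_finite (s1_bdd e) hl).subset fun _ h => h.1

lemma FD_le {e l : ℝ} (hl : 0 < l) (M : ℕ) : (FD e l).ncard ≤ (S1 e l M).ncard := by
  rw [← Set.ncard_image_of_injective (f := fun D : ℤ => (fun _ => D : Fin 1 → ℤ)) _ (fun a b h => congrFun h 0)]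
  refine Set.ncard_le_ncard ?_ (S1_fin hl M)
  rintro _ ⟨D, ⟨h1, h2, h3⟩, rfl⟩
  rw [mem_S1 hl]
  exact ⟨⟨h1, h2⟩, fun p hp => h3 p (Nat.prime_of_mem_primesBelow hp)⟩

lemma mult_count {l : ℝ} (hl : 0 ≤ l) (k : ℕ) (hk : 0 < k) :
    {D : ℤ | D ≠ 0 ∧ |(D : ℝ)| ≤ l ∧ (k : ℤ) ∣ D}.Finite ∧
    (({D : ℤ | D ≠ 0 ∧ |(D : ℝ)| ≤ l ∧ (k : ℤ) ∣ D}.ncard : ℕ) : ℝ) ≤ 2 * l / k := by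
  classical
  have hf : {D : ℤ | D ≠ 0 ∧ |(D : ℝ)| ≤ l ∧ (k : ℤ) ∣ D}.Finite := (int_abs_fin l).subset fun D h => h.2.1
  refine ⟨hf, ?_⟩
  have hk0 : (0 : ℝ) < k := by exact_mod_cast hk
  set n := ⌊l / k⌋₊
  have hsub : {D : ℤ | D ≠ 0 ∧ |(D : ℝ)| ≤ l ∧ (k : ℤ) ∣ D} ⊆
      (((Finset.Icc 1 n).image fun m : ℕ => ((k * m : ℕ) : ℤ)) ∪ ((Finset.Icc 1 n).image fun m : ℕ => -((k * m : ℕ) : ℤ)) : Finset ℤ) := by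
    rintro D ⟨h0, h1, ⟨m, rfl⟩⟩
    have hm : m ≠ 0 := by rintro rfl; simp at h0
    have hmn : m.natAbs ∈ Finset.Icc 1 n := by
      rw [Finset.mem_Icc]
      refine ⟨Int.natAbs_pos.2 hm, Nat.le_floor ?_⟩
      rw [le_div_iff₀ hk0]
      have : ((m.natAbs : ℕ) : ℝ) = |(m : ℝ)| := by
        rw [← Int.cast_abs, Int.abs_eq_natAbs]; simp
      rw [this]
      push_cast at h1
      rw [abs_mul, abs_of_pos hk0] at h1; linarith
    rw [Finset.coe_union, Finset.coe_image, Finset.coe_image]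
    rcases Int.natAbs_eq m with h | h
    · left; refine ⟨m.natAbs, hmn, ?_⟩
      simp only; push_cast; rw [Int.natCast_natAbs] at *; rw [← h]
    · right; refine ⟨m.natAbs, hmn, ?_⟩
      simp only; push_cast; rw [Int.natCast_natAbs] at *; nth_rw 2 [h]; ring
  have h1 := Set.ncard_le_ncard hsub (Finset.finite_toSet _)
  rw [Set.ncard_coe_finset] at h1
  have h2 := h1.trans (Finset.card_union_le _ _)
  have h3 : ((Finset.Icc 1 n).image fun m : ℕ => ((k * m : ℕ) : ℤ)).card ≤ n := Finset.card_image_le.trans (by simp)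
  have h4 : ((Finset.Icc 1 n).image fun m : ℕ => -((k * m : ℕ) : ℤ)).card ≤ n := Finset.card_image_le.trans (by simp)
  have h5 : (n : ℝ) ≤ l / k := Nat.floor_le (by positivity)
  have h6 : (({D : ℤ | D ≠ 0 ∧ |(D : ℝ)| ≤ l ∧ (k : ℤ) ∣ D}.ncard : ℕ) : ℝ) ≤ n + n := by exact_mod_cast h2.trans (by omega)
  calc _ ≤ _ := h6
    _ ≤ l / k + l / k := by linarith
    _ = _ := by ring

lemma FD_ge {e l : ℝ} (hl : 0 < l) {M : ℕ} (hM : 3 ≤ M) : ((S1 e l M).ncard : ℝ) ≤ (FD e l).ncard + 4 * l / M := by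
  classical
  set Q := (Finset.Ioo (M - 1) (⌊l⌋₊ + 1)).filter Nat.Prime with hQ
  set E : ℕ → Set ℤ := fun p => {D : ℤ | D ≠ 0 ∧ |(D : ℝ)| ≤ l ∧ ((p ^ 2 : ℕ) : ℤ) ∣ D} with hE
  have hEf : ∀ p, (E p).Finite := fun p => (int_abs_fin l).subset fun D h => h.2.1
  have hsub : (fun f : Fin 1 → ℤ => f 0) '' S1 e l M ⊆ FD e l ∪ (Q.biUnion fun p => (hEf p).toFinset : Finset ℤ) := by
    rintro _ ⟨f, hf, rfl⟩
    rw [mem_S1 hl] at hf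
    by_cases hF : Fund (f 0)
    · left; exact ⟨hf.1.1, hf.1.2, hF⟩
    · right
      obtain ⟨p, hp, hMp, hpD⟩ := not_fund_prime hM hf.2 hF
      have hD0 : f 0 ≠ 0 := by
        intro h; have := hf.1.1; rw [h] at this; simp at this
      rw [Finset.mem_coe, Finset.mem_biUnion]
      refine ⟨p, Finset.mem_filter.2 ⟨Finset.mem_Ioo.2 ⟨by omega, ?_⟩, hp⟩, (hEf p).mem_toFinset.2 ⟨hD0, hf.1.2, by exact_mod_cast hpD⟩⟩
      rw [Nat.lt_succ_iff, Nat.le_floor_iff hl.le]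
      have h1 := Int.le_of_dvd (abs_pos.2 hD0) ((dvd_abs _ _).2 hpD)
      have hp1 : (1 : ℝ) ≤ p := by exact_mod_cast hp.one_le
      have h2 : (p : ℝ) ^ 2 ≤ l := by
        calc (p : ℝ) ^ 2 ≤ ((|f 0| : ℤ) : ℝ) := by exact_mod_cast h1
          _ = |((f 0 : ℤ) : ℝ)| := Int.cast_abs
          _ ≤ l := hf.1.2
      nlinarith
  have h1 : (S1 e l M).ncard ≤ (FD e l).ncard + (Q.biUnion fun p => (hEf p).toFinset).card := by
    rw [← Set.ncard_image_of_injective (f := fun f : Fin 1 → ℤ => f 0) _ (fun a b h => by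
      funext i; rw [Subsingleton.elim i 0]; exact h), ← Set.ncard_coe_finset]
    exact (Set.ncard_le_ncard hsub ((FD_fin e l).union (Finset.finite_toSet _))).trans (Set.ncard_union_le _ _)
  have h2 : ((Q.biUnion fun p => (hEf p).toFinset).card : ℝ) ≤ ∑ p ∈ Q, ((hEf p).toFinset.card : ℝ) := by
    exact_mod_cast Finset.card_biUnion_le
  have h3 : ∀ p ∈ Q, ((hEf p).toFinset.card : ℝ) ≤ 2 * l * ((p : ℝ) ^ 2)⁻¹ := by
    intro p hp
    have hpp := (Finset.mem_filter.1 hp).2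
    have := (mult_count hl.le (p ^ 2) (pow_pos hpp.pos 2)).2
    rw [← Set.ncard_eq_toFinset_card _ (hEf p)]
    refine this.trans (le_of_eq ?_)
    push_cast; rw [div_eq_mul_inv]
  have h4 := Finset.sum_le_sum h3
  rw [← Finset.mul_sum] at h4
  have h5 : 2 * l * ∑ p ∈ Q, ((p : ℝ) ^ 2)⁻¹ ≤ 2 * l * (2 / M) := by
    gcongr
    exact sum_sq_le (by omega)
  have h6 : ((S1 e l M).ncard : ℝ) ≤ (FD e l).ncard + (Q.biUnion fun p => (hEf p).toFinset).card := by exact_mod_cast h1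
  have h7 : 2 * l * (2 / (M : ℝ)) = 4 * l / M := by ring
  linarith

theorem FD_lim {e : ℝ} (he : e ≠ 0) : Tendsto (fun l : ℝ => ((FD e l).ncard : ℝ) / l) atTop (𝓝 (3 / Real.pi ^ 2)) := by
  have hpi := Real.pi_pos
  have hκ : 1 * (6 / Real.pi ^ 2 / 2) = 3 / Real.pi ^ 2 := by ring
  have hinv : Tendsto (fun n : ℕ => 1 / (n : ℝ)) atTop (𝓝 0) := tendsto_one_div_atTop_nhds_zero_nat
  have hd : ∀ n : ℕ, 3 ≤ n → _ := fun n hn => dens1 n hn (s1_bdd e) ((s1_conv e).addHaar_frontier volume)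
  simp only [s1_vol he] at hd
  apply squeeze_eps
  · intro ε hε
    have h1 : Tendsto (fun n : ℕ => 1 * (EP n / 2)) atTop (𝓝 (3 / Real.pi ^ 2)) := by
      rw [← hκ]; exact (EP_tendsto.div_const 2).const_mul 1
    obtain ⟨n, hn, hn1⟩ := ((h1.eventually (gt_mem_nhds (show _ < 3 / Real.pi ^ 2 + ε by linarith))).and (eventually_ge_atTop 3)).exists
    refine ⟨_, _, hd n hn1, hn, ?_⟩
    filter_upwards [eventually_gt_atTop 0] with l hl
    rw [pow_one]
    gcongr
    exact FD_le hl n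
  · intro ε hε
    have h1 : Tendsto (fun n : ℕ => 1 * (EP n / 2) - 4 * (1 / (n : ℝ))) atTop (𝓝 (3 / Real.pi ^ 2)) := by
      rw [← hκ]
      simpa using ((EP_tendsto.div_const 2).const_mul 1).sub (hinv.const_mul 4)
    obtain ⟨n, hn, hn1⟩ := ((h1.eventually (lt_mem_nhds (show 3 / Real.pi ^ 2 - ε < _ by linarith))).and (eventually_ge_atTop 3)).exists
    refine ⟨_, _, (hd n hn1).sub_const (4 * (1 / (n : ℝ))), hn, ?_⟩
    filter_upwards [eventually_gt_atTop 0] with l hl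
    have hb := FD_ge (e := e) hl hn1
    rw [le_div_iff₀ hl, pow_one]
    have e1 : ((((S1 e l n).ncard : ℕ) : ℝ) / l - 4 * (1 / (n : ℝ))) * l = ((S1 e l n).ncard : ℝ) - 4 * l / n := by
      field_simp
    calc _ = _ := e1
      _ ≤ _ := by linarith

end DH

open NumberField
open scoped Classical

namespace DH
open Module IntermediateField

lemma exists_sD (D : ℤ) : ∃ s : ℂ, s ^ 2 = D := IsAlgClosed.exists_pow_nat_eq (D : ℂ) two_pos
noncomputable def sD (D : ℤ) : ℂ := (exists_sD D).choose
lemma sD_sq (D : ℤ) : sD D ^ 2 = D := (exists_sD D).choose_spec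
noncomputable def Kof (D : ℤ) : IntermediateField ℚ ℂ := ℚ⟮sD D⟯

lemma not_rat {D : ℤ} (h : Fund D) (h1 : D ≠ 1) {s : ℂ} (hs : s ^ 2 = D) :
    s ∉ (algebraMap ℚ ℂ).range := by
  rintro ⟨q, hq⟩
  have h2 : q ^ 2 = (D : ℚ) := by
    have h3 : ((q : ℚ) : ℂ) = s := hq
    rw [← h3] at hs
    exact_mod_cast hs
  have hsq : IsSquare ((D : ℤ) : ℚ) := ⟨q, by rw [← h2]; ring⟩
  rw [Rat.isSquare_intCast_iff] at hsq
  obtain ⟨k, hk⟩ := hsq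
  exact h.not_sq h1 k (by rw [hk]; ring)

lemma finrank_adj {D : ℤ} (h : Fund D) (h1 : D ≠ 1) {s : ℂ} (hs : s ^ 2 = D) :
    finrank ℚ ℚ⟮s⟯ = 2 := by
  have hm : (Polynomial.X ^ 2 - Polynomial.C (D : ℚ)).Monic := Polynomial.monic_X_pow_sub_C _ (by norm_num)
  have ha : Polynomial.aeval s (Polynomial.X ^ 2 - Polynomial.C (D : ℚ)) = 0 := by simp [hs]
  have hi : IsIntegral ℚ s := ⟨_, hm, by simpa [Polynomial.aeval_def] using ha⟩
  rw [IntermediateField.adjoin.finrank hi]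
  apply le_antisymm
  · have := Polynomial.natDegree_le_natDegree (minpoly.min ℚ s hm ha)
    rwa [Polynomial.natDegree_X_pow_sub_C] at this
  · exact (minpoly.two_le_natDegree_iff hi).2 (not_rat h h1 hs)

lemma finrank_Kof {D : ℤ} (h : Fund D) (h1 : D ≠ 1) : finrank ℚ (Kof D) = 2 :=
  finrank_adj h h1 (sD_sq D)

lemma exists_Kof_QD {D : ℤ} (h : Fund D) (h1 : D ≠ 1) [NumberField (Kof D)] :
    ∃ Q : QD (𝓞 (Kof D)), Q.D = D := by
  have hs : (⟨sD D, mem_adjoin_simple_self ℚ (sD D)⟩ : Kof D) ^ 2 = (D : Kof D) := by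
    apply Subtype.ext
    simpa using sD_sq D
  exact exists_QD hs h h1 (finrank_Kof h h1)

lemma absDisc_Kof {D : ℤ} (h : Fund D) (h1 : D ≠ 1) : absDiscC (Kof D) = D.natAbs := by
  have hf : FiniteDimensional ℚ (Kof D) := Module.finite_of_finrank_pos (by rw [finrank_Kof h h1]; norm_num)
  rw [absDiscC, dif_pos hf]
  have : NumberField (Kof D) := ⟨⟩
  obtain ⟨Q, hQ⟩ := exists_Kof_QD h h1
  rw [Q.discr_eq, hQ]

lemma Kof_inj {D D' : ℤ} (h : Fund D) (h1 : D ≠ 1) (h' : Fund D') (h1' : D' ≠ 1)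
    (he : Kof D = Kof D') : D = D' := by
  have hf : FiniteDimensional ℚ (Kof D) := Module.finite_of_finrank_pos (by rw [finrank_Kof h h1]; norm_num)
  have : NumberField (Kof D) := ⟨⟩
  obtain ⟨Q, hQ⟩ := exists_Kof_QD h h1
  have hm : sD D' ∈ Kof D := by rw [he]; exact mem_adjoin_simple_self ℚ (sD D')
  have hs : (⟨sD D', hm⟩ : Kof D) ^ 2 = (D' : Kof D) := by
    apply Subtype.ext
    simpa using sD_sq D'
  obtain ⟨Q', hQ'⟩ := exists_QD hs h' h1' (finrank_Kof h h1)
  rw [← hQ, ← hQ', ← Q.discr_eq, ← Q'.discr_eq]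

lemma fund_of_squarefree {m : ℤ} (hm : Squarefree m) : Fund (if m % 4 = 1 then m else 4 * m) := by
  have key : ∀ p : ℕ, p.Prime → ¬ ((p : ℤ) ^ 2 ∣ m) := by
    intro p hp hd
    have := hm p (by rwa [← sq])
    exact hp.one_lt.ne' (by simpa using Int.isUnit_iff_natAbs_eq.1 this)
  intro p hp
  unfold FundAt
  split_ifs with h2 h4 h4
  · exact Or.inl h4
  · have := key 2 Nat.prime_two
    norm_num at this
    omega
  · exact key p hp
  · intro hd
    have hc : IsCoprime ((p : ℤ) ^ 2) 4 := by
      rw [show (4 : ℤ) = ((2 : ℕ) : ℤ) ^ 2 by norm_num]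
      apply IsCoprime.pow
      exact Nat.isCoprime_iff_coprime.2 ((Nat.coprime_primes hp Nat.prime_two).2 h2)
    exact key p hp (hc.dvd_of_dvd_mul_left hd)

lemma exists_D (K : IntermediateField ℚ ℂ) (hK : finrank ℚ K = 2) :
    ∃ D : ℤ, Fund D ∧ D ≠ 1 ∧ Kof D = K := by
  have hf : FiniteDimensional ℚ K := Module.finite_of_finrank_pos (by rw [hK]; norm_num)
  obtain ⟨x, hx⟩ : ∃ x : K, x ∉ (algebraMap ℚ K).range := by
    by_contra hcon
    push Not at hcon
    have h1 : finrank ℚ K = 1 := by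
      rw [finrank_eq_one_iff_of_nonzero' (1 : K) one_ne_zero]
      intro w
      obtain ⟨q, hq⟩ := hcon w
      exact ⟨q, by rw [← hq, Algebra.algebraMap_eq_smul_one]⟩
    omega
  have hi : IsIntegral ℚ x := IsIntegral.of_finite ℚ x
  have h2 := (minpoly.two_le_natDegree_iff hi).2 hx
  have h3 := minpoly.natDegree_le (A := ℚ) x
  have h4 : (minpoly ℚ x).natDegree = 2 := by omega
  have h5 := minpoly.aeval ℚ x
  have hlead : (minpoly ℚ x).coeff 2 = 1 := by rw [← h4]; exact minpoly.monic hi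
  rw [Polynomial.aeval_eq_sum_range, h4] at h5
  simp only [Finset.sum_range_succ, Finset.sum_range_zero, hlead] at h5
  set b := (minpoly ℚ x).coeff 0
  set a := (minpoly ℚ x).coeff 1
  have h6 : (2 * x + (a : K)) ^ 2 = ((a ^ 2 - 4 * b : ℚ) : K) := by
    simp only [Algebra.smul_def, pow_zero, mul_one, pow_one, map_one, one_mul, zero_add] at h5
    push_cast
    have e1 : (algebraMap ℚ K) b = (b : K) := rfl
    have e2 : (algebraMap ℚ K) a = (a : K) := rfl
    rw [e1, e2] at h5
    linear_combination 4 * h5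
  set r := a ^ 2 - 4 * b
  set y := 2 * x + (a : K)
  have hy : y ∉ (algebraMap ℚ K).range := by
    rintro ⟨q, hq⟩
    apply hx
    refine ⟨(q - a) / 2, ?_⟩
    have e1 : (algebraMap ℚ K) q = (q : K) := rfl
    have e2 : (algebraMap ℚ K) ((q - a) / 2) = (((q - a) / 2 : ℚ) : K) := rfl
    rw [e2]; push_cast
    rw [← e1, hq]; simp only [y]; ring
  have hden : (r.den : K) ≠ 0 := by exact_mod_cast r.den_nz
  have hz : ((r.den : K) * y) ^ 2 = ((r.num * r.den : ℤ) : K) := by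
    have e3 : ((r : ℚ) : K) = (r.num : K) / (r.den : K) := by
      rw [← Rat.cast_natCast, ← Rat.cast_intCast, ← Rat.cast_div, Rat.num_div_den]
    rw [mul_pow, h6, e3]; push_cast; field_simp
  set N : ℤ := r.num * r.den
  have hN : N ≠ 0 := by
    intro h0
    rw [h0] at hz
    simp only [Int.cast_zero, ne_eq, OfNat.ofNat_ne_zero, not_false_eq_true, pow_eq_zero_iff,
      mul_eq_zero, hden, false_or] at hz
    exact hy ⟨0, by rw [hz]; simp⟩
  obtain ⟨m0, k, hmk, hsq⟩ := Nat.sq_mul_squarefree N.natAbs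
  have hk : k ≠ 0 := by
    rintro rfl
    apply hN
    simpa using hmk.symm
  obtain ⟨m, hm, hmN⟩ : ∃ m : ℤ, Squarefree m ∧ N = k ^ 2 * m := by
    refine ⟨N.sign * m0, ?_, ?_⟩
    · rw [← Int.squarefree_natAbs, Int.natAbs_mul, Int.natAbs_sign_of_ne_zero hN]
      simpa using hsq
    · calc N = N.sign * N.natAbs := (Int.sign_mul_natAbs N).symm
        _ = _ := by rw [← hmk]; push_cast; ring
  have hkK : (k : K) ≠ 0 := by exact_mod_cast hk
  set t : K := (r.den : K) * y / k with ht
  have ht2 : t ^ 2 = (m : K) := by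
    rw [ht, div_pow, hz, hmN]; push_cast; field_simp
  have hratt : ∀ q : ℚ, t ≠ (q : K) := by
    intro q hq
    apply hy
    refine ⟨q * k / r.den, ?_⟩
    have e2 : (algebraMap ℚ K) (q * k / r.den) = ((q * k / r.den : ℚ) : K) := rfl
    rw [e2]; push_cast
    rw [← hq, ht]
    field_simp
  have hfund := fund_of_squarefree hm
  obtain ⟨D, hD, s, hs, hsr⟩ : ∃ D : ℤ, Fund D ∧ ∃ s : K, s ^ 2 = (D : K) ∧ ∀ q : ℚ, s ≠ (q : K) := by
    refine ⟨_, hfund, ?_⟩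
    split_ifs
    · exact ⟨t, ht2, hratt⟩
    · refine ⟨2 * t, by rw [mul_pow, ht2]; push_cast; ring, fun q hq => hratt (q / 2) ?_⟩
      push_cast
      rw [← hq]; ring
  have hD1 : D ≠ 1 := by
    rintro rfl
    have : (s - 1) * (s + 1) = 0 := by
      push_cast at hs
      linear_combination hs
    rcases mul_eq_zero.1 this with h | h
    · exact hsr 1 (by push_cast; linear_combination h)
    · exact hsr (-1) (by push_cast; linear_combination h)
  refine ⟨D, hD, hD1, ?_⟩
  have hsC : (s : ℂ) ^ 2 = sD D ^ 2 := by
    rw [sD_sq]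
    have := congrArg (fun z : K => (z : ℂ)) hs
    simpa using this
  have hmem : sD D ∈ K := by
    rcases sq_eq_sq_iff_eq_or_eq_neg.1 hsC with h | h
    · rw [← h]; exact s.2
    · rw [show sD D = -(s : ℂ) by rw [h]; ring]; exact neg_mem s.2
  apply IntermediateField.eq_of_le_of_finrank_eq
  · exact adjoin_simple_le_iff.2 hmem
  · rw [finrank_Kof hD hD1, hK]

/-- class number 3-part as a function of `D` -/
noncomputable def hT (D : ℤ) : ℕ := clTor (Kof D) 3

lemma hT_real {D : ℤ} (h : Fund D) (h1 : D ≠ 1) (h0 : 0 < D) : Nat.card (orbD D) = 3 * hT D := by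
  have hf : FiniteDimensional ℚ (Kof D) := Module.finite_of_finrank_pos (by rw [finrank_Kof h h1]; norm_num)
  have : NumberField (Kof D) := ⟨⟩
  obtain ⟨Q, hQ⟩ := exists_Kof_QD h h1
  have hs : (⟨sD D, mem_adjoin_simple_self ℚ (sD D)⟩ : Kof D) ^ 2 = (D : Kof D) := by
    apply Subtype.ext
    simpa using sD_sq D
  have := Q.card_orbD
  rw [card_UCubes_real hs h h1 (finrank_Kof h h1) h0, hQ] at this
  rw [this, mul_comm]; rfl

lemma hT_imag {D : ℤ} (h : Fund D) (h0 : D < -4) : Nat.card (orbD D) = hT D := by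
  have h1 : D ≠ 1 := by omega
  have hf : FiniteDimensional ℚ (Kof D) := Module.finite_of_finrank_pos (by rw [finrank_Kof h h1]; norm_num)
  have : NumberField (Kof D) := ⟨⟩
  obtain ⟨Q, hQ⟩ := exists_Kof_QD h h1
  have := Q.card_orbD
  rw [Q.card_UCubes_imag (by rw [hQ]; exact h0), hQ] at this
  rw [this, mul_one]; rfl

theorem field_sum (X : ℝ) :
    (∑ᶠ K ∈ {K : IntermediateField ℚ ℂ |
            Module.finrank ℚ K = 2 ∧ (absDiscC K : ℝ) ≤ X}, (clTor K 3 : ℝ)) =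
    ∑ᶠ D ∈ {D : ℤ | Fund D ∧ D ≠ 1 ∧ (D.natAbs : ℝ) ≤ X}, (hT D : ℝ) := by
  symm
  apply finsum_mem_eq_of_bijOn Kof
  · refine ⟨?_, ?_, ?_⟩
    · rintro D ⟨h, h1, hX⟩
      exact ⟨finrank_Kof h h1, by rw [absDisc_Kof h h1]; exact hX⟩
    · rintro D ⟨h, h1, -⟩ D' ⟨h', h1', -⟩ he
      exact Kof_inj h h1 h' h1' he
    · rintro K ⟨hK, hX⟩
      obtain ⟨D, h, h1, rfl⟩ := exists_D K hK
      refine ⟨D, ⟨h, h1, ?_⟩, rfl⟩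
      rwa [absDisc_Kof h h1] at hX
  · intro D _; rfl

end DH

namespace DH
open Filter Topology

lemma FO_lim2 {σ e : ℝ} (hs : Sg σ e) :
    Tendsto (fun X : ℝ => ((FO e X).ncard : ℝ) / X) atTop (𝓝 (3 / (Real.pi ^ 2 * |e|) + 3 / Real.pi ^ 2)) := by
  have he : e ≠ 0 := by rcases hs.h with h | h <;> rw [h.2] <;> norm_num
  have hq : Tendsto (fun X : ℝ => √(√X)) atTop atTop :=
    Real.tendsto_sqrt_atTop.comp Real.tendsto_sqrt_atTop
  have h1 := ((FO_lim hs).comp hq).add (FD_lim he)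
  refine h1.congr' ?_
  filter_upwards [eventually_gt_atTop 0] with X hX
  have hX4 : √(√X) ^ 4 = X := by
    rw [show √(√X) ^ 4 = (√(√X) ^ 2) ^ 2 by ring, Real.sq_sqrt (Real.sqrt_nonneg _), Real.sq_sqrt hX.le]
  simp only [Function.comp, hX4]
  field_simp
  ring

lemma mem_orbD {D : ℤ} {o : Orb} : o ∈ orbD D ↔ ∃ f, fdisc f = D ∧ toOrb f = o := Iff.rfl

open scoped Classical in
lemma orb_sum {σ e : ℝ} (hs : Sg σ e) {X : ℝ} (hX : 0 ≤ X) :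
    ∑ D ∈ (FD_fin e X).toFinset, (Nat.card (orbD D) : ℝ) = ((FO e X).ncard : ℝ) := by
  have hsub : ∀ D ∈ FD e X, orbD D ⊆ FO e X := by
    rintro D hD _ ⟨f, hf, rfl⟩
    have hf : fdisc f = D := hf
    exact ⟨f, by subst hf; exact hD, rfl⟩
  have hfin := FO_fin hs hX
  have hU : FO e X = ⋃ D ∈ (FD_fin e X).toFinset, orbD D := by
    ext o
    simp only [Set.mem_iUnion, Set.Finite.mem_toFinset, exists_prop]
    constructor
    · rintro ⟨f, hf, rfl⟩
      exact ⟨fdisc f, hf, f, rfl, rfl⟩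
    · rintro ⟨D, hD, ho⟩; exact hsub D hD ho
  rw [← Nat.cast_sum]
  congr 1
  have hc : ∀ D ∈ (FD_fin e X).toFinset, (orbD D).Finite := fun D hD =>
    hfin.subset (hsub D ((FD_fin e X).mem_toFinset.1 hD))
  have hg : ∃ G : ℤ → Finset Orb, ∀ D ∈ (FD_fin e X).toFinset, (G D : Set Orb) = orbD D :=
    ⟨fun D => if h : (orbD D).Finite then h.toFinset else ∅, fun D hD => by simp [hc D hD]⟩
  obtain ⟨G, hG⟩ := hg
  have h2 : FO e X = (((FD_fin e X).toFinset.biUnion G : Finset Orb) : Set Orb) := by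
    rw [hU, Finset.coe_biUnion]
    exact Set.iUnion₂_congr fun D hD => (hG D hD).symm
  rw [h2, Set.ncard_coe_finset, Finset.card_biUnion]
  · refine Finset.sum_congr rfl fun D hD => ?_
    rw [← hG D hD, Nat.card_coe_set_eq, Set.ncard_coe_finset]
  · intro D hD D' hD' hne
    rw [Function.onFun, ← Finset.disjoint_coe, hG D hD, hG D' hD', Set.disjoint_left]
    rintro _ ⟨f, hf, rfl⟩ ⟨f', hf', h⟩
    have hf : fdisc f = D := hf
    have hf' : fdisc f' = D' := hf'
    exact hne (by rw [← hf, ← hf']; exact (fdisc_of_toOrb h).symm)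

lemma Fund_ne_zero {D : ℤ} (h : Fund D) : D ≠ 0 := by
  rintro rfl
  have := h 2 Nat.prime_two
  simp [FundAt] at this

def TF (X : ℝ) : Set ℤ := {D | Fund D ∧ |(D : ℝ)| ≤ X}
lemma TF_fin (X : ℝ) : (TF X).Finite := (int_abs_fin X).subset fun _ h => h.2

noncomputable def kc (D : ℤ) : ℝ :=
  (if D = 1 then 0 else (hT D : ℝ)) - (if D < 0 then 1 else 1 / 3) * (Nat.card (orbD D) : ℝ)

lemma kc_zero {D : ℤ} (h : Fund D) (h4 : 4 < |(D : ℝ)|) : kc D = 0 := by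
  have h5 : 4 < |D| := by exact_mod_cast h4
  have h1 : D ≠ 1 := by rintro rfl; norm_num at h5
  rw [kc, if_neg h1]
  rcases lt_or_ge D 0 with h0 | h0
  · rw [if_pos h0, hT_imag h (by rw [abs_of_neg h0] at h5; omega)]; ring
  · rw [if_neg (not_lt.2 h0), hT_real h h1 (by rw [abs_of_nonneg h0] at h5; omega)]
    push_cast; ring

lemma main_sum {X : ℝ} (hX : 4 ≤ X) :
    ∑ᶠ D ∈ {D : ℤ | Fund D ∧ D ≠ 1 ∧ (D.natAbs : ℝ) ≤ X}, (hT D : ℝ) =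
    ((FO (-1) X).ncard : ℝ) + ((FO (1 / 3) X).ncard : ℝ) / 3 + ∑ D ∈ (TF_fin 4).toFinset, kc D := by
  have hX0 : 0 ≤ X := by linarith
  have hk : ∑ D ∈ (TF_fin 4).toFinset, kc D = ∑ D ∈ (TF_fin X).toFinset, kc D := by
    apply Finset.sum_subset
    · intro D hD
      rw [Set.Finite.mem_toFinset] at hD ⊢
      exact ⟨hD.1, hD.2.trans hX⟩
    · intro D hD hD'
      rw [Set.Finite.mem_toFinset] at hD hD'
      exact kc_zero hD.1 (not_le.1 fun h => hD' ⟨hD.1, h⟩)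
  have hN : ∀ D : ℤ, ((D.natAbs : ℕ) : ℝ) = |(D : ℝ)| := fun D => by
    rw [Nat.cast_natAbs, Int.cast_abs]
  have hS : {D : ℤ | Fund D ∧ D ≠ 1 ∧ (D.natAbs : ℝ) ≤ X} =
      (((TF_fin X).toFinset.filter (fun D => D ≠ 1) : Finset ℤ) : Set ℤ) := by
    ext D
    simp only [Set.mem_ofPred_eq, Finset.coe_filter, Set.Finite.mem_toFinset, hN, TF]
    tauto
  rw [hS, finsum_mem_coe_finset, Finset.sum_filter]
  have hA : (TF_fin X).toFinset.filter (fun D => D < 0) = (FD_fin (-1) X).toFinset := by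
    ext D
    simp only [Finset.mem_filter, Set.Finite.mem_toFinset, TF, FD, Set.mem_ofPred_eq]
    have : (0 : ℝ) < -1 * (D : ℝ) ↔ D < 0 := by
      rw [neg_one_mul, neg_pos]; exact Int.cast_lt_zero
    rw [this]; tauto
  have hB : (TF_fin X).toFinset.filter (fun D => ¬ D < 0) = (FD_fin (1 / 3) X).toFinset := by
    ext D
    simp only [Finset.mem_filter, Set.Finite.mem_toFinset, TF, FD, Set.mem_ofPred_eq]
    have : (0 : ℝ) < 1 / 3 * (D : ℝ) ↔ 0 < D := by
      rw [mul_pos_iff_of_pos_left (by norm_num)]; exact Int.cast_pos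
    rw [this]
    constructor
    · rintro ⟨⟨h1, h2⟩, h3⟩
      exact ⟨by have := Fund_ne_zero h1; omega, h2, h1⟩
    · rintro ⟨h1, h2, h3⟩
      exact ⟨⟨h3, h2⟩, by omega⟩
  rw [hk, ← orb_sum (σ := -1) ⟨Or.inl ⟨rfl, rfl⟩⟩ hX0, ← orb_sum (σ := 1) ⟨Or.inr ⟨rfl, rfl⟩⟩ hX0, ← hA, ← hB,
    Finset.sum_div, Finset.sum_filter, Finset.sum_filter, ← Finset.sum_add_distrib, ← Finset.sum_add_distrib]
  refine Finset.sum_congr rfl fun D _ => ?_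
  rw [kc]
  by_cases h1 : D = 1 <;> by_cases h0 : D < 0 <;> simp [h1, h0] <;> ring

end DH

/-- **Davenport–Heilbronn.** As `X → ∞`, the sum of `|Cl_K[3]|` over all quadratic
subfields `K ⊂ ℂ` with `D_K ≤ X` is asymptotic to `(2/(3ζ(2)) + 1/ζ(2))·X = (10/π²)·X`;
i.e. `(1/X)·Σ_{[K:ℚ]=2, D_K ≤ X} |Cl_K[3]| → 10/π²`. -/
theorem davenport_heilbronn_average_three_torsion :
    Filter.Tendsto
      (fun X : ℝ =>
        (∑ᶠ K ∈ {K : IntermediateField ℚ ℂ |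
            Module.finrank ℚ K = 2 ∧ (absDiscC K : ℝ) ≤ X}, (clTor K 3 : ℝ)) / X)
      Filter.atTop (nhds (10 / Real.pi ^ 2)) := by
  have hA := DH.FO_lim2 (σ := -1) (e := -1) ⟨Or.inl ⟨rfl, rfl⟩⟩
  have hB := DH.FO_lim2 (σ := 1) (e := 1 / 3) ⟨Or.inr ⟨rfl, rfl⟩⟩
  have hC : Filter.Tendsto (fun X : ℝ => (∑ D ∈ (DH.TF_fin 4).toFinset, DH.kc D) / X) Filter.atTop (nhds 0) :=
    tendsto_const_nhds.div_atTop Filter.tendsto_id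
  have h := (hA.add (hB.div_const 3)).add hC
  have hpi : Real.pi ≠ 0 := Real.pi_ne_zero
  have e1 : 3 / (Real.pi ^ 2 * |(-1 : ℝ)|) + 3 / Real.pi ^ 2 +
      (3 / (Real.pi ^ 2 * |(1 / 3 : ℝ)|) + 3 / Real.pi ^ 2) / 3 + 0 = 10 / Real.pi ^ 2 := by
    rw [abs_neg, abs_one, abs_of_pos (by norm_num : (0 : ℝ) < 1 / 3)]
    field_simp
    norm_num
  rw [e1] at h
  refine h.congr' ?_
  filter_upwards [Filter.eventually_ge_atTop 4] with X hX
  have hf := (DH.field_sum X).trans (DH.main_sum hX)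
  refine Eq.trans ?_ (congrArg (fun t => t / X) hf.symm)
  ring
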